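/- arXiv:math/9201230 — 3 statements merged into one kernel-verified Lean document; each statement's English description precedes it below -/
import Mathlib

section
/- There exists a non-reflexive Banach space X such that both X and its dual X' have Property (w), and neither X' nor X'' is weakly sequentially complete. -/
open Filter Topology

noncomputable section

/-- An operator between normed spaces is *weakly compact* if the image of the closed unit
ball is relatively compact in the weak topology of the codomain. -/
def IsWeaklyCompactOperator {X Y : Type*} [NormedAddCommGroup X] [NormedSpace ℝ X]
    [NormedAddCommGroup Y] [NormedSpace ℝ Y] (T : X →L[ℝ] Y) : Prop :=
  IsCompact (closure (toWeakSpace ℝ Y '' (T '' Metric.closedBall 0 1)))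

/-- An operator between normed spaces is *compact* if the image of the closed unit ball is
relatively norm-compact. -/
def IsCompactOp {X Y : Type*} [NormedAddCommGroup X] [NormedSpace ℝ X]
    [NormedAddCommGroup Y] [NormedSpace ℝ Y] (T : X →L[ℝ] Y) : Prop :=
  IsCompact (closure (T '' Metric.closedBall 0 1))

/-- A Banach space has *Property (w)* if every operator into its dual is weakly compact. -/
def PropertyW (X : Type*) [NormedAddCommGroup X] [NormedSpace ℝ X] : Prop :=
  ∀ T : X →L[ℝ] (X →L[ℝ] ℝ), IsWeaklyCompactOperator T

/-- A normed space is *weakly sequentially complete* if every weakly Cauchy sequence is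
weakly convergent. -/
def WeaklySeqComplete (X : Type*) [NormedAddCommGroup X] [NormedSpace ℝ X] : Prop :=
  ∀ x : ℕ → X,
    (∀ f : X →L[ℝ] ℝ, ∃ L : ℝ, Tendsto (fun n => f (x n)) atTop (𝓝 L)) →
    ∃ x₀ : X, ∀ f : X →L[ℝ] ℝ, Tendsto (fun n => f (x n)) atTop (𝓝 (f x₀))

/-- A normed space is reflexive if the canonical embedding into the double dual is
surjective. -/
def IsReflexiveSpace (X : Type*) [NormedAddCommGroup X] [NormedSpace ℝ X] : Prop :=
  Function.Surjective (NormedSpace.inclusionInDoubleDual ℝ X)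

/-- `(e i)` is a normalized unconditional basic sequence. -/
def IsNormalizedUnconditionalBasic {E : Type*} [NormedAddCommGroup E] [NormedSpace ℝ E]
    (e : ℕ → E) : Prop :=
  (∀ i, ‖e i‖ = 1) ∧
  ∃ C : ℝ, ∀ S F : Finset ℕ, S ⊆ F → ∀ a : ℕ → ℝ,
    ‖∑ i ∈ S, a i • e i‖ ≤ C * ‖∑ i ∈ F, a i • e i‖

/-- `(x i)` dominates `(y i)`. -/
def Dominates {X Y : Type*} [NormedAddCommGroup X] [NormedSpace ℝ X]
    [NormedAddCommGroup Y] [NormedSpace ℝ Y] (x : ℕ → X) (y : ℕ → Y) : Prop :=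
  ∃ C : ℝ, ∀ (s : Finset ℕ) (a : ℕ → ℝ),
    ‖∑ i ∈ s, a i • y i‖ ≤ C * ‖∑ i ∈ s, a i • x i‖

/-- Two sequences are equivalent if each dominates the other. -/
def EquivalentSeq {X Y : Type*} [NormedAddCommGroup X] [NormedSpace ℝ X]
    [NormedAddCommGroup Y] [NormedSpace ℝ Y] (x : ℕ → X) (y : ℕ → Y) : Prop :=
  Dominates x y ∧ Dominates y x

/-- `(v n)` is a block basis of `(e i)`. -/
def IsBlockBasis {E : Type*} [NormedAddCommGroup E] [NormedSpace ℝ E]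
    (e v : ℕ → E) : Prop :=
  ∃ q : ℕ → ℕ, StrictMono q ∧ ∃ a : ℕ → ℝ,
    ∀ n, v n ≠ 0 ∧ v n = ∑ i ∈ Finset.Ico (q n) (q (n + 1)), a i • e i

/-- A sequence is semi-normalized. -/
def SemiNormalized {E : Type*} [NormedAddCommGroup E] (x : ℕ → E) : Prop :=
  ∃ c C : ℝ, 0 < c ∧ ∀ i, c ≤ ‖x i‖ ∧ ‖x i‖ ≤ C

/-- `(e i)` is right dominant. -/
def RightDominantBound {E : Type*} [NormedAddCommGroup E] [NormedSpace ℝ E]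
    (e : ℕ → E) : Prop :=
  ∃ C : ℝ, ∀ m n : ℕ → ℕ, (∀ i, m i ≤ n i) → (∀ i, n i < m (i + 1)) →
    ∀ (s : Finset ℕ) (a : ℕ → ℝ),
      ‖∑ i ∈ s, a i • e (m i)‖ ≤ C * ‖∑ i ∈ s, a i • e (n i)‖

/-- The James norm associated to `(e i)` of a (finitely supported) scalar sequence. -/
def jamesNorm {E : Type*} [NormedAddCommGroup E] [NormedSpace ℝ E]
    (e : ℕ → E) (a : ℕ → ℝ) : ℝ :=
  sSup { x : ℝ | ∃ (k : ℕ) (p : ℕ → ℕ), 0 < k ∧ p 0 = 0 ∧ StrictMono p ∧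
    x = ‖∑ i ∈ Finset.range k, (∑ j ∈ Finset.Ico (p i) (p (i + 1)), a j) • e (p i)‖ }

/-- `X`, together with the sequence `(u i)`, is the James-type space over `(e i)`. -/
def IsJamesSpace {E X : Type*} [NormedAddCommGroup E] [NormedSpace ℝ E]
    [NormedAddCommGroup X] [NormedSpace ℝ X] (e : ℕ → E) (u : ℕ → X) : Prop :=
  Dense (Submodule.span ℝ (Set.range u) : Set X) ∧
  ∀ a : ℕ →₀ ℝ, ‖∑ i ∈ a.support, a i • u i‖ = jamesNorm e (a : ℕ → ℝ)

/-- `(e i)` is shrinking: the span of the biorthogonal functionals is dense in the dual of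
the closed linear span of `(e i)`. -/
def IsShrinking {E : Type*} [NormedAddCommGroup E] [NormedSpace ℝ E] (e : ℕ → E) : Prop :=
  ∃ e' : ℕ → ((Submodule.span ℝ (Set.range e)).topologicalClosure →L[ℝ] ℝ),
    (∀ i j, e' i ⟨e j, Submodule.le_topologicalClosure _
        (Submodule.subset_span (Set.mem_range_self j))⟩ = if i = j then 1 else 0) ∧
    Dense (Submodule.span ℝ (Set.range e') :
      Set ((Submodule.span ℝ (Set.range e)).topologicalClosure →L[ℝ] ℝ))

/-- `E` satisfies an upper `p`-estimate with respect to the unconditional basis `(e i)`. -/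
def UpperPEstimate {E : Type*} [NormedAddCommGroup E] [NormedSpace ℝ E]
    (e : ℕ → E) (p : ℝ) : Prop :=
  ∃ C : ℝ, ∀ (n : ℕ) (x : ℕ → E) (s : ℕ → Finset ℕ) (a : ℕ → ℕ → ℝ),
    (∀ k, k < n → x k = ∑ i ∈ s k, a k i • e i) →
    (∀ k l, k < n → l < n → k ≠ l → Disjoint (s k) (s l)) →
    ‖∑ k ∈ Finset.range n, x k‖ ≤ C * (∑ k ∈ Finset.range n, ‖x k‖ ^ p) ^ (1 / p)

/-- `(e i)` is subsymmetric: unconditional and equivalent to all of its subsequences. -/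
def IsSubsymmetric {E : Type*} [NormedAddCommGroup E] [NormedSpace ℝ E] (e : ℕ → E) : Prop :=
  (∃ C : ℝ, ∀ S F : Finset ℕ, S ⊆ F → ∀ a : ℕ → ℝ,
    ‖∑ i ∈ S, a i • e i‖ ≤ C * ‖∑ i ∈ F, a i • e i‖) ∧
  ∀ φ : ℕ → ℕ, StrictMono φ → EquivalentSeq e (e ∘ φ)

/-- `(e i)` is a symmetric basic sequence: equivalent to all of its permutations. -/
def IsSymmetricSeq {E : Type*} [NormedAddCommGroup E] [NormedSpace ℝ E] (e : ℕ → E) : Prop :=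
  ∀ σ : Equiv.Perm ℕ, EquivalentSeq e (fun i => e (σ i))

/-- A topological space is scattered if every nonempty closed subset has a point isolated
in that subset. -/
def Scattered (K : Type*) [TopologicalSpace K] : Prop :=
  ∀ C : Set K, C.Nonempty → IsClosed C → ∃ x ∈ C, ∃ U : Set K, IsOpen U ∧ U ∩ C = {x}

end

open NormedSpace in
lemma aux_wc {Y Z : Type*} [NormedAddCommGroup Y] [NormedSpace ℝ Y]
    [NormedAddCommGroup Z] [NormedSpace ℝ Z] (T : Y →L[ℝ] Z)
    (h : ∀ Φ : (Y →L[ℝ] ℝ) →L[ℝ] ℝ, ∃ z : Z, ∀ ψ : Z →L[ℝ] ℝ, Φ (ψ.comp T) = ψ z) :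
    IsWeaklyCompactOperator T := by
  choose g hg using h
  have hK : IsCompact (WeakDual.toStrongDual ⁻¹' Metric.closedBall (0 : StrongDual ℝ (Y →L[ℝ] ℝ)) 1) :=
    WeakDual.isCompact_closedBall 0 1
  let G : WeakDual ℝ (Y →L[ℝ] ℝ) → WeakSpace ℝ Z := fun Φ => toWeakSpace ℝ Z (g (WeakDual.toStrongDual Φ))
  have hG : Continuous G := by
    apply WeakBilin.continuous_of_continuous_eval
    intro ψ
    have : (fun a => ((topDualPairing ℝ Z).flip (G a)) ψ) = fun Φ : WeakDual ℝ (Y →L[ℝ] ℝ) => Φ (ψ.comp T) := by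
      funext Φ
      exact (hg _ ψ).symm
    rw [this]
    exact WeakDual.eval_continuous _
  have hc := hK.image hG
  refine hc.closure_of_subset ?_
  rintro _ ⟨_, ⟨y, hy, rfl⟩, rfl⟩
  refine ⟨StrongDual.toWeakDual (inclusionInDoubleDual ℝ Y y), ?_, ?_⟩
  · simp only [Set.mem_preimage, mem_closedBall_zero_iff] at hy ⊢
    have h2 := (double_dual_bound ℝ Y y).trans hy
    exact (mem_closedBall_zero_iff (E := StrongDual ℝ (StrongDual ℝ Y))).2 h2
  · have : g (inclusionInDoubleDual ℝ Y y) = T y := by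
      apply (SeparatingDual.eq_iff_forall_dual_eq (R := ℝ)).2
      intro ψ
      rw [← hg]; rfl
    show toWeakSpace ℝ Z (g (inclusionInDoubleDual ℝ Y y)) = _
    rw [this]
/-- alternating sums of subsequences of `s` are small -/
def AltSmall {Y : Type*} [NormedAddCommGroup Y] (s : ℕ → Y) : Prop :=
  ∀ ε : ℝ, 0 < ε → ∃ N : ℕ, 0 < N ∧ ∃ φ : ℝ, 0 ≤ φ ∧ φ ^ 2 ≤ ε * N ∧
    ∀ t : ℕ → ℕ, StrictMono t →
      ‖∑ j ∈ Finset.range N, (s (t (2 * j)) - s (t (2 * j + 1)))‖ ≤ φ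

lemma aux_double {Y : Type*} [NormedAddCommGroup Y] [NormedSpace ℝ Y]
    (B : Y →L[ℝ] Y →L[ℝ] ℝ) (s : ℕ → Y) (r q : ℕ → ℝ) (α β : ℝ)
    (hr : ∀ k, Tendsto (fun n => B (s k) (s n)) atTop (𝓝 (r k)))
    (hα : Tendsto r atTop (𝓝 α))
    (hq : ∀ n, Tendsto (fun k => B (s k) (s n)) atTop (𝓝 (q n)))
    (hβ : Tendsto q atTop (𝓝 β))
    (H : AltSmall s) : α = β := by
  by_contra hne
  have hd : 0 < |α - β| := abs_pos.2 (sub_ne_zero.2 hne)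
  obtain ⟨N, hN, φ, hφ0, hφ, ht⟩ := H (|α - β| / (4 * (‖B‖ + 1))) (by positivity)
  have hNr : (0 : ℝ) < N := by exact_mod_cast hN
  set τ := |α - β| / (8 * N) with hτ
  have hτ0 : 0 < τ := by positivity
  obtain ⟨t, -, htr⟩ := exists_seq_of_forall_finset_exists
    (fun k : ℕ => |r k - α| < τ / 2 ∧ |q k - β| < τ / 2)
    (fun x y => x < y ∧ |B (s x) (s y) - α| < τ ∧ |B (s y) (s x) - β| < τ) (by
      intro S hS
      have e1 : ∀ᶠ y in atTop, |r y - α| < τ / 2 := by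
        have := Metric.tendsto_nhds.1 hα (τ / 2) (by positivity)
        simpa [Real.dist_eq] using this
      have e2 : ∀ᶠ y in atTop, |q y - β| < τ / 2 := by
        have := Metric.tendsto_nhds.1 hβ (τ / 2) (by positivity)
        simpa [Real.dist_eq] using this
      have e3 : ∀ᶠ y in atTop, ∀ x ∈ S, x < y ∧ |B (s x) (s y) - α| < τ ∧ |B (s y) (s x) - β| < τ := by
        rw [Filter.eventually_all_finset]
        intro x hx
        have h1 := Metric.tendsto_nhds.1 (hr x) (τ / 2) (by positivity)
        have h2 := Metric.tendsto_nhds.1 (hq x) (τ / 2) (by positivity)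
        filter_upwards [h1, h2, eventually_gt_atTop x] with y h1 h2 h3
        rw [Real.dist_eq] at h1 h2
        obtain ⟨h4, h5⟩ := hS x hx
        refine ⟨h3, ?_, ?_⟩
        · rw [abs_lt] at *
          constructor <;> linarith
        · rw [abs_lt] at *
          constructor <;> linarith
      obtain ⟨y, h1, h2, h3⟩ := (e1.and (e2.and e3)).exists
      exact ⟨y, ⟨h1, h2⟩, h3⟩)
  have hmono : StrictMono t := fun a b hab => (htr a b hab).1
  set x := ∑ j ∈ Finset.range N, (s (t (2 * (2 * j))) - s (t (2 * (2 * j + 1)))) with hx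
  set y := ∑ j ∈ Finset.range N, (s (t (2 * (2 * j) + 1)) - s (t (2 * (2 * j + 1) + 1))) with hy
  have hxn : ‖x‖ ≤ φ := ht (fun i => t (2 * i)) (fun a b hab => hmono (by lia))
  have hyn : ‖y‖ ≤ φ := ht (fun i => t (2 * i + 1)) (fun a b hab => hmono (by lia))
  have hBup : |B x y| ≤ ‖B‖ * φ ^ 2 := by
    calc |B x y| ≤ ‖B‖ * ‖x‖ * ‖y‖ := B.le_opNorm₂ x y
      _ ≤ ‖B‖ * φ * φ := by gcongr
      _ = _ := by ring
  have hterm : ∀ j i, |B (s (t (2 * (2 * j))) - s (t (2 * (2 * j + 1))))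
      (s (t (2 * (2 * i) + 1)) - s (t (2 * (2 * i + 1) + 1))) - (if j = i then α - β else 0)| ≤ 4 * τ := by
    intro j i
    simp only [map_sub, sub_apply]
    rcases lt_trichotomy j i with h | h | h
    · have a1 := (htr (2 * (2 * j)) (2 * (2 * i) + 1) (by lia)).2.1
      have a2 := (htr (2 * (2 * j)) (2 * (2 * i + 1) + 1) (by lia)).2.1
      have a3 := (htr (2 * (2 * j + 1)) (2 * (2 * i) + 1) (by lia)).2.1
      have a4 := (htr (2 * (2 * j + 1)) (2 * (2 * i + 1) + 1) (by lia)).2.1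
      rw [if_neg h.ne]
      rw [abs_lt] at a1 a2 a3 a4
      rw [abs_le]
      constructor <;> linarith
    · subst h
      have a1 := (htr (2 * (2 * j)) (2 * (2 * j) + 1) (by lia)).2.1
      have a2 := (htr (2 * (2 * j)) (2 * (2 * j + 1) + 1) (by lia)).2.1
      have a3 := (htr (2 * (2 * j) + 1) (2 * (2 * j + 1)) (by lia)).2.2
      have a4 := (htr (2 * (2 * j + 1)) (2 * (2 * j + 1) + 1) (by lia)).2.1
      rw [if_pos rfl]
      rw [abs_lt] at a1 a2 a3 a4
      rw [abs_le]
      constructor <;> linarith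
    · have a1 := (htr (2 * (2 * i) + 1) (2 * (2 * j)) (by lia)).2.2
      have a2 := (htr (2 * (2 * i + 1) + 1) (2 * (2 * j)) (by lia)).2.2
      have a3 := (htr (2 * (2 * i) + 1) (2 * (2 * j + 1)) (by lia)).2.2
      have a4 := (htr (2 * (2 * i + 1) + 1) (2 * (2 * j + 1)) (by lia)).2.2
      rw [if_neg h.ne']
      rw [abs_lt] at a1 a2 a3 a4
      rw [abs_le]
      constructor <;> linarith
  have hsum : |B x y - N * (α - β)| ≤ N * (N * (4 * τ)) := by
    have e1 : B x y - N * (α - β) = ∑ j ∈ Finset.range N, ∑ i ∈ Finset.range N,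
        (B (s (t (2 * (2 * j))) - s (t (2 * (2 * j + 1))))
      (s (t (2 * (2 * i) + 1)) - s (t (2 * (2 * i + 1) + 1))) - (if j = i then α - β else 0)) := by
      have e2 : ∀ j ∈ Finset.range N, ∑ i ∈ Finset.range N, (if j = i then α - β else 0) = α - β := by
        intro j hj
        rw [Finset.sum_ite_eq, if_pos hj]
      have e3 : ∀ F : ℕ → ℕ → ℝ, ∑ j ∈ Finset.range N, ∑ i ∈ Finset.range N,
          (F j i - (if j = i then α - β else 0)) =
          ∑ j ∈ Finset.range N, ∑ i ∈ Finset.range N, F j i - N * (α - β) := by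
        intro F
        simp only [Finset.sum_sub_distrib]
        rw [Finset.sum_congr rfl e2, Finset.sum_const, Finset.card_range, nsmul_eq_mul]
      rw [e3]
      congr 1
      have e4 : B x = ∑ j ∈ Finset.range N, B (s (t (2 * (2 * j))) - s (t (2 * (2 * j + 1)))) := by
        rw [hx, map_sum]
      rw [e4, sum_apply]
      apply Finset.sum_congr rfl
      intro j _
      rw [hy, map_sum]
    rw [e1]
    refine (Finset.abs_sum_le_sum_abs _ _).trans ?_
    calc _ ≤ ∑ j ∈ Finset.range N, (N * (4 * τ)) := by
            apply Finset.sum_le_sum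
            intro j _
            refine (Finset.abs_sum_le_sum_abs _ _).trans ?_
            calc _ ≤ ∑ i ∈ Finset.range N, (4 * τ) := Finset.sum_le_sum fun i _ => hterm j i
              _ = _ := by simp
      _ = _ := by simp
  have h4 : N * (N * (4 * τ)) = N * |α - β| / 2 := by
    rw [hτ]; field_simp; ring
  have h5 : ‖B‖ * φ ^ 2 ≤ N * |α - β| / 4 := by
    calc ‖B‖ * φ ^ 2 ≤ (‖B‖ + 1) * (|α - β| / (4 * (‖B‖ + 1)) * N) := by
          gcongr; linarith
      _ = _ := by
        have : ‖B‖ + 1 ≠ 0 := by positivity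
        field_simp
  have h6 : N * |α - β| ≤ |B x y| + |B x y - N * (α - β)| := by
    have : N * |α - β| = |N * (α - β)| := by rw [abs_mul, abs_of_pos hNr]
    rw [this]
    have := abs_sub_abs_le_abs_sub (N * (α - β)) (B x y)
    rw [abs_sub_comm] at this
    linarith
  have : 0 < N * |α - β| := by positivity
  linarith

open NormedSpace in
lemma aux_W {Y : Type*} [NormedAddCommGroup Y] [NormedSpace ℝ Y]
    (s : ℕ → Y) (σ : (Y →L[ℝ] ℝ) →L[ℝ] ℝ)
    (hσ : ∀ f : Y →L[ℝ] ℝ, Tendsto (fun n => f (s n)) atTop (𝓝 (σ f)))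
    (hbi : ∀ Φ : (Y →L[ℝ] ℝ) →L[ℝ] ℝ, ∃ (y : Y) (L : ℝ), ∀ f, Φ f = f y + L * σ f)
    (H : AltSmall s) : PropertyW Y := by
  intro T
  apply aux_wc
  have key : ∀ Ψ : (Y →L[ℝ] ℝ) →L[ℝ] ℝ, σ (Ψ.comp T) = Ψ (σ.comp T.flip) := by
    intro Ψ
    obtain ⟨y, L, hΨ⟩ := hbi Ψ
    have e1 : Ψ.comp T = T.flip y + L • σ.comp T := by
      ext z; simp [hΨ]
    have e2 : σ (σ.comp T) = σ (σ.comp T.flip) := by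
      apply aux_double T s (fun k => σ (T (s k))) (fun n => σ (T.flip (s n)))
      · intro k; exact hσ _
      · exact hσ (σ.comp T)
      · intro n; exact hσ (T.flip (s n))
      · exact hσ (σ.comp T.flip)
      · exact H
    rw [e1, hΨ]
    simp [e2]
  intro Φ
  obtain ⟨y, L, hΦ⟩ := hbi Φ
  refine ⟨T y + L • (σ.comp T.flip), ?_⟩
  intro ψ
  rw [hΦ, key]
  simp
set_option linter.all false
/-- exponents -/
def aa : ℕ → ℕ
  | 0 => 0
  | k + 1 => 16 * aa k + 15
/-- weights -/
noncomputable def ww (k : ℕ) : ℝ := (1 / 2) ^ aa k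
/-- lengths -/
noncomputable def nn (k : ℕ) : ℝ := 2 ^ (4 * aa k)

/-- admissible coefficient sequences -/
def Adm (n : ℝ) (D : ℕ) (c : ℕ → ℝ) : Prop :=
  (∀ m ≤ D, |∑ i ∈ Finset.range m, c i| ≤ 1) ∧ ∑ i ∈ Finset.range D, |c i| ≤ n

/-- evaluation -/
def vl (D : ℕ) (c x : ℕ → ℝ) : ℝ := ∑ i ∈ Finset.range D, c i * x i

/-- The data of the space. -/
structure JS (X : Type) [NormedAddCommGroup X] [NormedSpace ℝ X] where
  sq : X →ₗ[ℝ] (ℕ → ℝ)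
  inj : Function.Injective sq
  lim : ∀ x, Tendsto (sq x) atTop (𝓝 0)
  nk : ℕ → X → ℝ
  nk_nonneg : ∀ k x, 0 ≤ nk k x
  hasSum : ∀ x, HasSum (fun k => nk k x ^ 2) (‖x‖ ^ 2)
  le_nk : ∀ k x D c, Adm (nn k) D c → ww k * |vl D c (sq x)| ≤ nk k x
  nk_le : ∀ k x b, (∀ D c, Adm (nn k) D c → ww k * |vl D c (sq x)| ≤ b) → nk k x ≤ b
  make : ∀ (x b : ℕ → ℝ), Tendsto x atTop (𝓝 0) →
    (∀ k D c, Adm (nn k) D c → ww k * |vl D c x| ≤ b k) → Summable (fun k => b k ^ 2) → ∃ z, sq z = x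

lemma ww_pos (k : ℕ) : 0 < ww k := by unfold ww; positivity
lemma nn_ge (k : ℕ) : 1 ≤ nn k := by unfold nn; exact one_le_pow₀ (by norm_num)

lemma adm_zero (k : ℕ) : Adm (nn k) 0 0 := by
  have := nn_ge k
  constructor
  · intro m hm
    simp
  · simp; linarith

lemma adm_single (k i : ℕ) : Adm (nn k) (i + 1) (Pi.single i 1) := by
  constructor
  · intro m _
    simp only [Pi.single_apply, Finset.sum_ite_eq', Finset.sum_ite_eq]
    split_ifs <;> simp
  · have : ∀ j ∈ Finset.range (i+1), |(Pi.single i 1 : ℕ → ℝ) j| = (Pi.single i 1 : ℕ → ℝ) j := by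
      intro j _
      by_cases h : j = i
      · subst h; simp
      · simp [h]
    rw [Finset.sum_congr rfl this]
    simp only [Pi.single_apply, Finset.sum_ite_eq', Finset.sum_ite_eq]
    simpa using nn_ge k

lemma vl_single (i : ℕ) (x : ℕ → ℝ) : vl (i + 1) (Pi.single i 1) x = x i := by
  unfold vl
  rw [Finset.sum_eq_single i]
  · simp
  · intro j _ h; simp [h]
  · simp

lemma vl_add (D c) (x y : ℕ → ℝ) : vl D c (x + y) = vl D c x + vl D c y := by
  simp [vl, mul_add, Finset.sum_add_distrib]
lemma vl_smul (D c) (a : ℝ) (x : ℕ → ℝ) : vl D c (a • x) = a * vl D c x := by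
  simp only [vl, Finset.mul_sum]
  refine Finset.sum_congr rfl fun i _ => ?_
  simp; ring

/-- index type -/
abbrev IK (k : ℕ) : Type := {p : ℕ × (ℕ → ℝ) // Adm (nn k) p.1 p.2}
/-- pieces -/
abbrev EK (k : ℕ) : Type := lp (fun _ : IK k => ℝ) ⊤
/-- ambient -/
abbrev ZZ : Type := lp EK 2

noncomputable instance instEK1 (k : ℕ) : NormedAddCommGroup (EK k) := lp.normedAddCommGroup
noncomputable instance instEK2 (k : ℕ) : NormedSpace ℝ (EK k) := lp.instNormedSpace
instance instEK3 (k : ℕ) : CompleteSpace (EK k) := inferInstance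
noncomputable instance instZZ1 : NormedAddCommGroup ZZ := lp.normedAddCommGroup
noncomputable instance instZZ2 : NormedSpace ℝ ZZ := lp.instNormedSpace
noncomputable instance instZZ4 : AddCommGroup ZZ := instZZ1.toAddCommGroup
noncomputable instance instZZ5 : AddCommMonoid ZZ := instZZ4.toAddCommMonoid
noncomputable instance instZZ6 : Module ℝ ZZ := instZZ2.toModule
noncomputable instance instZZ7 : SMul ℝ ZZ := instZZ6.toSMul
instance instZZ3 : CompleteSpace ZZ := inferInstance

/-- coordinates -/
noncomputable def zq (z : ZZ) (i : ℕ) : ℝ := (z 0 : IK 0 → ℝ) ⟨(i + 1, Pi.single i 1), adm_single 0 i⟩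

lemma zq_add (z z' : ZZ) : zq (z + z') = zq z + zq z' := rfl
lemma zq_smul (a : ℝ) (z : ZZ) : zq (a • z) = a • zq z := rfl

lemma z_le (z : ZZ) (k : ℕ) (p : IK k) : |(z k : IK k → ℝ) p| ≤ ‖z‖ :=
  (lp.norm_apply_le_norm (by simp) (z k) p).trans (lp.norm_apply_le_norm (by simp) z k)

/-- the space -/
def XS : Submodule ℝ ZZ where
  carrier := {z | Tendsto (zq z) atTop (𝓝 0) ∧
    ∀ k (p : IK k), (z k : IK k → ℝ) p = ww k * vl p.1.1 p.1.2 (zq z)}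
  zero_mem' := by
    constructor
    · exact tendsto_const_nhds
    · intro k p
      have : zq 0 = 0 := rfl
      simp [this, vl]
  add_mem' := by
    rintro a b ⟨h1, h2⟩ ⟨h3, h4⟩
    constructor
    · rw [zq_add]; have := h1.add h3; rw [add_zero] at this; exact this
    · intro k p
      rw [zq_add, vl_add, mul_add, ← h2, ← h4]; rfl
  smul_mem' := by
    rintro a b ⟨h1, h2⟩
    constructor
    · rw [zq_smul]; have := h1.const_mul a; rw [mul_zero] at this; exact this
    · intro k p
      rw [zq_smul, vl_smul, mul_left_comm, ← h2]; rfl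

lemma z_cont (k : ℕ) (p : IK k) : Continuous fun z : ZZ => (z k : IK k → ℝ) p := by
  apply continuous_iff_continuousAt.2
  intro z
  rw [ContinuousAt, Metric.tendsto_nhds_nhds]
  intro ε hε
  refine ⟨ε, hε, fun {y} hy => ?_⟩
  rw [dist_eq_norm] at hy
  rw [Real.dist_eq]
  exact (z_le (y - z) k p).trans_lt hy

lemma XS_closed : IsClosed (XS : Set ZZ) := by
  have : (XS : Set ZZ) = {z | Tendsto (zq z) atTop (𝓝 0)} ∩
    ⋂ k, ⋂ p : IK k, {z | (z k : IK k → ℝ) p = ww k * vl p.1.1 p.1.2 (zq z)} := by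
    ext z
    simp [XS]
  rw [this]
  apply IsClosed.inter
  · apply isClosed_of_closure_subset
    intro z hz
    rw [Metric.mem_closure_iff] at hz
    rw [Set.mem_setOf_eq, Metric.tendsto_nhds]
    intro ε hε
    obtain ⟨y, hy, hyz⟩ := hz (ε / 2) (by positivity)
    have := Metric.tendsto_nhds.1 hy (ε / 2) (by positivity)
    filter_upwards [this] with i hi
    rw [Real.dist_eq] at *
    rw [dist_eq_norm] at hyz
    have h1 : |zq z i - zq y i| < ε / 2 := (z_le (z - y) 0 _).trans_lt hyz
    rw [abs_lt] at *
    constructor <;> linarith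
  · refine isClosed_iInter fun k => isClosed_iInter fun p => ?_
    apply isClosed_eq (z_cont k p)
    unfold vl
    refine continuous_const.mul (continuous_finset_sum _ fun i _ => continuous_const.mul ?_)
    exact z_cont 0 _

instance : CompleteSpace XS := XS_closed.completeSpace_coe

lemma zz_hasSum (z : ZZ) : HasSum (fun k => ‖z k‖ ^ 2) (‖z‖ ^ 2) := by
  have := lp.hasSum_norm (p := 2) (by simp) z
  simpa using this

/-- The concrete data. -/
noncomputable def XSJ : JS XS where
  sq := { toFun := fun z => zq z, map_add' := fun a b => rfl, map_smul' := fun a b => rfl }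
  inj := by
    rintro ⟨a, ha⟩ ⟨b, hb⟩ h
    have h' : zq a = zq b := h
    apply Subtype.ext
    apply lp.ext
    funext k
    apply lp.ext
    funext p
    have h1 := ha.2 k p
    have h2 := hb.2 k p
    simp only at h1 h2 ⊢
    rw [h1, h2, h']
  lim := fun z => z.2.1
  nk := fun k z => ‖(z : ZZ) k‖
  nk_nonneg := fun k z => norm_nonneg _
  hasSum := fun z => zz_hasSum z
  le_nk := by
    intro k z D c h
    have h1 := z.2.2 k ⟨(D, c), h⟩
    have h2 := lp.norm_apply_le_norm (by simp) ((z : ZZ) k) ⟨(D, c), h⟩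
    rw [h1, Real.norm_eq_abs, abs_mul, abs_of_pos (ww_pos k)] at h2
    exact h2
  nk_le := by
    intro k z b h
    haveI : Nonempty (IK k) := ⟨⟨(0, 0), adm_zero k⟩⟩
    apply lp.norm_le_of_forall_le'
    intro p
    have h1 := z.2.2 k p
    rw [h1, Real.norm_eq_abs, abs_mul, abs_of_pos (ww_pos k)]
    exact h _ _ p.2
  make := by
    intro x b hx hb hs
    have hb' : ∀ k (p : IK k), ‖ww k * vl p.1.1 p.1.2 x‖ ≤ b k := by
      intro k p
      rw [Real.norm_eq_abs, abs_mul, abs_of_pos (ww_pos k)]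
      exact hb _ _ _ p.2
    let u : ∀ k, EK k := fun k => ⟨fun p => ww k * vl p.1.1 p.1.2 x,
      memℓp_infty ⟨b k, by rintro _ ⟨p, rfl⟩; exact hb' k p⟩⟩
    have hu : ∀ k, ‖u k‖ ≤ b k := by
      intro k
      haveI : Nonempty (IK k) := ⟨⟨(0, 0), adm_zero k⟩⟩
      apply lp.norm_le_of_forall_le'
      intro p
      exact hb' k p
    let z : ZZ := ⟨u, by
      apply memℓp_gen
      simp only [ENNReal.toReal_ofNat, Real.rpow_ofNat]
      exact Summable.of_nonneg_of_le (fun k => by positivity)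
        (fun k => pow_le_pow_left₀ (norm_nonneg _) (hu k) 2) hs⟩
    have hz : zq z = x := by
      funext i
      show ww 0 * vl (i + 1) (Pi.single i 1) x = x i
      rw [vl_single]; simp [ww, aa]
    refine ⟨⟨z, ?_, ?_⟩, hz⟩
    · rw [hz]; exact hx
    · intro k p
      rw [hz]

lemma aa_ge (k : ℕ) : k ≤ aa k := by
  induction k with
  | zero => simp
  | succ k ih => simp only [aa]; omega

lemma ww_le (k : ℕ) : ww k ≤ (1 / 2) ^ k :=
  pow_le_pow_of_le_one (by norm_num) (by norm_num) (aa_ge k)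

lemma ww_le_one (k : ℕ) : ww k ≤ 1 := pow_le_one₀ (by norm_num) (by norm_num)

lemma ww_sum : Summable (fun k => ww k ^ 2) := by
  refine Summable.of_nonneg_of_le (fun k => by positivity) (fun k => ?_)
    (summable_geometric_of_lt_one (r := (1 / 2 : ℝ)) (by norm_num) (by norm_num))
  have := ww_le k
  have := ww_le_one k
  have := ww_pos k
  nlinarith

namespace JS
variable {X : Type} [NormedAddCommGroup X] [NormedSpace ℝ X] (J : JS X)

lemma nk_le_norm (k x) : J.nk k x ≤ ‖x‖ := by
  have h := le_hasSum (J.hasSum x) k (fun j _ => by positivity)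
  exact le_of_sq_le_sq h (norm_nonneg _)

lemma norm_le_of {x : X} {b : ℕ → ℝ} (hb : ∀ k, J.nk k x ≤ b k) {S B : ℝ}
    (hs : HasSum (fun k => b k ^ 2) S) (h : S ≤ B ^ 2) (hB : 0 ≤ B) : ‖x‖ ≤ B := by
  have := hasSum_le (fun k => pow_le_pow_left₀ (J.nk_nonneg k x) (hb k) 2) (J.hasSum x) hs
  exact le_of_sq_le_sq (this.trans h) hB

lemma norm_mono {x y : X} (hb : ∀ k, J.nk k x ≤ J.nk k y) : ‖x‖ ≤ ‖y‖ :=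
  J.norm_le_of hb (J.hasSum y) le_rfl (norm_nonneg _)

lemma vl_le (k x D c) (h : Adm (nn k) D c) : ww k * |vl D c (J.sq x)| ≤ ‖x‖ :=
  (J.le_nk k x D c h).trans (J.nk_le_norm k x)

lemma nk_add (k x y) : J.nk k (x + y) ≤ J.nk k x + J.nk k y := by
  apply J.nk_le
  intro D c h
  have h1 := J.le_nk k x D c h
  have h2 := J.le_nk k y D c h
  rw [map_add, vl_add]
  have := abs_add_le (vl D c (J.sq x)) (vl D c (J.sq y))
  have := ww_pos k
  nlinarith

lemma nk_smul (k x) (a : ℝ) : J.nk k (a • x) ≤ |a| * J.nk k x := by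
  apply J.nk_le
  intro D c h
  have h1 := J.le_nk k x D c h
  rw [map_smul, vl_smul, abs_mul]
  have := abs_nonneg a
  nlinarith

lemma sq_le (x i) : |J.sq x i| ≤ ‖x‖ := by
  have := J.vl_le 0 x _ _ (adm_single 0 i)
  rw [vl_single] at this
  simpa [ww, aa] using this

/-- coordinate functionals -/
noncomputable def co (i : ℕ) : X →L[ℝ] ℝ :=
  LinearMap.mkContinuous ((LinearMap.proj i).comp J.sq) 1 (fun x => by
    simpa using J.sq_le x i)

lemma co_apply (i x) : J.co i x = J.sq x i := rfl

lemma vl_ind (D c n) : vl D c (fun i => if i < n then 1 else 0) = ∑ i ∈ Finset.range (min D n), c i := by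
  unfold vl
  simp only [mul_ite, mul_one, mul_zero]
  rw [← Finset.sum_filter]
  congr 1
  ext i; simp

lemma vl_ind_le {k D c} (n) (h : Adm (nn k) D c) : |vl D c (fun i => if i < n then 1 else 0)| ≤ 1 := by
  rw [vl_ind]
  exact h.1 _ (min_le_left _ _)

lemma ss_ex (n : ℕ) : ∃ z, J.sq z = fun i => if i < n then 1 else 0 := by
  apply J.make _ ww
  · apply tendsto_const_nhds.congr'
    filter_upwards [eventually_ge_atTop n] with i hi
    simp [hi]
  · intro k D c h
    have := vl_ind_le n h
    have := ww_pos k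
    nlinarith
  · exact ww_sum

/-- partial sums of the basis -/
noncomputable def ss (n : ℕ) : X := Classical.choose (J.ss_ex n)
lemma sq_ss (n) : J.sq (J.ss n) = fun i => if i < n then 1 else 0 := Classical.choose_spec (J.ss_ex n)

lemma nk_ss (k n) : J.nk k (J.ss n) ≤ ww k := by
  apply J.nk_le
  intro D c h
  rw [sq_ss]
  have := vl_ind_le n h
  have := ww_pos k
  nlinarith

/-- a bound -/
noncomputable def SB : ℝ := Real.sqrt (∑' k, ww k ^ 2)
lemma SB_nonneg : 0 ≤ SB := Real.sqrt_nonneg _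

lemma norm_ss (n) : ‖J.ss n‖ ≤ SB := by
  apply J.norm_le_of (fun k => J.nk_ss k n) ww_sum.hasSum _ SB_nonneg
  unfold SB
  rw [Real.sq_sqrt (tsum_nonneg fun k => by positivity)]

/-- basis -/
noncomputable def ee (i : ℕ) : X := J.ss (i + 1) - J.ss i

lemma sq_ee (i j) : J.sq (J.ee i) j = if j = i then 1 else 0 := by
  unfold ee
  rw [map_sub, Pi.sub_apply, sq_ss, sq_ss]
  grind

/-- projections -/
noncomputable def PP (N : ℕ) : X →L[ℝ] X := ∑ i ∈ Finset.range N, (J.co i).smulRight (J.ee i)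

lemma PP_apply (N x) : J.PP N x = ∑ i ∈ Finset.range N, J.sq x i • J.ee i := by
  simp [PP, sum_apply, co_apply]

lemma sq_sum (N : ℕ) (a : ℕ → ℝ) : J.sq (∑ i ∈ Finset.range N, a i • J.ee i) = fun j => if j < N then a j else 0 := by
  funext j
  rw [map_sum, Finset.sum_apply]
  simp only [map_smul, Pi.smul_apply, sq_ee, smul_eq_mul, mul_ite, mul_one, mul_zero]
  simp

lemma sq_PP (N x) : J.sq (J.PP N x) = fun j => if j < N then J.sq x j else 0 := by
  rw [PP_apply, sq_sum]

lemma vl_trunc (D c N) (x : ℕ → ℝ) : vl D c (fun j => if j < N then x j else 0) = vl (min D N) c x := by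
  unfold vl
  simp only [mul_ite, mul_zero]
  rw [← Finset.sum_filter]
  congr 1
  ext i; simp

lemma adm_min {n D c} (N : ℕ) (h : Adm n D c) : Adm n (min D N) c := by
  refine ⟨fun m hm => h.1 m (hm.trans (min_le_left _ _)), le_trans ?_ h.2⟩
  apply Finset.sum_le_sum_of_subset_of_nonneg
  · intro i; simp; omega
  · intros; positivity

lemma nk_PP (k N x) : J.nk k (J.PP N x) ≤ J.nk k x := by
  apply J.nk_le
  intro D c h
  rw [sq_PP, vl_trunc]
  exact J.le_nk k x _ c (adm_min N h)

lemma norm_PP (N x) : ‖J.PP N x‖ ≤ ‖x‖ := J.norm_mono fun k => J.nk_PP k N x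

lemma PP_ss (n m) : J.PP n (J.ss m) = J.ss (min m n) := by
  apply J.inj
  rw [sq_PP, sq_ss, sq_ss]
  funext j
  grind


lemma nk_sup (k y) {s : ℝ} (hy : ∀ i, |J.sq y i| ≤ s) : J.nk k y ≤ ww k * (nn k * s) := by
  apply J.nk_le
  intro D c h
  apply mul_le_mul_of_nonneg_left _ (ww_pos k).le
  have hs : 0 ≤ s := (abs_nonneg _).trans (hy 0)
  calc |vl D c (J.sq y)| ≤ ∑ i ∈ Finset.range D, |c i * J.sq y i| := Finset.abs_sum_le_sum_abs _ _
    _ ≤ ∑ i ∈ Finset.range D, |c i| * s := by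
        apply Finset.sum_le_sum
        intro i _
        rw [abs_mul]
        exact mul_le_mul_of_nonneg_left (hy i) (abs_nonneg _)
    _ = (∑ i ∈ Finset.range D, |c i|) * s := by rw [Finset.sum_mul]
    _ ≤ nn k * s := mul_le_mul_of_nonneg_right h.2 hs

lemma near_max (f : X →L[ℝ] ℝ) {ε : ℝ} (hε : 0 < ε) : ∃ z, ‖z‖ ≤ 1 ∧ ‖f‖ - ε ≤ f z := by
  by_cases h : ‖f‖ - ε < 0
  · exact ⟨0, by simp, by simpa using h.le⟩
  · obtain ⟨x, hx, hfx⟩ := f.exists_lt_apply_of_lt_opNorm (r := ‖f‖ - ε) (by linarith)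
    rw [Real.norm_eq_abs] at hfx
    rcases abs_cases (f x) with ⟨h1, _⟩ | ⟨h1, _⟩
    · exact ⟨x, hx.le, by linarith⟩
    · exact ⟨-x, by simpa using hx.le, by simp; linarith⟩

lemma norm_pert (z y : X) (hz : ‖z‖ ≤ 1) (hy : ‖y‖ ≤ 1) {t η s : ℝ} (ht : 0 < t) (hη : 0 < η)
    (K : ℕ) (hK : ‖z‖ ^ 2 - η ^ 2 ≤ ∑ k ∈ Finset.range K, J.nk k z ^ 2)
    (hs : ∀ i, |J.sq y i| ≤ s) :
    ‖z + t • y‖ ^ 2 ≤ 1 + t ^ 2 + 2 * t * η + 2 * t * (s * ∑ k ∈ Finset.range K, ww k * nn k) := by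
  have h1 := (J.hasSum z).mul_left (1 + t / η)
  have h2 := (J.hasSum y).mul_left (t ^ 2 + t * η)
  have h3 : HasSum (fun k => if k ∈ Finset.range K then t * (2 * (ww k * (nn k * s)) - J.nk k z ^ 2 / η) else 0)
      (∑ k ∈ Finset.range K, t * (2 * (ww k * (nn k * s)) - J.nk k z ^ 2 / η)) := by
    have := hasSum_sum_of_ne_finset_zero (L := SummationFilter.unconditional ℕ) (s := Finset.range K) (f := fun k => if k ∈ Finset.range K then t * (2 * (ww k * (nn k * s)) - J.nk k z ^ 2 / η) else 0) (by
      intro b hb; simp only [if_neg hb])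
    convert this using 1
    apply Finset.sum_congr rfl
    intro k hk
    rw [if_pos hk]
  have h4 := hasSum_le (L := SummationFilter.unconditional ℕ) (fun k => ?_) (J.hasSum (z + t • y)) ((h1.add h2).add h3)
  · refine h4.trans ?_
    have e : ∑ k ∈ Finset.range K, t * (2 * (ww k * (nn k * s)) - J.nk k z ^ 2 / η) =
       2 * t * (s * ∑ k ∈ Finset.range K, ww k * nn k) - (t / η) * ∑ k ∈ Finset.range K, J.nk k z ^ 2 := by
      rw [Finset.mul_sum, Finset.mul_sum, Finset.mul_sum, ← Finset.sum_sub_distrib]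
      apply Finset.sum_congr rfl
      intro k _
      ring
    rw [e]
    have h5 : (t / η) * (‖z‖ ^ 2 - η ^ 2) ≤ (t / η) * ∑ k ∈ Finset.range K, J.nk k z ^ 2 :=
      mul_le_mul_of_nonneg_left hK (by positivity)
    have h6 : (t / η) * η ^ 2 = t * η := by field_simp
    have h7 : ‖z‖ ^ 2 ≤ 1 := by nlinarith [norm_nonneg z]
    have h8 : ‖y‖ ^ 2 ≤ 1 := by nlinarith [norm_nonneg y]
    have h9 : (t ^ 2 + t * η) * ‖y‖ ^ 2 ≤ (t ^ 2 + t * η) * 1 := mul_le_mul_of_nonneg_left h8 (by positivity)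
    nlinarith
  · have ha := J.nk_nonneg k z
    have hb := J.nk_nonneg k y
    have ha1 := (J.nk_le_norm k z).trans hz
    have hbs := J.nk_sup k y hs
    have hab : J.nk k (z + t • y) ≤ J.nk k z + t * J.nk k y := by
      have e1 := J.nk_add k z (t • y)
      have e2 := J.nk_smul k y t
      rw [abs_of_pos ht] at e2
      linarith
    have hsq := pow_le_pow_left₀ (J.nk_nonneg k (z + t • y)) hab 2
    refine hsq.trans ?_
    generalize J.nk k z = a at *
    generalize J.nk k y = b at *
    generalize ww k * (nn k * s) = g at *
    split_ifs
    · have e : (1 + t / η) * a ^ 2 + (t ^ 2 + t * η) * b ^ 2 + t * (2 * g - a ^ 2 / η)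
        = a ^ 2 + t ^ 2 * b ^ 2 + t * η * b ^ 2 + 2 * t * g := by field_simp; ring
      rw [e]
      have : a * b ≤ g := by nlinarith
      have : t * (a * b) ≤ t * g := mul_le_mul_of_nonneg_left this ht.le
      have : 0 ≤ t * η * b ^ 2 := by positivity
      nlinarith
    · have e : (1 + t / η) * a ^ 2 + (t ^ 2 + t * η) * b ^ 2 + 0 - (a + t * b) ^ 2
        = (t / η) * (a - η * b) ^ 2 := by field_simp; ring
      have : 0 ≤ (t / η) * (a - η * b) ^ 2 := by positivity
      linarith

lemma sup_est (f : X →L[ℝ] ℝ) {ε : ℝ} (hε : 0 < ε) : ∃ C : ℝ, ∀ (y : X) (s : ℝ), ‖y‖ ≤ 1 →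
    (∀ i, |J.sq y i| ≤ s) → f y ≤ ε + C * s := by
  set F := ‖f‖ with hF
  have hF0 : 0 ≤ F := norm_nonneg _
  set t := ε / (3 * (F + 1)) with htdef
  have ht : 0 < t := by positivity
  have hFt : F * t ≤ ε / 3 := by
    rw [htdef, mul_div_assoc', div_le_div_iff₀ (by positivity) (by positivity)]
    nlinarith
  obtain ⟨z, hz, hfz⟩ := near_max f (ε := t * (ε / 3)) (by positivity)
  have hev : ∀ᶠ K in atTop, ‖z‖ ^ 2 - t ^ 2 < ∑ k ∈ Finset.range K, J.nk k z ^ 2 :=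
    (J.hasSum z).tendsto_sum_nat.eventually_const_lt (by nlinarith [sq_pos_of_pos ht])
  obtain ⟨K, hK⟩ := hev.exists
  refine ⟨F * ∑ k ∈ Finset.range K, ww k * nn k, fun y s hy hs => ?_⟩
  have h := J.norm_pert z y hz hy ht ht K hK.le hs
  set D := ∑ k ∈ Finset.range K, ww k * nn k
  have h2 : ‖z + t • y‖ ≤ 1 + t ^ 2 / 2 + t * t + t * (s * D) := by
    nlinarith [sq_nonneg (‖z + t • y‖ - 1)]
  have h3 : f z + t * f y ≤ F * ‖z + t • y‖ := by
    have := (le_abs_self _).trans (f.le_opNorm (z + t • y))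
    simpa using this
  have h4 : F * ‖z + t • y‖ ≤ F * (1 + t ^ 2 / 2 + t * t + t * (s * D)) :=
    mul_le_mul_of_nonneg_left h2 hF0
  have h5 : t * f y ≤ t * (ε / 3 + F * t / 2 + F * t + F * D * s) := by nlinarith
  have h6 := le_of_mul_le_mul_left h5 ht
  linarith

lemma shrink (f : X →L[ℝ] ℝ) {δ : ℝ} (hδ : 0 < δ) : ∃ N : ℕ, ∀ u, (∀ i < N, J.sq u i = 0) →
    ‖u‖ ≤ 1 → f u ≤ δ := by
  by_contra hcon
  push Not at hcon
  have key : ∀ M : ℕ, ∃ v, M * δ ≤ f v ∧ ‖v‖ ≤ M ∧ ∀ i, |J.sq v i| ≤ 2 := by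
    intro M
    induction M with
    | zero => exact ⟨0, by simp, by simp, by simp⟩
    | succ M ih =>
      obtain ⟨v, h1, h2, h3⟩ := ih
      have := Metric.tendsto_atTop.1 (J.lim v) 1 one_pos
      obtain ⟨N, hN⟩ := this
      obtain ⟨u, hu1, hu2, hu3⟩ := hcon N
      refine ⟨v + u, ?_, ?_, ?_⟩
      · rw [map_add]; push_cast; linarith
      · push_cast; exact (norm_add_le _ _).trans (add_le_add h2 hu2)
      · intro i
        rw [map_add, Pi.add_apply]
        by_cases hi : i < N
        · rw [hu1 i hi, add_zero]; exact h3 i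
        · have e1 := hN i (by omega)
          rw [Real.dist_eq, sub_zero] at e1
          have e2 := (J.sq_le u i).trans hu2
          have := abs_add_le (J.sq v i) (J.sq u i)
          linarith
  obtain ⟨C, hC⟩ := J.sup_est f (ε := δ / 2) (by positivity)
  obtain ⟨M, hM⟩ := exists_nat_gt (max 1 (4 * C / δ))
  have hM1 : (1 : ℝ) < M := (le_max_left _ _).trans_lt hM
  have hM2 : 4 * C / δ < M := (le_max_right _ _).trans_lt hM
  obtain ⟨v, h1, h2, h3⟩ := key M
  have hM0 : (0 : ℝ) < M := by linarith
  have := hC ((M : ℝ)⁻¹ • v) ((M : ℝ)⁻¹ * 2) (by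
      rw [norm_smul, Real.norm_of_nonneg (by positivity)]
      rw [inv_mul_le_iff₀ hM0]; linarith) (by
      intro i
      rw [map_smul, Pi.smul_apply, smul_eq_mul, abs_mul, abs_of_pos (by positivity)]
      exact mul_le_mul_of_nonneg_left (h3 i) (by positivity))
  rw [map_smul, smul_eq_mul, inv_mul_le_iff₀ hM0] at this
  have e : (M : ℝ) * (δ / 2 + C * ((M : ℝ)⁻¹ * 2)) = M * δ / 2 + 2 * C := by field_simp
  rw [e] at this
  rw [div_lt_iff₀ hδ] at hM2
  linarith

lemma shrink' (f : X →L[ℝ] ℝ) {δ : ℝ} (hδ : 0 < δ) : ∃ N : ℕ, ∀ u, (∀ i < N, J.sq u i = 0) →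
    |f u| ≤ δ * ‖u‖ := by
  obtain ⟨N, hN⟩ := J.shrink f hδ
  have key : ∀ u, (∀ i < N, J.sq u i = 0) → f u ≤ δ * ‖u‖ := by
    intro u hu
    by_cases h : u = 0
    · simp [h]
    have hp : 0 < ‖u‖ := norm_pos_iff.2 h
    have := hN (‖u‖⁻¹ • u) (by intro i hi; simp [hu i hi]) (by
      rw [norm_smul, norm_inv, norm_norm, inv_mul_cancel₀ hp.ne'])
    rw [map_smul, smul_eq_mul, inv_mul_le_iff₀ hp] at this
    linarith
  refine ⟨N, fun u hu => abs_le.2 ⟨?_, key u hu⟩⟩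
  have := key (-u) (by intro i hi; simp [hu i hi])
  rw [map_neg, norm_neg] at this
  linarith

lemma tend_PP (f : X →L[ℝ] ℝ) : Tendsto (fun N => f.comp (J.PP N)) atTop (𝓝 f) := by
  rw [Metric.tendsto_atTop]
  intro ε hε
  obtain ⟨N, hN⟩ := J.shrink' f (δ := ε / 4) (by positivity)
  refine ⟨N, fun n hn => ?_⟩
  rw [dist_eq_norm, norm_sub_rev]
  have : ‖f - f.comp (J.PP n)‖ ≤ ε / 2 := by
    apply ContinuousLinearMap.opNorm_le_bound _ (by positivity)
    intro x
    have e := hN (x - J.PP n x) (by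
      intro i hi
      rw [map_sub, Pi.sub_apply, sq_PP]
      simp [show i < n by omega])
    have e2 : ‖x - J.PP n x‖ ≤ 2 * ‖x‖ := by
      have := norm_sub_le x (J.PP n x)
      have := J.norm_PP n x
      linarith
    simp only [sub_apply, ContinuousLinearMap.comp_apply, Real.norm_eq_abs]
    rw [← map_sub]
    nlinarith
  linarith

lemma ss_cauchy (f : X →L[ℝ] ℝ) : ∃ l, Tendsto (fun n => f (J.ss n)) atTop (𝓝 l) := by
  apply cauchySeq_tendsto_of_complete
  rw [Metric.cauchySeq_iff']
  intro ε hε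
  obtain ⟨N, hN⟩ := J.shrink' f (δ := ε / (4 * (SB + 1))) (by have := SB_nonneg; positivity)
  refine ⟨N, fun n hn => ?_⟩
  rw [Real.dist_eq, ← map_sub]
  have h1 := hN (J.ss n - J.ss N) (by
    intro i hi
    rw [map_sub, Pi.sub_apply, sq_ss, sq_ss]
    simp [hi, show i < n by omega])
  have h2 : ‖J.ss n - J.ss N‖ ≤ 2 * (SB + 1) := by
    have := norm_sub_le (J.ss n) (J.ss N)
    have := J.norm_ss n
    have := J.norm_ss N
    linarith
  have h0 := SB_nonneg
  have h3 : ε / (4 * (SB + 1)) * (2 * (SB + 1)) = ε / 2 := by field_simp; norm_num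
  have h4 := mul_le_mul_of_nonneg_left h2 (show 0 ≤ ε / (4 * (SB + 1)) by positivity)
  linarith

/-- limit of the partial sums in the bidual -/
noncomputable def sg : (X →L[ℝ] ℝ) →L[ℝ] ℝ :=
  continuousLinearMapOfTendsto (fun n => NormedSpace.inclusionInDoubleDual ℝ X (J.ss n))
    (f := fun f => Classical.choose (J.ss_cauchy f)) (by
      rw [tendsto_pi_nhds]
      intro f
      exact Classical.choose_spec (J.ss_cauchy f))

lemma sg_tend (f : X →L[ℝ] ℝ) : Tendsto (fun n => f (J.ss n)) atTop (𝓝 (J.sg f)) :=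
  Classical.choose_spec (J.ss_cauchy f)

lemma sg_co (n) : J.sg (J.co n) = 1 := by
  apply tendsto_nhds_unique (J.sg_tend (J.co n))
  apply tendsto_const_nhds.congr'
  filter_upwards [eventually_gt_atTop n] with i hi
  simp [co_apply, sq_ss, hi]


/-- truncation of a bidual element -/
noncomputable def pa (Φ : (X →L[ℝ] ℝ) →L[ℝ] ℝ) (N : ℕ) : X := ∑ i ∈ Finset.range N, Φ (J.co i) • J.ee i

lemma f_pa (Φ : (X →L[ℝ] ℝ) →L[ℝ] ℝ) (N : ℕ) (f : X →L[ℝ] ℝ) : f (J.pa Φ N) = Φ (f.comp (J.PP N)) := by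
  have : f.comp (J.PP N) = ∑ i ∈ Finset.range N, f (J.ee i) • J.co i := by
    ext x
    simp [PP_apply, sum_apply, co_apply, mul_comm]
  rw [this, pa, map_sum, map_sum]
  simp [mul_comm]

lemma norm_pa (Φ : (X →L[ℝ] ℝ) →L[ℝ] ℝ) (N : ℕ) : ‖J.pa Φ N‖ ≤ ‖Φ‖ := by
  apply NormedSpace.norm_le_dual_bound ℝ _ (norm_nonneg Φ)
  intro f
  rw [f_pa]
  refine (Φ.le_opNorm _).trans (mul_le_mul_of_nonneg_left ?_ (norm_nonneg _))
  apply ContinuousLinearMap.opNorm_le_bound _ (norm_nonneg _)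
  intro x
  exact (f.le_opNorm _).trans (mul_le_mul_of_nonneg_left (J.norm_PP N x) (norm_nonneg _))

lemma sq_pa (Φ : (X →L[ℝ] ℝ) →L[ℝ] ℝ) (N : ℕ) :
    J.sq (J.pa Φ N) = fun j => if j < N then Φ (J.co j) else 0 := J.sq_sum N _

lemma nk_pa_mono (Φ : (X →L[ℝ] ℝ) →L[ℝ] ℝ) (k : ℕ) : Monotone fun N => J.nk k (J.pa Φ N) := by
  intro N M h
  have : J.pa Φ N = J.PP N (J.pa Φ M) := by
    apply J.inj
    rw [sq_PP, sq_pa, sq_pa]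
    funext j
    grind
  simp only
  rw [this]
  exact J.nk_PP _ _ _

lemma vl_pa (Φ : (X →L[ℝ] ℝ) →L[ℝ] ℝ) (D c) : vl D c (J.sq (J.pa Φ D)) = vl D c (fun j => Φ (J.co j)) := by
  rw [sq_pa, vl_trunc, min_self]

/-- block suprema -/
noncomputable def bb (Φ : (X →L[ℝ] ℝ) →L[ℝ] ℝ) (k : ℕ) : ℝ := ⨆ N, J.nk k (J.pa Φ N)

lemma bb_bdd (Φ : (X →L[ℝ] ℝ) →L[ℝ] ℝ) (k : ℕ) : BddAbove (Set.range fun N => J.nk k (J.pa Φ N)) :=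
  ⟨‖Φ‖, by rintro _ ⟨N, rfl⟩; exact (J.nk_le_norm _ _).trans (J.norm_pa Φ N)⟩

lemma bb_ge (Φ : (X →L[ℝ] ℝ) →L[ℝ] ℝ) {k D c} (h : Adm (nn k) D c) :
    ww k * |vl D c (fun j => Φ (J.co j))| ≤ J.bb Φ k := by
  rw [← vl_pa]
  exact (J.le_nk _ _ _ _ h).trans (le_ciSup (J.bb_bdd Φ k) D)

lemma bb_nonneg (Φ : (X →L[ℝ] ℝ) →L[ℝ] ℝ) (k : ℕ) : 0 ≤ J.bb Φ k :=
  (J.nk_nonneg _ _).trans (le_ciSup (J.bb_bdd Φ k) 0)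

lemma bb_le (Φ : (X →L[ℝ] ℝ) →L[ℝ] ℝ) (k : ℕ) : J.bb Φ k ≤ ‖Φ‖ :=
  ciSup_le fun N => (J.nk_le_norm _ _).trans (J.norm_pa Φ N)

lemma bb_sum (Φ : (X →L[ℝ] ℝ) →L[ℝ] ℝ) : Summable fun k => J.bb Φ k ^ 2 := by
  apply summable_of_sum_le (c := ‖Φ‖ ^ 2) (fun k => by positivity)
  intro S
  have ht : Tendsto (fun N => ∑ k ∈ S, J.nk k (J.pa Φ N) ^ 2) atTop (𝓝 (∑ k ∈ S, J.bb Φ k ^ 2)) := by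
    apply tendsto_finset_sum
    intro k _
    exact (tendsto_atTop_ciSup (J.nk_pa_mono Φ k) (J.bb_bdd Φ k)).pow 2
  apply le_of_tendsto' ht
  intro N
  calc _ ≤ ‖J.pa Φ N‖ ^ 2 := sum_le_hasSum S (fun k _ => by positivity) (J.hasSum _)
    _ ≤ ‖Φ‖ ^ 2 := pow_le_pow_left₀ (norm_nonneg _) (J.norm_pa Φ N) 2

lemma alt_build (a : ℕ → ℝ) {δ : ℝ} (hδ : 0 < δ) (h : ∀ N, ∃ n, N < n ∧ δ ≤ |a n - a N|) (M : ℕ) :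
    ∃ (D : ℕ) (c : ℕ → ℝ), (∀ m ≤ D, |∑ i ∈ Finset.range m, c i| ≤ 1) ∧ ∑ i ∈ Finset.range D, c i = 0 ∧
      ∑ i ∈ Finset.range D, |c i| ≤ 2 * M ∧ M * δ ≤ vl D c a := by
  induction M with
  | zero => exact ⟨0, 0, by simp, by simp, by simp, by simp [vl]⟩
  | succ M ih =>
    obtain ⟨D, c, h1, h2, h3, h4⟩ := ih
    obtain ⟨n, hn, ha⟩ := h D
    obtain ⟨e, he, hea⟩ : ∃ e : ℝ, |e| = 1 ∧ δ ≤ e * (a n - a D) := by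
      rcases abs_cases (a n - a D) with ⟨h5, _⟩ | ⟨h5, _⟩
      · exact ⟨1, by simp, by linarith⟩
      · exact ⟨-1, by simp, by linarith⟩
    let c' : ℕ → ℝ := fun i => (if i < D then c i else 0) + ((if i = n then e else 0) - (if i = D then e else 0))
    have ind : ∀ (g : ℕ → ℝ) m, ∑ i ∈ Finset.range m, (if i < D then g i else 0) = ∑ i ∈ Finset.range (min m D), g i := by
      intro g m
      rw [← Finset.sum_filter]
      congr 1
      ext i; simp
    have hs : ∀ m, ∑ i ∈ Finset.range m, c' i = ∑ i ∈ Finset.range (min m D), c i + ((if n < m then e else 0) - (if D < m then e else 0)) := by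
      intro m
      simp only [c', Finset.sum_add_distrib, Finset.sum_sub_distrib, ind]
      simp
    refine ⟨n + 1, c', ?_, ?_, ?_, ?_⟩
    · intro m hm
      rw [hs]
      by_cases hmD : D < m
      · rw [min_eq_right hmD.le, h2, if_pos hmD]
        split_ifs
        · simp
        · simp [he]
      · rw [min_eq_left (by omega), if_neg hmD, if_neg (by omega)]
        simpa using h1 m (by omega)
    · rw [hs, min_eq_right (by omega), h2, if_pos (by omega), if_pos (by omega)]; simp
    · have : ∀ i, |c' i| ≤ (if i < D then |c i| else 0) + ((if i = n then 1 else 0) + (if i = D then 1 else 0)) := by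
        intro i
        simp only [c']
        refine (abs_add_le _ _).trans (add_le_add ?_ ((abs_sub _ _).trans (add_le_add ?_ ?_)))
        · split_ifs <;> simp
        · split_ifs <;> simp [he]
        · split_ifs <;> simp [he]
      refine (Finset.sum_le_sum fun i _ => this i).trans ?_
      simp only [Finset.sum_add_distrib, ind]
      rw [min_eq_right (by omega)]
      simp [show D < n + 1 by omega]
      linarith
    · have : vl (n + 1) c' a = vl D c a + e * (a n - a D) := by
        unfold vl
        have e1 : ∀ i, c' i * a i = (if i < D then c i * a i else 0) + ((if i = n then e * a i else 0) - (if i = D then e * a i else 0)) := by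
          intro i
          simp only [c']
          split_ifs <;> ring
        simp only [e1, Finset.sum_add_distrib, Finset.sum_sub_distrib, ind]
        rw [min_eq_right (by omega)]
        simp [show D < n + 1 by omega]
        ring
      rw [this]
      push_cast
      linarith

lemma a_cauchy (Φ : (X →L[ℝ] ℝ) →L[ℝ] ℝ) : ∃ L, Tendsto (fun n => Φ (J.co n)) atTop (𝓝 L) := by
  apply cauchySeq_tendsto_of_complete
  rw [Metric.cauchySeq_iff']
  by_contra hcon
  push Not at hcon
  obtain ⟨δ, hδ, h⟩ := hcon
  have h' : ∀ N, ∃ n, N < n ∧ δ ≤ |Φ (J.co n) - Φ (J.co N)| := by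
    intro N
    obtain ⟨n, hn, h2⟩ := h N
    rw [Real.dist_eq] at h2
    refine ⟨n, lt_of_le_of_ne hn ?_, h2⟩
    rintro rfl
    simp at h2
    linarith
  obtain ⟨k, hk⟩ := exists_nat_gt (‖Φ‖ / δ)
  have hk1 : 1 ≤ k := by
    by_contra h0
    have : k = 0 := by omega
    subst this
    have : 0 ≤ ‖Φ‖ / δ := by positivity
    simp at hk; linarith
  obtain ⟨D, c, h1, h2, h3, h4⟩ := alt_build _ hδ h' (2 ^ (3 * aa k))
  have hak := aa_ge k
  have hA : Adm (nn k) D c := by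
    refine ⟨h1, h3.trans ?_⟩
    unfold nn
    push_cast
    rw [← pow_succ']
    exact pow_le_pow_right₀ (by norm_num) (by omega)
  have h5 := (J.bb_ge Φ hA).trans (J.bb_le Φ k)
  have h6 := h4.trans (le_abs_self _)
  have h7 := (mul_le_mul_of_nonneg_left h6 (ww_pos k).le).trans h5
  have h8 : ww k * (((2 ^ (3 * aa k) : ℕ) : ℝ) * δ) = 2 ^ (2 * aa k) * δ := by
    unfold ww
    push_cast
    rw [show 3 * aa k = aa k + 2 * aa k by ring, pow_add, one_div, inv_pow]
    field_simp
  rw [h8] at h7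
  have h9 : (k : ℝ) ≤ 2 ^ (2 * aa k) := by
    have : k ≤ 2 ^ (2 * aa k) := (show k ≤ 2 * aa k by omega).trans Nat.lt_two_pow_self.le
    exact_mod_cast this
  rw [div_lt_iff₀ hδ] at hk
  nlinarith

lemma bid (Φ : (X →L[ℝ] ℝ) →L[ℝ] ℝ) : ∃ (z : X) (L : ℝ), (∀ f, Φ f = f z + L * J.sg f) ∧
    Tendsto (fun n => Φ (J.co n)) atTop (𝓝 L) := by
  obtain ⟨L, hL⟩ := J.a_cauchy Φ
  obtain ⟨z, hz⟩ := J.make (fun n => Φ (J.co n) - L) (fun k => J.bb Φ k + |L| * ww k)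
    (by simpa using hL.sub_const L)
    (by
      intro k D c h
      have e : vl D c (fun n => Φ (J.co n) - L) = vl D c (fun n => Φ (J.co n)) - L * ∑ i ∈ Finset.range D, c i := by
        unfold vl
        rw [Finset.mul_sum, ← Finset.sum_sub_distrib]
        apply Finset.sum_congr rfl
        intro i _
        ring
      rw [e]
      have h1 := J.bb_ge Φ h
      have h2 := abs_sub (vl D c (fun n => Φ (J.co n))) (L * ∑ i ∈ Finset.range D, c i)
      rw [abs_mul] at h2
      have h3 := mul_le_mul_of_nonneg_left (h.1 D le_rfl) (abs_nonneg L)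
      have := ww_pos k
      nlinarith)
    (by
      refine Summable.of_nonneg_of_le (fun k => by positivity) (fun k => ?_)
        (((J.bb_sum Φ).mul_left 2).add (ww_sum.mul_left (2 * |L| ^ 2)))
      nlinarith [sq_nonneg (J.bb Φ k - |L| * ww k)])
  refine ⟨z, L, fun f => ?_, hL⟩
  have hpa : ∀ N, J.pa Φ N = J.PP N z + L • J.ss N := by
    intro N
    apply J.inj
    rw [map_add, map_smul, sq_pa, sq_PP, sq_ss, hz]
    funext j
    simp only [Pi.add_apply, Pi.smul_apply, smul_eq_mul]
    split_ifs <;> ring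
  have t1 : Tendsto (fun N => f (J.pa Φ N)) atTop (𝓝 (Φ f)) := by
    simp only [f_pa]
    exact (Φ.continuous.tendsto f).comp (J.tend_PP f)
  have t2 : Tendsto (fun N => f (J.PP N z)) atTop (𝓝 (f z)) :=
    ((ContinuousLinearMap.apply ℝ ℝ z).continuous.tendsto f).comp (J.tend_PP f)
  have t3 : Tendsto (fun N => f (J.pa Φ N)) atTop (𝓝 (f z + L * J.sg f)) := by
    simp only [hpa, map_add, map_smul, smul_eq_mul]
    exact t2.add ((J.sg_tend f).const_mul L)
  exact tendsto_nhds_unique t1 t3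

/-- limit of the coordinate functionals in the third dual -/
noncomputable def lam : ((X →L[ℝ] ℝ) →L[ℝ] ℝ) →L[ℝ] ℝ :=
  continuousLinearMapOfTendsto (fun n => NormedSpace.inclusionInDoubleDual ℝ (X →L[ℝ] ℝ) (J.co n))
    (f := fun f => Classical.choose (J.a_cauchy f)) (by
      rw [tendsto_pi_nhds]
      intro f
      exact Classical.choose_spec (J.a_cauchy f))

lemma lam_tend (Φ : (X →L[ℝ] ℝ) →L[ℝ] ℝ) : Tendsto (fun n => Φ (J.co n)) atTop (𝓝 (J.lam Φ)) :=
  Classical.choose_spec (J.a_cauchy Φ)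

lemma lam_sg : J.lam J.sg = 1 := by
  apply tendsto_nhds_unique (J.lam_tend J.sg)
  simp only [sg_co]
  exact tendsto_const_nhds

lemma lam_iota (x : X) : J.lam (NormedSpace.inclusionInDoubleDual ℝ X x) = 0 :=
  tendsto_nhds_unique (J.lam_tend _) (J.lim x)

lemma trid (Ψ : ((X →L[ℝ] ℝ) →L[ℝ] ℝ) →L[ℝ] ℝ) : ∃ (g : X →L[ℝ] ℝ) (L : ℝ), ∀ Φ, Ψ Φ = Φ g + L * J.lam Φ := by
  refine ⟨Ψ.comp (NormedSpace.inclusionInDoubleDual ℝ X), Ψ J.sg - J.sg (Ψ.comp (NormedSpace.inclusionInDoubleDual ℝ X)), fun Φ => ?_⟩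
  obtain ⟨z, L, h1, h2⟩ := J.bid Φ
  have hL : J.lam Φ = L := tendsto_nhds_unique (J.lam_tend Φ) h2
  have e : Φ = NormedSpace.inclusionInDoubleDual ℝ X z + L • J.sg := by
    ext f
    rw [h1]
    simp
  rw [h1, hL]
  conv_lhs => rw [e]
  rw [map_add, map_smul]
  simp only [ContinuousLinearMap.comp_apply, smul_eq_mul]
  ring


lemma comb (t : ℕ → ℕ) (ht : StrictMono t) (m N : ℕ) :
    (0 ≤ ∑ j ∈ Finset.range N, ((if t (2 * j) < m then (1 : ℝ) else 0) - (if t (2 * j + 1) < m then 1 else 0)) ∧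
    ∑ j ∈ Finset.range N, ((if t (2 * j) < m then (1 : ℝ) else 0) - (if t (2 * j + 1) < m then 1 else 0)) ≤ 1) ∧
    (t (2 * N) < m →
      ∑ j ∈ Finset.range N, ((if t (2 * j) < m then (1 : ℝ) else 0) - (if t (2 * j + 1) < m then 1 else 0)) = 0) := by
  induction N with
  | zero => simp
  | succ N ih =>
    obtain ⟨⟨h0, h1⟩, h2⟩ := ih
    rw [Finset.sum_range_succ]
    have m1 : t (2 * N) < t (2 * N + 1) := ht (by omega)
    have m2 : t (2 * N + 1) < t (2 * (N + 1)) := ht (by omega)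
    by_cases h : t (2 * N) < m
    · rw [h2 h, if_pos h]
      by_cases h' : t (2 * N + 1) < m
      · simp [h']
      · rw [if_neg h']
        refine ⟨by norm_num, fun h3 => absurd (m2.trans h3) h'⟩
    · rw [if_neg h, if_neg (by omega), sub_zero, add_zero]
      exact ⟨⟨h0, h1⟩, fun h3 => absurd (m1.trans (m2.trans h3)) h⟩

lemma alt_co : AltSmall J.co := by
  intro ε hε
  obtain ⟨k, hk⟩ := exists_nat_gt (1 / ε)
  have hk1 : 1 ≤ k := by
    by_contra h0
    have : k = 0 := by omega
    subst this
    have : 0 < 1 / ε := by positivity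
    simp at hk; linarith
  have hak := aa_ge k
  refine ⟨2 ^ (3 * aa k), by positivity, 2 ^ aa k, by positivity, ?_, ?_⟩
  · push_cast
    have h9 : (k : ℝ) ≤ 2 ^ (aa k) := by
      have : k ≤ 2 ^ (aa k) := hak.trans Nat.lt_two_pow_self.le
      exact_mod_cast this
    rw [div_lt_iff₀ hε] at hk
    have h1 : 1 ≤ ε * 2 ^ aa k := by nlinarith
    have h2 : ε * 2 ^ (3 * aa k) = (ε * 2 ^ aa k) * (2 ^ aa k) ^ 2 := by ring
    rw [h2]
    exact le_mul_of_one_le_left (by positivity) h1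
  · intro t ht
    generalize hN : 2 ^ (3 * aa k) = N
    have hNn : 2 * (N : ℝ) ≤ nn k := by
      rw [← hN]
      unfold nn
      push_cast
      rw [← pow_succ']
      exact pow_le_pow_right₀ (by norm_num) (by omega)
    let c : ℕ → ℝ := fun i => ∑ j ∈ Finset.range N, ((if i = t (2 * j) then (1 : ℝ) else 0) - (if i = t (2 * j + 1) then 1 else 0))
    have hA : Adm (nn k) (t (2 * N)) c := by
      constructor
      · intro m _
        simp only [c]
        rw [Finset.sum_comm]
        simp only [Finset.sum_sub_distrib, Finset.sum_ite_eq', Finset.mem_range]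
        have := comb t ht m N
        rw [Finset.sum_sub_distrib] at this
        rw [abs_le]
        constructor <;> linarith [this.1.1, this.1.2]
      · refine le_trans ?_ hNn
        have : ∀ i, |c i| ≤ ∑ j ∈ Finset.range N, ((if i = t (2 * j) then (1 : ℝ) else 0) + (if i = t (2 * j + 1) then 1 else 0)) := by
          intro i
          refine (Finset.abs_sum_le_sum_abs _ _).trans (Finset.sum_le_sum fun j _ => ?_)
          refine (abs_sub _ _).trans (add_le_add ?_ ?_) <;> split_ifs <;> simp
        refine (Finset.sum_le_sum fun i _ => this i).trans ?_
        rw [Finset.sum_comm]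
        simp only [Finset.sum_add_distrib, Finset.sum_ite_eq', Finset.mem_range]
        have e1 : ∀ g : ℕ → ℕ, ∑ j ∈ Finset.range N, (if g j < t (2 * N) then (1 : ℝ) else 0) ≤ N := by
          intro g
          calc _ ≤ ∑ j ∈ Finset.range N, (1 : ℝ) := Finset.sum_le_sum fun j _ => by split_ifs <;> simp
            _ = N := by simp
        have := e1 (fun j => t (2 * j))
        have := e1 (fun j => t (2 * j + 1))
        linarith
    apply ContinuousLinearMap.opNorm_le_bound _ (by positivity)
    intro x
    have h1 := J.vl_le k x _ _ hA
    have h2 : vl (t (2 * N)) c (J.sq x) = (∑ j ∈ Finset.range N, (J.co (t (2 * j)) - J.co (t (2 * j + 1)))) x := by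
      rw [sum_apply]
      simp only [sub_apply, co_apply]
      unfold vl
      simp only [c, Finset.sum_mul]
      rw [Finset.sum_comm]
      apply Finset.sum_congr rfl
      intro j hj
      rw [Finset.mem_range] at hj
      simp only [sub_mul, Finset.sum_sub_distrib, ite_mul, one_mul, zero_mul, Finset.sum_ite_eq', Finset.mem_range]
      rw [if_pos (ht (by omega)), if_pos (ht (by omega))]
    rw [Real.norm_eq_abs, ← h2]
    unfold ww at h1
    rw [one_div, inv_pow, inv_mul_le_iff₀ (by positivity)] at h1
    exact h1

lemma aa_ge2 (k : ℕ) : 2 * k ≤ aa k := by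
  induction k with
  | zero => simp
  | succ k ih => simp only [aa]; omega

lemma aa_mono : Monotone aa := monotone_nat_of_le_succ fun k => by simp only [aa]; omega

lemma aa_gap {k j : ℕ} (h : k < j) : 16 * aa k + 15 ≤ aa j := aa_mono (show k + 1 ≤ j from h)

lemma nk_sum_le (k : ℕ) (N : ℕ) (v : ℕ → X) (h : ∀ j, J.nk k (v j) ≤ 2 * ww k) :
    J.nk k (∑ j ∈ Finset.range N, v j) ≤ ww k * (2 * N) := by
  induction N with
  | zero =>
    simp only [Finset.range_zero, Finset.sum_empty]
    apply J.nk_le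
    intro D c _
    simp [vl]
  | succ N ih =>
    rw [Finset.sum_range_succ]
    have h1 := J.nk_add k (∑ j ∈ Finset.range N, v j) (v N)
    have h2 := h N
    push_cast
    linarith

lemma alt_ss : AltSmall J.ss := by
  intro ε hε
  obtain ⟨k, hk⟩ := exists_pow_lt_of_lt_one (show 0 < ε / 8 by positivity) (show (1 / 2 : ℝ) < 1 by norm_num)
  refine ⟨2 ^ (7 * aa k), by positivity, Real.sqrt (4 * ((2 ^ (7 * aa k) : ℕ) : ℝ) * (1 / 2) ^ k * 2), by positivity, ?_, ?_⟩
  · rw [Real.sq_sqrt (by positivity)]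
    have : (0 : ℝ) < ((2 ^ (7 * aa k) : ℕ) : ℝ) := by positivity
    nlinarith
  · intro t ht
    apply Real.le_sqrt_of_sq_le
    have hg := (hasSum_geometric_two).mul_left (4 * ((2 ^ (7 * aa k) : ℕ) : ℝ) * (1 / 2) ^ k)
    refine hasSum_le (fun j => ?_) (J.hasSum _) hg
    set u := ∑ j ∈ Finset.range (2 ^ (7 * aa k)), (J.ss (t (2 * j)) - J.ss (t (2 * j + 1))) with hu
    have hu1 : J.nk j u ≤ ww j * (2 * ((2 ^ (7 * aa k) : ℕ) : ℝ)) := by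
      apply J.nk_sum_le
      intro i
      have h1 := J.nk_add j (J.ss (t (2 * i))) ((-1 : ℝ) • (J.ss (t (2 * i + 1))))
      have h2 := J.nk_smul j (J.ss (t (2 * i + 1))) (-1)
      have h3 := J.nk_ss j (t (2 * i))
      have h4 := J.nk_ss j (t (2 * i + 1))
      rw [neg_one_smul] at h1 h2
      rw [abs_neg, abs_one, one_mul] at h2
      rw [sub_eq_add_neg]
      linarith
    have hu2 : J.nk j u ≤ ww j * (nn j * 1) := by
      apply J.nk_sup
      intro i
      rw [hu, map_sum, Finset.sum_apply]
      simp only [map_sub, Pi.sub_apply, sq_ss]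
      have := comb t ht (i + 1) (2 ^ (7 * aa k))
      have e : ∑ j ∈ Finset.range (2 ^ (7 * aa k)), ((if i < t (2 * j) then (1 : ℝ) else 0) - (if i < t (2 * j + 1) then 1 else 0))
        = - ∑ j ∈ Finset.range (2 ^ (7 * aa k)), ((if t (2 * j) < i + 1 then (1 : ℝ) else 0) - (if t (2 * j + 1) < i + 1 then 1 else 0)) := by
        rw [← Finset.sum_neg_distrib]
        apply Finset.sum_congr rfl
        intro j _
        by_cases h1 : i < t (2 * j) <;> by_cases h2 : i < t (2 * j + 1) <;> 
          simp [h1, h2, Nat.lt_succ_iff, not_lt.1, not_le.2]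
        all_goals (first | (rw [if_neg (by omega), if_neg (by omega)]; norm_num) | (rw [if_neg (by omega), if_pos (by omega)]; norm_num) | (rw [if_pos (by omega), if_neg (by omega)]; norm_num) | (rw [if_pos (by omega), if_pos (by omega)]; norm_num))
      rw [e, abs_neg, abs_le]
      constructor <;> linarith [this.1.1, this.1.2]
    push_cast at hu1 ⊢
    have hn := J.nk_nonneg j u
    have h2k := aa_ge2 k
    have h2j := aa_ge2 j
    by_cases hjk : j ≤ k
    · have h1 := pow_le_pow_left₀ hn hu2 2
      refine h1.trans ?_
      have hm := aa_mono hjk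
      have e1 : (ww j * (nn j * 1)) ^ 2 = (2 : ℝ) ^ (6 * aa j) := by
        unfold ww nn
        rw [one_div, inv_pow, show 4 * aa j = aa j + 3 * aa j by ring, pow_add]
        field_simp
        rw [← pow_mul]
        congr 1; ring
      have e2 : (4 : ℝ) * 2 ^ (7 * aa k) * (1 / 2) ^ k * (1 / 2) ^ j * (2 ^ k * 2 ^ j) = 4 * 2 ^ (7 * aa k) := by
        rw [one_div, inv_pow, inv_pow]; field_simp
      have e3 : (2 : ℝ) ^ (6 * aa j) * (2 ^ k * 2 ^ j) ≤ 4 * 2 ^ (7 * aa k) := by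
        rw [← pow_add, ← pow_add]
        calc (2 : ℝ) ^ (6 * aa j + (k + j)) ≤ 2 ^ (7 * aa k) := pow_le_pow_right₀ (by norm_num) (by omega)
          _ ≤ _ := by
            have : (0 : ℝ) < 2 ^ (7 * aa k) := by positivity
            linarith
      rw [e1]
      rw [← e2] at e3
      exact le_of_mul_le_mul_right e3 (by positivity)
    · have h1 := pow_le_pow_left₀ hn hu1 2
      refine h1.trans ?_
      have hm := aa_gap (show k < j by omega)
      have e1 : (ww j * (2 * 2 ^ (7 * aa k))) ^ 2 * (2 ^ aa j) ^ 2 = 4 * 2 ^ (7 * aa k) * (2 : ℝ) ^ (7 * aa k) := by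
        unfold ww
        rw [one_div, inv_pow]
        field_simp
        ring
      have e2 : (4 : ℝ) * 2 ^ (7 * aa k) * (1 / 2) ^ k * (1 / 2) ^ j * (2 ^ aa j) ^ 2 = 4 * 2 ^ (7 * aa k) * 2 ^ (2 * aa j - k - j) := by
        have : ((2 : ℝ) ^ aa j) ^ 2 = 2 ^ (2 * aa j - k - j) * 2 ^ k * 2 ^ j := by
          rw [← pow_add, ← pow_add, ← pow_mul]
          congr 1; omega
        rw [this, one_div, inv_pow, inv_pow]; field_simp
      have e3 : (ww j * (2 * 2 ^ (7 * aa k))) ^ 2 * (2 ^ aa j) ^ 2 ≤ (4 : ℝ) * 2 ^ (7 * aa k) * (1 / 2) ^ k * (1 / 2) ^ j * (2 ^ aa j) ^ 2 := by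
        rw [e1, e2]
        apply mul_le_mul_of_nonneg_left _ (by positivity)
        exact pow_le_pow_right₀ (by norm_num) (by omega)
      exact le_of_mul_le_mul_right e3 (by positivity)

end JS

lemma JS.final {X : Type} [NormedAddCommGroup X] [NormedSpace ℝ X] (J : JS X) : 
    ¬ IsReflexiveSpace X ∧ PropertyW X ∧ PropertyW (X →L[ℝ] ℝ) ∧
      ¬ WeaklySeqComplete (X →L[ℝ] ℝ) ∧ ¬ WeaklySeqComplete ((X →L[ℝ] ℝ) →L[ℝ] ℝ) := by
  refine ⟨?_, ?_, ?_, ?_, ?_⟩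
  · intro h
    obtain ⟨x, hx⟩ := h J.sg
    have h1 := J.lam_iota x
    rw [hx, J.lam_sg] at h1
    exact one_ne_zero h1
  · refine aux_W J.ss J.sg J.sg_tend (fun Φ => ?_) J.alt_ss
    obtain ⟨z, L, h, _⟩ := J.bid Φ
    exact ⟨z, L, h⟩
  · exact aux_W J.co J.lam J.lam_tend J.trid J.alt_co
  · intro h
    obtain ⟨f, hf⟩ := h J.co J.a_cauchy
    have h0 : f = 0 := by
      ext x
      exact tendsto_nhds_unique (hf (NormedSpace.inclusionInDoubleDual ℝ X x)) (J.lim x)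
    have h1 := hf J.sg
    rw [h0, map_zero] at h1
    simp only [J.sg_co] at h1
    exact one_ne_zero (tendsto_nhds_unique tendsto_const_nhds h1)
  · intro h
    obtain ⟨F, hF⟩ := h (fun n => NormedSpace.inclusionInDoubleDual ℝ X (J.ss n))
      (fun Ψ => ⟨_, J.sg_tend (Ψ.comp (NormedSpace.inclusionInDoubleDual ℝ X))⟩)
    have h0 : F = J.sg := by
      ext f
      exact tendsto_nhds_unique (hF (NormedSpace.inclusionInDoubleDual ℝ (X →L[ℝ] ℝ) f)) (J.sg_tend f)
    have h1 := hF J.lam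
    rw [h0, J.lam_sg] at h1
    simp only [J.lam_iota] at h1
    exact zero_ne_one (tendsto_nhds_unique tendsto_const_nhds h1)

/-- a non-reflexive Banach space such that both it and its dual have
Property (w), while neither the dual nor the bidual is weakly sequentially complete. -/
theorem statement14 : ∃ (X : Type) (_ : NormedAddCommGroup X) (_ : NormedSpace ℝ X)
    (_ : CompleteSpace X),
    ¬ IsReflexiveSpace X ∧ PropertyW X ∧ PropertyW (X →L[ℝ] ℝ) ∧
      ¬ WeaklySeqComplete (X →L[ℝ] ℝ) ∧
      ¬ WeaklySeqComplete ((X →L[ℝ] ℝ) →L[ℝ] ℝ) := by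
  refine ⟨XS, inferInstance, inferInstance, inferInstance, ?_⟩
  exact XSJ.final
end

section
/- Let K be a nonempty scattered compact Hausdorff space and let E be a Banach space. Then E has Property (w) if and only if C(K,E) has Property (w). -/
open Filter Topology

section Part1
open Metric

variable {X Y F G : Type*} [NormedAddCommGroup X] [NormedSpace ℝ X]
    [NormedAddCommGroup Y] [NormedSpace ℝ Y] [NormedAddCommGroup F] [NormedSpace ℝ F]
    [NormedAddCommGroup G] [NormedSpace ℝ G]

/-- Arens regularity of a bounded bilinear form. -/
def AR (B : X →L[ℝ] Y →L[ℝ] ℝ) : Prop :=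
  ∀ (η : (X →L[ℝ] ℝ) →L[ℝ] ℝ) (ξ : (Y →L[ℝ] ℝ) →L[ℝ] ℝ),
    η (ξ.comp B) = ξ (η.comp B.flip)

theorem wcont (ξ : Y →L[ℝ] ℝ) :
    Continuous fun w : WeakSpace ℝ Y => ξ ((toWeakSpace ℝ Y).symm w) :=
  WeakBilin.eval_continuous (topDualPairing ℝ Y).flip ξ

theorem wcont_of {α : Type*} [TopologicalSpace α] (g : α → WeakSpace ℝ Y)
    (h : ∀ ξ : Y →L[ℝ] ℝ, Continuous fun a => ξ ((toWeakSpace ℝ Y).symm (g a))) :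
    Continuous g :=
  WeakBilin.continuous_of_continuous_eval (topDualPairing ℝ Y).flip h

theorem w_t2 : T2Space (WeakSpace ℝ Y) := by
  refine T2Space.of_injective_continuous
    (f := fun (w : WeakSpace ℝ Y) (ξ : Y →L[ℝ] ℝ) => ξ ((toWeakSpace ℝ Y).symm w)) ?_ ?_
  · intro a b hab
    apply (toWeakSpace ℝ Y).symm.injective
    apply (SeparatingDual.eq_iff_forall_dual_eq (R := ℝ)).2
    intro g
    exact congrFun hab g
  · exact continuous_pi fun ξ => wcont ξ

theorem AR.weaklyCompact {B : X →L[ℝ] Y →L[ℝ] ℝ} (h : AR B) : IsWeaklyCompactOperator B := by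
  have := w_t2 (Y := Y →L[ℝ] ℝ)
  let S : WeakDual ℝ (X →L[ℝ] ℝ) → WeakSpace ℝ (Y →L[ℝ] ℝ) := fun η =>
    toWeakSpace ℝ _ ((WeakDual.toStrongDual η).comp B.flip)
  have hS : Continuous S := by
    apply wcont_of
    intro ξ
    have : (fun a => ξ ((toWeakSpace ℝ (Y →L[ℝ] ℝ)).symm (S a)))
        = fun a : WeakDual ℝ (X →L[ℝ] ℝ) => a (ξ.comp B) := by
      funext a
      exact (h (WeakDual.toStrongDual a) ξ).symm
    rw [this]
    exact WeakDual.eval_continuous _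
  have hc := (WeakDual.isCompact_closedBall (𝕜 := ℝ) (E := X →L[ℝ] ℝ) 0 1).image hS
  refine hc.closure_of_subset ?_
  rintro _ ⟨_, ⟨x, hx, rfl⟩, rfl⟩
  refine ⟨StrongDual.toWeakDual (NormedSpace.inclusionInDoubleDual ℝ X x), ?_, ?_⟩
  · simp only [Set.mem_preimage, mem_closedBall, dist_zero_right] at hx ⊢
    exact (NormedSpace.double_dual_bound ℝ X x).trans hx
  · simp only [S]
    congr 1

theorem AR_of_weaklyCompact {B : X →L[ℝ] Y →L[ℝ] ℝ} (h : IsWeaklyCompactOperator B) : AR B := by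
  classical
  -- the case of norm at most one
  have key : ∀ (η : (X →L[ℝ] ℝ) →L[ℝ] ℝ), ‖η‖ ≤ 1 → ∀ (ξ : (Y →L[ℝ] ℝ) →L[ℝ] ℝ),
      η (ξ.comp B) = ξ (η.comp B.flip) := by
    intro η hη
    set C := closure (toWeakSpace ℝ (Y →L[ℝ] ℝ) '' (B '' closedBall 0 1)) with hC
    have hCc : IsCompact C := h
    -- finite version
    have fin : ∀ s : Finset ((Y →L[ℝ] ℝ) →L[ℝ] ℝ), ∃ z ∈ C, ∀ ξ ∈ s,
        ξ ((toWeakSpace ℝ _).symm z) = η (ξ.comp B) := by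
      intro s
      let Φ : WeakSpace ℝ (Y →L[ℝ] ℝ) → (s → ℝ) := fun w ξ => ξ.1 ((toWeakSpace ℝ _).symm w)
      have hΦ : Continuous Φ := continuous_pi fun ξ => wcont ξ.1
      let L : X →ₗ[ℝ] (s → ℝ) := LinearMap.pi fun ξ => (ξ.1.comp B).toLinearMap
      let v : s → ℝ := fun ξ => η (ξ.1.comp B)
      have hv : v ∈ closure (L '' closedBall 0 1) := by
        by_contra hv
        obtain ⟨f, u, h1, h2⟩ := geometric_hahn_banach_closed_point
          ((convex_closedBall (0:X) 1).linear_image L).closure isClosed_closure hv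
        let c : s → ℝ := fun ξ => f (Pi.single ξ 1)
        have hf : ∀ w : s → ℝ, f w = ∑ ξ, w ξ * c ξ := by
          intro w
          have hw : w = ∑ ξ, w ξ • (Pi.single ξ (1:ℝ) : s → ℝ) := by
            funext j
            simp [Finset.sum_apply, Pi.single_apply]
          conv_lhs => rw [hw]
          simp only [map_sum, map_smul, smul_eq_mul, c]
        let ζ : (Y →L[ℝ] ℝ) →L[ℝ] ℝ := ∑ ξ : s, c ξ • ξ.1
        have hζ : ∀ x, ζ (B x) = f (L x) := by
          intro x
          rw [hf]
          simp [ζ, L, mul_comm]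
        have hle : ∀ x, ‖x‖ ≤ 1 → ζ (B x) < u := by
          intro x hx
          rw [hζ]
          exact h1 _ (subset_closure ⟨x, by simpa using hx, rfl⟩)
        have hu : 0 < u := by simpa using hle 0 (by simp)
        have hn : ‖ζ.comp B‖ ≤ u := by
          refine ContinuousLinearMap.opNorm_le_of_unit_norm hu.le ?_
          intro x hx
          rw [Real.norm_eq_abs, abs_le]
          have a1 := hle x hx.le
          have a2 := hle (-x) (by simp [hx])
          simp at a1 a2 ⊢
          constructor <;> linarith
        have hfv : f v = η (ζ.comp B) := by
          rw [hf]
          have : ζ.comp B = ∑ ξ : s, c ξ • (ξ.1.comp B) := by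
            ext x; simp [ζ]
          rw [this]
          simp [v, mul_comm]
        have := (le_abs_self _).trans ((η.le_opNorm (ζ.comp B)))
        have : ‖η‖ * ‖ζ.comp B‖ ≤ 1 * u := mul_le_mul hη hn (norm_nonneg _) zero_le_one
        rw [hfv] at h2
        linarith
      have hsub : closure (L '' closedBall 0 1) ⊆ Φ '' C := by
        refine closure_minimal ?_ (hCc.image hΦ).isClosed
        rintro _ ⟨x, hx, rfl⟩
        exact ⟨toWeakSpace ℝ _ (B x), subset_closure ⟨_, ⟨x, hx, rfl⟩, rfl⟩, rfl⟩
      obtain ⟨z, hz, hzv⟩ := hsub hv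
      exact ⟨z, hz, fun ξ hξ => congrFun hzv ⟨ξ, hξ⟩⟩
    -- all at once
    obtain ⟨z, hz, hz'⟩ := hCc.inter_iInter_nonempty
      (fun ξ : (Y →L[ℝ] ℝ) →L[ℝ] ℝ =>
        {w : WeakSpace ℝ (Y →L[ℝ] ℝ) | ξ ((toWeakSpace ℝ _).symm w) = η (ξ.comp B)})
      (fun ξ => isClosed_eq (wcont ξ) continuous_const)
      (fun s => by
        obtain ⟨z, hz, h⟩ := fin s
        exact ⟨z, hz, by simpa using h⟩)
    simp only [Set.mem_iInter, Set.mem_ofPred_eq] at hz'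
    have hze : (toWeakSpace ℝ _).symm z = η.comp B.flip := by
      ext y
      have := hz' (NormedSpace.inclusionInDoubleDual ℝ Y y)
      rw [NormedSpace.dual_def] at this
      rw [this]
      rfl
    intro ξ
    rw [← hz' ξ, hze]
  intro η ξ
  by_cases h0 : η = 0
  · subst h0; simp
  have hn : ‖η‖ ≠ 0 := fun h => h0 ((ContinuousLinearMap.opNorm_zero_iff η).1 h)
  have := key (‖η‖⁻¹ • η) (by
    refine ContinuousLinearMap.opNorm_le_bound _ zero_le_one fun φ => ?_
    have h1 := η.le_opNorm φ
    rw [smul_apply, smul_eq_mul, norm_mul, norm_inv, Real.norm_eq_abs ‖η‖,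
      abs_of_nonneg (norm_nonneg η), inv_mul_le_iff₀ (lt_of_le_of_ne (norm_nonneg η) hn.symm),
      one_mul]
    exact h1) ξ
  simp only [ContinuousLinearMap.smul_comp, map_smul, smul_apply] at this
  exact smul_right_injective _ (inv_ne_zero hn) this

theorem propertyW_iff : PropertyW X ↔ ∀ B : X →L[ℝ] X →L[ℝ] ℝ, AR B :=
  ⟨fun h B => AR_of_weaklyCompact (h B), fun h B => (h B).weaklyCompact⟩

theorem AR.flip {B : X →L[ℝ] Y →L[ℝ] ℝ} (h : AR B) : AR B.flip := by
  intro ξ η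
  have := h η ξ
  simpa using this.symm

theorem AR.sum {ι : Type*} (s : Finset ι) {B : ι → X →L[ℝ] Y →L[ℝ] ℝ}
    (h : ∀ i ∈ s, AR (B i)) : AR (∑ i ∈ s, B i) := by
  intro η ξ
  have e1 : ξ.comp (∑ i ∈ s, B i) = ∑ i ∈ s, ξ.comp (B i) := by
    ext x; simp
  have e2 : η.comp (∑ i ∈ s, B i).flip = ∑ i ∈ s, η.comp (B i).flip := by
    ext y
    simp only [ContinuousLinearMap.comp_apply, sum_apply]
    rw [← map_sum]
    congr 1
    ext x
    simp
  rw [e1, e2, map_sum, map_sum]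
  exact Finset.sum_congr rfl fun i hi => h i hi η ξ

theorem AR.pullback {B : X →L[ℝ] Y →L[ℝ] ℝ} (h : AR B) (p : F →L[ℝ] X) : AR (B.comp p) := by
  intro η ξ
  have := h (η.comp ((ContinuousLinearMap.compL ℝ F X ℝ).flip p)) ξ
  exact this

theorem AR_of_approx {B : X →L[ℝ] Y →L[ℝ] ℝ}
    (h : ∀ ε > 0, ∃ B' : X →L[ℝ] Y →L[ℝ] ℝ, AR B' ∧ ‖B - B'‖ ≤ ε) : AR B := by
  intro η ξ
  have hb : ∀ ε > 0, |η (ξ.comp B) - ξ (η.comp B.flip)| ≤ 2 * ‖η‖ * ‖ξ‖ * ε := by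
    intro ε hε
    obtain ⟨B', hB', hn⟩ := h ε hε
    have e := hB' η ξ
    have e1 : η (ξ.comp B) - η (ξ.comp B') = η (ξ.comp (B - B')) := by
      rw [← map_sub]; congr 1; ext; simp
    have e2 : ξ (η.comp B.flip) - ξ (η.comp B'.flip) = ξ (η.comp (B - B').flip) := by
      rw [← map_sub]; congr 1; ext; simp only [sub_apply, ContinuousLinearMap.comp_apply]; rw [← map_sub]; congr 1
    have n1 : ‖η (ξ.comp (B - B'))‖ ≤ ‖η‖ * (‖ξ‖ * ε) :=
      (η.le_opNorm _).trans (mul_le_mul_of_nonneg_left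
        ((ContinuousLinearMap.opNorm_comp_le _ _).trans
          (mul_le_mul_of_nonneg_left hn (norm_nonneg _))) (norm_nonneg _))
    have n2 : ‖ξ (η.comp (B - B').flip)‖ ≤ ‖ξ‖ * (‖η‖ * ε) :=
      (ξ.le_opNorm _).trans (mul_le_mul_of_nonneg_left
        ((ContinuousLinearMap.opNorm_comp_le _ _).trans
          (mul_le_mul_of_nonneg_left (by rw [ContinuousLinearMap.opNorm_flip]; exact hn)
            (norm_nonneg _))) (norm_nonneg _))
    rw [Real.norm_eq_abs] at n1 n2
    have : η (ξ.comp B) - ξ (η.comp B.flip)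
      = η (ξ.comp (B - B')) - ξ (η.comp (B - B').flip) := by linarith
    rw [this]
    have n3 := abs_add_le (η (ξ.comp (B - B'))) (-ξ (η.comp (B - B').flip))
    rw [abs_neg, ← sub_eq_add_neg] at n3
    linarith
  by_contra hne
  have hpos : 0 < |η (ξ.comp B) - ξ (η.comp B.flip)| := abs_pos.2 (sub_ne_zero.2 hne)
  set d := |η (ξ.comp B) - ξ (η.comp B.flip)|
  have hM : 0 ≤ 2 * ‖η‖ * ‖ξ‖ := by positivity
  have := hb (d / (2 * (2 * ‖η‖ * ‖ξ‖ + 1))) (by positivity)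
  rw [← mul_div_assoc, le_div_iff₀ (by positivity)] at this
  nlinarith

/-- ultrafilter limits of bounded families exist in the bidual -/
theorem exists_ulim {ι : Type*} (p : Ultrafilter ι) (x : ι → X) (hx : ∀ i, ‖x i‖ ≤ 1) :
    ∃ η : (X →L[ℝ] ℝ) →L[ℝ] ℝ, ∀ φ : X →L[ℝ] ℝ, Tendsto (fun i => φ (x i)) p (𝓝 (η φ)) := by
  let J : ι → WeakDual ℝ (X →L[ℝ] ℝ) := fun i =>
    StrongDual.toWeakDual (NormedSpace.inclusionInDoubleDual ℝ X (x i))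
  have hc := (WeakDual.isCompact_closedBall (𝕜 := ℝ) (E := X →L[ℝ] ℝ) 0 1)
  obtain ⟨η, -, hη⟩ := hc.ultrafilter_le_nhds (p.map J) (by
    rw [le_principal_iff]
    refine Filter.univ_mem' (f := (p : Filter ι)) fun i => ?_
    simp only [Set.mem_preimage, mem_closedBall, dist_zero_right]
    exact (NormedSpace.double_dual_bound ℝ X (x i)).trans (hx i))
  refine ⟨WeakDual.toStrongDual η, fun φ => ?_⟩
  have ht : Tendsto J p (𝓝 η) := hη
  exact ((WeakDual.eval_continuous φ).tendsto η).comp ht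

end Part1

section Part2

/-- every operator into `ℓ¹` is "diagonally null" (no complemented copy of `ℓ¹`). -/
def NN (F : Type*) [NormedAddCommGroup F] [NormedSpace ℝ F] : Prop :=
  ∀ (φ : ℕ → F →L[ℝ] ℝ) (M : ℝ) (y : ℕ → F) (ε : ℝ), 0 < ε → (∀ n, ‖y n‖ ≤ 1) →
    (∀ (y : F) (s : Finset ℕ), ∑ n ∈ s, |φ n y| ≤ M * ‖y‖) → ∃ n, φ n (y n) < ε

variable {X : Type*} [NormedAddCommGroup X] [NormedSpace ℝ X]

theorem not_AR_of_order (B : X →L[ℝ] X →L[ℝ] ℝ) (z : ℕ → X) (hz : ∀ n, ‖z n‖ ≤ 1) (a b : ℝ)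
    (hab : b < a) (h1 : ∀ k l, k ≤ l → a ≤ B (z k) (z l)) (h2 : ∀ k l, l < k → B (z k) (z l) ≤ b) :
    ¬ AR B := by
  intro h
  obtain ⟨η, hη⟩ := exists_ulim (hyperfilter ℕ) z hz
  have hle : ((hyperfilter ℕ : Ultrafilter ℕ) : Filter ℕ) ≤ atTop := Nat.hyperfilter_le_atTop
  have e := h η η
  have i1 : a ≤ η (η.comp B) := by
    refine ge_of_tendsto' (hη _) fun k => ?_
    refine ge_of_tendsto (hη (B (z k))) ?_
    filter_upwards [hle (eventually_ge_atTop k)] with l hl using h1 k l hl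
  have i2 : η (η.comp B.flip) ≤ b := by
    refine le_of_tendsto' (hη _) fun l => ?_
    refine le_of_tendsto (hη (B.flip (z l))) ?_
    filter_upwards [hle (eventually_gt_atTop l)] with k hk using h2 k l hk
  linarith

theorem rosenthal_sel (φ : ℕ → X →L[ℝ] ℝ) (M : ℝ) (x : ℕ → X) (hx : ∀ n, ‖x n‖ ≤ 1)
    (hM : ∀ (y : X) (s : Finset ℕ), ∑ n ∈ s, |φ n y| ≤ M * ‖y‖) (δ : ℝ) (hδ : 0 < δ) :
    ∃ a : ℕ → ℕ, StrictMono a ∧ ∀ k (s : Finset ℕ), k ∉ s →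
      ∑ j ∈ s, |φ (a j) (x (a k))| ≤ 2 * δ := by
  classical
  obtain ⟨η, hη⟩ := exists_ulim (hyperfilter ℕ) x hx
  have hle : ((hyperfilter ℕ : Ultrafilter ℕ) : Filter ℕ) ≤ atTop := Nat.hyperfilter_le_atTop
  have hM0 : ∀ s : Finset ℕ, ∀ b, ∑ n ∈ s, |φ n (x b)| ≤ |M| := fun s b =>
    (hM (x b) s).trans ((le_abs_self _).trans (by
      rw [abs_mul, abs_norm]; exact mul_le_of_le_one_right (abs_nonneg _) (hx b)))
  have hc : Summable fun n => |η (φ n)| := by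
    refine summable_of_sum_le (c := |M|) (fun _ => abs_nonneg _) fun s => ?_
    refine le_of_tendsto' (tendsto_finsetSum s fun n _ => (hη (φ n)).abs) fun b => hM0 s b
  obtain ⟨e, he, c, hec, -⟩ := posSumOfEncodable (ε := 1) one_pos ℕ
  have hd : Summable fun n => |η (φ n)| + e n := hc.add hec.summable
  have hd0 : ∀ n, 0 ≤ |η (φ n)| + e n := fun n => add_nonneg (abs_nonneg _) (he n).le
  have tail : ∀ f : ℕ → ℝ, (∀ n, 0 ≤ f n) → Summable f → ∃ N, ∀ s : Finset ℕ, (∀ i ∈ s, N ≤ i) →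
      ∑ i ∈ s, f i ≤ δ := by
    intro f hf hs
    obtain ⟨t, ht⟩ := summable_iff_vanishing_norm.1 hs δ hδ
    refine ⟨t.sup id + 1, fun s hsN => ?_⟩
    refine (le_abs_self _).trans (ht s ?_).le
    rw [Finset.disjoint_left]
    intro i hi hit
    have := Finset.le_sup (f := id) hit
    have := hsN i hi
    simp at *
    omega
  obtain ⟨j0, hj0⟩ := tail _ hd0 hd
  obtain ⟨f, hf, hf'⟩ := exists_seq_of_forall_finset_exists
    (fun q : ℕ × ℕ => j0 ≤ q.1 ∧ ∀ s : Finset ℕ, (∀ i ∈ s, q.2 ≤ i) →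
      ∑ i ∈ s, |φ i (x q.1)| ≤ δ)
    (fun q q' => q.2 ≤ q'.1 ∧ q.1 < q'.1 ∧ |φ q.1 (x q'.1)| ≤ |η (φ q.1)| + e q.1)
    (by
      intro s _
      have h1 : ∀ᶠ b in (hyperfilter ℕ : Filter ℕ), j0 ≤ b ∧ ∀ q ∈ s,
          q.2 ≤ b ∧ q.1 < b ∧ |φ q.1 (x b)| ≤ |η (φ q.1)| + e q.1 := by
        refine ((eventually_ge_atTop j0).filter_mono hle).and ?_
        rw [Filter.eventually_all_finset]
        intro q _
        refine ((eventually_ge_atTop q.2).filter_mono hle).and (((eventually_gt_atTop q.1).filter_mono hle).and ?_)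
        have := (hη (φ q.1)).abs.eventually_lt_const (u := |η (φ q.1)| + e q.1)
          (by linarith [he q.1])
        filter_upwards [this] with b hb using le_of_lt hb
      obtain ⟨b, hb0, hb⟩ := h1.exists
      obtain ⟨N, hN⟩ := tail (fun i => |φ i (x b)|) (fun _ => abs_nonneg _)
        (summable_of_sum_le (c := |M|) (fun _ => abs_nonneg _) fun s => hM0 s b)
      exact ⟨(b, N), ⟨hb0, hN⟩, hb⟩)
  have hmono : StrictMono fun n => (f n).1 := fun m n hmn => (hf' m n hmn).2.1
  refine ⟨fun n => (f n).1, hmono, fun k s hk => ?_⟩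
  rw [← Finset.sum_filter_add_sum_filter_not s (fun j => j < k)]
  have A : ∑ j ∈ s with j < k, |φ (f j).1 (x (f k).1)| ≤ δ := by
    calc _ ≤ ∑ j ∈ s with j < k, (|η (φ (f j).1)| + e (f j).1) := by
          refine Finset.sum_le_sum fun j hj => ?_
          exact (hf' j k (Finset.mem_filter.1 hj).2).2.2
      _ = ∑ i ∈ (s.filter (fun j => j < k)).image (fun n => (f n).1), (|η (φ i)| + e i) := by
          rw [Finset.sum_image]
          exact fun _ _ _ _ h => hmono.injective h
      _ ≤ δ := by
          apply hj0
          intro i hi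
          obtain ⟨j, -, rfl⟩ := Finset.mem_image.1 hi
          exact (hf j).1
  have B : ∑ j ∈ s with ¬ j < k, |φ (f j).1 (x (f k).1)| ≤ δ := by
    calc _ = ∑ i ∈ (s.filter (fun j => ¬ j < k)).image (fun n => (f n).1), |φ i (x (f k).1)| := by
          rw [Finset.sum_image]
          exact fun _ _ _ _ h => hmono.injective h
      _ ≤ δ := by
          apply (hf k).2
          intro i hi
          obtain ⟨j, hj, rfl⟩ := Finset.mem_image.1 hi
          obtain ⟨hj1, hj2⟩ := Finset.mem_filter.1 hj
          have : k < j := lt_of_le_of_ne (not_lt.1 hj2) (fun h => hk (h ▸ hj1))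
          exact (hf' k j this).1
  linarith

theorem exists_form (ψ : ℕ → X →L[ℝ] ℝ) (M : ℝ) (hM0 : 0 ≤ M)
    (hM : ∀ (y : X) (s : Finset ℕ), ∑ n ∈ s, |ψ n y| ≤ M * ‖y‖) :
    ∃ B : X →L[ℝ] X →L[ℝ] ℝ, ∀ x y,
      HasSum (fun j => ψ j y * ∑ i ∈ Finset.range (j + 1), ψ i x) (B x y) := by
  have hS : ∀ j x, |∑ i ∈ Finset.range (j + 1), ψ i x| ≤ M * ‖x‖ := fun j x =>
    (Finset.abs_sum_le_sum_abs _ _).trans (hM x _)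
  have hpart : ∀ x y (s : Finset ℕ), ∑ j ∈ s, |ψ j y * ∑ i ∈ Finset.range (j + 1), ψ i x|
      ≤ M * M * ‖x‖ * ‖y‖ := by
    intro x y s
    calc _ ≤ ∑ j ∈ s, |ψ j y| * (M * ‖x‖) := by
          refine Finset.sum_le_sum fun j _ => ?_
          rw [abs_mul]
          exact mul_le_mul_of_nonneg_left (hS j x) (abs_nonneg _)
      _ = (∑ j ∈ s, |ψ j y|) * (M * ‖x‖) := by rw [Finset.sum_mul]
      _ ≤ (M * ‖y‖) * (M * ‖x‖) := mul_le_mul_of_nonneg_right (hM y s) (by positivity)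
      _ = _ := by ring
  have hsum : ∀ x y, Summable (fun j => ψ j y * ∑ i ∈ Finset.range (j + 1), ψ i x) := by
    intro x y
    refine Summable.of_norm ?_
    exact summable_of_sum_le (fun _ => norm_nonneg _) (hpart x y)
  let L : X →ₗ[ℝ] X →ₗ[ℝ] ℝ := LinearMap.mk₂ ℝ
    (fun x y => ∑' j, ψ j y * ∑ i ∈ Finset.range (j + 1), ψ i x)
    (by
      intro x x' y
      rw [← (hsum x y).tsum_add (hsum x' y)]
      congr 1; funext j
      simp only [map_add, Finset.sum_add_distrib]; ring)
    (by
      intro c x y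
      rw [smul_eq_mul, ← tsum_mul_left]
      congr 1; funext j
      simp only [map_smul, smul_eq_mul, ← Finset.mul_sum]; ring)
    (by
      intro x y y'
      rw [← (hsum x y).tsum_add (hsum x y')]
      congr 1; funext j
      simp only [map_add]; ring)
    (by
      intro c x y
      rw [smul_eq_mul, ← tsum_mul_left]
      congr 1; funext j
      simp only [map_smul, smul_eq_mul]; ring)
  refine ⟨L.mkContinuous₂ (M * M) ?_, fun x y => (hsum x y).hasSum⟩
  intro x y
  refine le_of_tendsto' (hsum x y).hasSum.norm fun s => ?_
  exact (norm_sum_le _ _).trans (hpart x y s)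

theorem NN_of_AR (h : ∀ B : X →L[ℝ] X →L[ℝ] ℝ, AR B) : NN X := by
  classical
  intro φ M x ε hε hx hM
  by_contra hcon
  push Not at hcon
  have hMpos : 0 < M := by
    have h1 := hM (x 0) {0}
    have h2 := hcon 0
    rw [Finset.sum_singleton] at h1
    have h3 := le_abs_self (φ 0 (x 0))
    by_contra hneg
    have := mul_nonpos_of_nonpos_of_nonneg (not_lt.1 hneg) (norm_nonneg (x 0))
    linarith
  obtain ⟨a, ha, hoff⟩ := rosenthal_sel φ M x hx hM (ε ^ 2 / (16 * M)) (by positivity)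
  set γ := 2 * (ε ^ 2 / (16 * M)) with hγ
  have hγM : γ * M = ε ^ 2 / 8 := by rw [hγ]; field_simp; norm_num
  have hM' : ∀ (y : X) (s : Finset ℕ), ∑ n ∈ s, |φ (a n) y| ≤ M * ‖y‖ := by
    intro y s
    refine le_trans (le_of_eq ?_) (hM y (s.image a))
    rw [Finset.sum_image]
    exact fun _ _ _ _ h => ha.injective h
  obtain ⟨B, hB⟩ := exists_form (fun n => φ (a n)) M hMpos.le hM'
  have hz : ∀ n, ‖x (a n)‖ ≤ 1 := fun n => hx _
  have hMz : ∀ k (s : Finset ℕ), ∑ n ∈ s, |φ (a n) (x (a k))| ≤ M := fun k s =>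
    (hM' _ s).trans (mul_le_of_le_one_right hMpos.le (hz k))
  have hdM : ∀ k, φ (a k) (x (a k)) ≤ M := fun k => by
    have := hMz k {k}
    rw [Finset.sum_singleton] at this
    exact (le_abs_self _).trans this
  have hS : ∀ j k, |∑ i ∈ Finset.range (j + 1), φ (a i) (x (a k))| ≤ M := fun j k =>
    (Finset.abs_sum_le_sum_abs _ _).trans (hMz k _)
  -- main term
  have main : ∀ k l, |B (x (a k)) (x (a l))
      - φ (a l) (x (a l)) * ∑ i ∈ Finset.range (l + 1), φ (a i) (x (a k))| ≤ γ * M := by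
    intro k l
    have ht := ((hB (x (a k)) (x (a l))).sub_const
      (φ (a l) (x (a l)) * ∑ i ∈ Finset.range (l + 1), φ (a i) (x (a k)))).abs
    refine le_of_tendsto ht ?_
    filter_upwards [eventually_ge_atTop {l}] with s hs
    have hl : l ∈ s := by simpa using hs
    rw [← Finset.add_sum_erase s _ hl, add_sub_cancel_left]
    calc _ ≤ ∑ j ∈ s.erase l, |φ (a j) (x (a l)) *
              ∑ i ∈ Finset.range (j + 1), φ (a i) (x (a k))| := Finset.abs_sum_le_sum_abs _ _
      _ ≤ ∑ j ∈ s.erase l, |φ (a j) (x (a l))| * M := by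
          refine Finset.sum_le_sum fun j _ => ?_
          rw [abs_mul]
          exact mul_le_mul_of_nonneg_left (hS j k) (abs_nonneg _)
      _ = (∑ j ∈ s.erase l, |φ (a j) (x (a l))|) * M := by rw [Finset.sum_mul]
      _ ≤ γ * M := mul_le_mul_of_nonneg_right (hoff l _ (Finset.notMem_erase _ _)) hMpos.le
  refine not_AR_of_order B (fun n => x (a n)) hz (ε ^ 2 * 3 / 4) (ε ^ 2 / 4) (by nlinarith)
    ?_ ?_ (h B)
  · intro k l hkl
    have hk : k ∈ Finset.range (l + 1) := by simp; omega
    have h1 := (abs_le.1 (main k l)).1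
    have h2 : |∑ i ∈ (Finset.range (l + 1)).erase k, φ (a i) (x (a k))| ≤ γ :=
      (Finset.abs_sum_le_sum_abs _ _).trans (hoff k _ (Finset.notMem_erase _ _))
    rw [← Finset.add_sum_erase _ _ hk] at h1
    set R := ∑ i ∈ (Finset.range (l + 1)).erase k, φ (a i) (x (a k))
    set p := φ (a l) (x (a l))
    set q := φ (a k) (x (a k))
    have hp : ε ≤ p := hcon _
    have hq : ε ≤ q := hcon _
    have hpM : p ≤ M := hdM l
    have e1 : ε ^ 2 ≤ p * q := by nlinarith
    have e2 : |p * R| ≤ γ * M := by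
      rw [abs_mul, abs_of_nonneg (hε.le.trans hp), mul_comm]
      exact mul_le_mul h2 hpM (hε.le.trans hp) ((abs_nonneg _).trans h2)
    have e3 := (abs_le.1 e2).1
    nlinarith
  · intro k l hkl
    have h1 := (abs_le.1 (main k l)).2
    have h2 : |∑ i ∈ Finset.range (l + 1), φ (a i) (x (a k))| ≤ γ :=
      (Finset.abs_sum_le_sum_abs _ _).trans (hoff k _ (by simp; omega))
    set R := ∑ i ∈ Finset.range (l + 1), φ (a i) (x (a k))
    set p := φ (a l) (x (a l))
    have hp : ε ≤ p := hcon _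
    have e2 : |p * R| ≤ γ * M := by
      rw [abs_mul, abs_of_nonneg (hε.le.trans hp), mul_comm]
      exact mul_le_mul h2 (hdM l) (hε.le.trans hp) ((abs_nonneg _).trans h2)
    have e3 := (abs_le.1 e2).2
    nlinarith

theorem NN.tendsto (h : NN X) (φ : ℕ → X →L[ℝ] ℝ) (M : ℝ)
    (hM : ∀ (y : X) (s : Finset ℕ), ∑ n ∈ s, |φ n y| ≤ M * ‖y‖) :
    Tendsto (fun n => ‖φ n‖) atTop (𝓝 0) := by
  classical
  by_contra hcon
  rw [Metric.tendsto_atTop] at hcon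
  push Not at hcon
  obtain ⟨ε, hε, hcon⟩ := hcon
  have hfr : ∃ᶠ n in atTop, ε ≤ ‖φ n‖ := by
    rw [frequently_atTop]
    intro N
    obtain ⟨n, hn, h⟩ := hcon N
    exact ⟨n, hn, by simpa using h⟩
  obtain ⟨a, ha, hae⟩ := extraction_of_frequently_atTop hfr
  have hy : ∀ n, ∃ y : X, ‖y‖ ≤ 1 ∧ ε / 2 ≤ φ (a n) y := by
    intro n
    by_contra hc
    push Not at hc
    have : ‖φ (a n)‖ ≤ ε / 2 := by
      refine ContinuousLinearMap.opNorm_le_of_unit_norm (by positivity) fun x hx => ?_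
      rw [Real.norm_eq_abs, abs_le]
      have a1 := hc x hx.le
      have a2 := hc (-x) (by simp [hx])
      simp at a1 a2 ⊢
      constructor <;> linarith
    linarith [hae n]
  choose y hy1 hy2 using hy
  obtain ⟨n, hn⟩ := h (fun n => φ (a n)) M y (ε / 2) (by positivity) hy1 (by
    intro y s
    refine le_trans (le_of_eq ?_) (hM y (s.image a))
    rw [Finset.sum_image]
    exact fun _ _ _ _ h => ha.injective h)
  linarith [hy2 n]

end Part2

section Part3

variable {K : Type*} [TopologicalSpace K] [CompactSpace K] [T2Space K]
  {E : Type*} [NormedAddCommGroup E] [NormedSpace ℝ E]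

theorem exists_bump (k : K) (U : Set K) (hU : IsOpen U) (hk : k ∈ U) :
    ∃ h : C(K, ℝ), (∀ x, 0 ≤ h x ∧ h x ≤ 1) ∧ (∀ᶠ x in 𝓝 k, h x = 1) ∧ ∀ x ∉ U, h x = 0 := by
  obtain ⟨V, hV, hVc, hVU⟩ := exists_mem_nhds_isClosed_subset (hU.mem_nhds hk)
  obtain ⟨h, h0, h1, h01⟩ := exists_continuous_zero_one_of_isClosed hU.isClosed_compl hVc
    (Set.disjoint_left.2 fun x hx hxV => hx (hVU hxV))
  exact ⟨h, h01, by filter_upwards [hV] with x hx using h1 hx, fun x hx => h0 hx⟩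

theorem exists_zeta (k : K) : ∃ ζ : (C(K, ℝ) →L[ℝ] ℝ) →L[ℝ] ℝ,
    (∀ φ : C(K, ℝ) →L[ℝ] ℝ, |ζ φ| ≤ ‖φ‖) ∧ ∀ U : Set K, IsOpen U → k ∈ U → ∀ (φ : C(K, ℝ) →L[ℝ] ℝ) (ε : ℝ), 0 < ε →
    ∃ h : C(K, ℝ), (∀ x, 0 ≤ h x ∧ h x ≤ 1) ∧ (∀ᶠ x in 𝓝 k, h x = 1) ∧ (∀ x ∉ U, h x = 0) ∧
      |φ h - ζ φ| < ε := by
  choose h h01 h1 h0 using fun U : TopologicalSpace.OpenNhdsOf k =>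
    exists_bump k (U : Set K) U.isOpen U.mem
  have hn : ∀ U, ‖h U‖ ≤ 1 := fun U => by
      rw [ContinuousMap.norm_le _ zero_le_one]
      intro x
      rw [Real.norm_eq_abs, abs_of_nonneg (h01 U x).1]
      exact (h01 U x).2
  obtain ⟨ζ, hζ⟩ := exists_ulim (Ultrafilter.of (atBot : Filter (TopologicalSpace.OpenNhdsOf k))) h
    hn
  refine ⟨ζ, fun φ => le_of_tendsto' (hζ φ).abs fun U => (φ.le_opNorm _).trans
    (mul_le_of_le_one_right (norm_nonneg _) (hn U)), fun U hU hk φ ε hε => ?_⟩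
  have e1 := (Metric.tendsto_nhds.1 (hζ φ)) ε hε
  have e2 := (eventually_le_atBot (⟨⟨U, hU⟩, hk⟩ : TopologicalSpace.OpenNhdsOf k)).filter_mono
    (Ultrafilter.of_le _)
  obtain ⟨V, hV1, hV2⟩ := (e1.and e2).exists
  exact ⟨h V, h01 V, h1 V, fun x hx => h0 V x fun hxV => hx (hV2 hxV), hV1⟩

/-- the map `(g, e) ↦ g • e` -/
noncomputable def mulE (K E : Type*) [TopologicalSpace K] [CompactSpace K] [NormedAddCommGroup E]
    [NormedSpace ℝ E] : C(K, ℝ) →L[ℝ] E →L[ℝ] C(K, E) :=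
  LinearMap.mkContinuous₂ (LinearMap.mk₂ ℝ
    (fun (g : C(K, ℝ)) (e : E) => (⟨fun x => g x • e, by fun_prop⟩ : C(K, E)))
    (by intros; ext; simp [add_smul]) (by intros; ext; simp [mul_smul])
    (by intros; ext; simp) (by intros; ext; exact smul_comm _ _ _)) 1 (by
      intro g e
      rw [ContinuousMap.norm_le _ (by positivity)]
      intro x
      simp only [LinearMap.mk₂_apply, ContinuousMap.coe_mk, norm_smul, one_mul]
      exact mul_le_mul_of_nonneg_right (g.norm_coe_le_norm x) (norm_nonneg _))

@[simp] theorem mulE_apply (g : C(K, ℝ)) (e : E) (x : K) : mulE K E g e x = g x • e := rfl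

/-- the atom of a functional at a point -/
noncomputable def atomP (E : Type*) [NormedAddCommGroup E] [NormedSpace ℝ E] (k : K) :
    (C(K, E) →L[ℝ] ℝ) →L[ℝ] (E →L[ℝ] ℝ) :=
  LinearMap.mkContinuous₂ (LinearMap.mk₂ ℝ
    (fun (μ : C(K, E) →L[ℝ] ℝ) (e : E) => (exists_zeta k).choose (μ.comp ((mulE K E).flip e)))
    (by intro μ ν e; rw [ContinuousLinearMap.add_comp, map_add])
    (by intro c μ e; rw [ContinuousLinearMap.smul_comp, map_smul])
    (by intro μ e e'; rw [map_add, ContinuousLinearMap.comp_add, map_add])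
    (by intro c μ e; rw [map_smul, ContinuousLinearMap.comp_smul, map_smul]))
    ‖(mulE K E).flip‖ (by
      intro μ e
      rw [LinearMap.mk₂_apply]
      refine ((exists_zeta k).choose_spec.1 _).trans ?_
      have h1 := ContinuousLinearMap.opNorm_comp_le μ ((mulE K E).flip e)
      have h2 := (mulE K E).flip.le_opNorm e
      calc _ ≤ ‖μ‖ * (‖(mulE K E).flip‖ * ‖e‖) :=
            h1.trans (mul_le_mul_of_nonneg_left h2 (norm_nonneg _))
        _ = _ := by ring)

theorem atomP_spec (k : K) (U : Set K) (hU : IsOpen U) (hk : k ∈ U) (μ : C(K, E) →L[ℝ] ℝ) (e : E)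
    (ε : ℝ) (hε : 0 < ε) :
    ∃ h : C(K, ℝ), (∀ x, 0 ≤ h x ∧ h x ≤ 1) ∧ (∀ᶠ x in 𝓝 k, h x = 1) ∧ (∀ x ∉ U, h x = 0) ∧
      |μ (mulE K E h e) - atomP E k μ e| < ε :=
  (exists_zeta k).choose_spec.2 U hU hk (μ.comp ((mulE K E).flip e)) ε hε

/-- evaluation -/
noncomputable def evE (E : Type*) [NormedAddCommGroup E] [NormedSpace ℝ E] (k : K) : C(K, E) →L[ℝ] E :=
  ContinuousMap.evalCLM ℝ k

@[simp] theorem evE_apply (k : K) (f : C(K, E)) : evE E k f = f k := rfl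

theorem atomP_ev (j k : K) (φ : E →L[ℝ] ℝ) [Decidable (k = j)] :
    atomP E k (φ.comp (evE E j)) = if k = j then φ else 0 := by
  ext e
  refine eq_of_forall_dist_le fun ε hε => ?_
  rw [dist_comm, Real.dist_eq]
  split_ifs with h
  · subst h
    obtain ⟨h, -, h1, -, h2⟩ := atomP_spec k Set.univ isOpen_univ trivial (φ.comp (evE E k)) e ε hε
    simpa [h1.self_of_nhds] using h2.le
  · obtain ⟨h, -, h1, h0, h2⟩ := atomP_spec k {j}ᶜ isOpen_compl_singleton h
      (φ.comp (evE E j)) e ε hε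
    simpa [h0 j (by simp)] using h2.le

theorem atom_sum_le (μ : C(K, E) →L[ℝ] ℝ) (A : Finset K) (e : K → E) (he : ∀ k, ‖e k‖ ≤ 1) :
    ∑ k ∈ A, atomP E k μ (e k) ≤ ‖μ‖ := by
  classical
  refine le_of_forall_pos_le_add fun ε hε => ?_
  obtain ⟨U, hU, hd⟩ := A.finite_toSet.t2_separation
  choose h h01 h1 h0 h2 using fun k => atomP_spec k (U k) (hU k).2 (hU k).1 μ (e k)
    (ε / (A.card + 1)) (by positivity)
  have b1 : μ (∑ k ∈ A, mulE K E (h k) (e k)) ≤ ‖μ‖ := by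
    refine (le_abs_self _).trans ((μ.le_opNorm _).trans
      (mul_le_of_le_one_right (norm_nonneg _) ?_))
    rw [ContinuousMap.norm_le _ zero_le_one]
    intro x
    have : (∑ k ∈ A, mulE K E (h k) (e k)) x = ∑ k ∈ A, h k x • e k := by
      rw [ContinuousMap.sum_apply]; rfl
    rw [this]
    by_cases hx : ∃ k ∈ A, x ∈ U k
    · obtain ⟨k, hk, hxk⟩ := hx
      rw [Finset.sum_eq_single k]
      · rw [norm_smul, Real.norm_eq_abs, abs_of_nonneg (h01 k x).1]
        exact mul_le_one₀ (h01 k x).2 (norm_nonneg _) (he k)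
      · intro j hj hjk
        rw [h0 j x, zero_smul]
        intro hxj
        exact Set.disjoint_left.1 (hd hj hk hjk) hxj hxk
      · intro h; exact absurd hk h
    · rw [Finset.sum_eq_zero]
      · simp
      · intro j hj
        rw [h0 j x, zero_smul]
        exact fun hxj => hx ⟨j, hj, hxj⟩
  have b2 : ∑ k ∈ A, atomP E k μ (e k)
      ≤ ∑ k ∈ A, (μ (mulE K E (h k) (e k)) + ε / (A.card + 1)) := by
    refine Finset.sum_le_sum fun k _ => ?_
    have := (abs_lt.1 (h2 k)).1
    linarith
  rw [Finset.sum_add_distrib, ← map_sum, Finset.sum_const, nsmul_eq_mul] at b2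
  have b3 : (A.card : ℝ) * (ε / (A.card + 1)) ≤ ε := by
    rw [← mul_div_assoc, div_le_iff₀ (by positivity)]
    nlinarith
  linarith

theorem atom_sum_abs_le (μ : C(K, E) →L[ℝ] ℝ) (A : Finset K) (e : K → E) (he : ∀ k, ‖e k‖ ≤ 1) :
    ∑ k ∈ A, |atomP E k μ (e k)| ≤ ‖μ‖ := by
  classical
  have := atom_sum_le μ A (fun k => if 0 ≤ atomP E k μ (e k) then e k else - e k) (by
    intro k
    split_ifs
    · exact he k
    · rw [norm_neg]; exact he k)
  refine le_trans (le_of_eq (Finset.sum_congr rfl fun k _ => ?_)) this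
  split_ifs with h
  · exact abs_of_nonneg h
  · rw [map_neg, abs_of_neg (not_le.1 h)]

theorem exists_near {X : Type*} [NormedAddCommGroup X] [NormedSpace ℝ X] (φ : X →L[ℝ] ℝ) (ε : ℝ)
    (hε : 0 < ε) : ∃ y : X, ‖y‖ ≤ 1 ∧ ‖φ‖ - ε ≤ φ y := by
  by_contra hc
  push Not at hc
  have h0 := hc 0 (by simp)
  rw [map_zero] at h0
  have : ‖φ‖ ≤ ‖φ‖ - ε := by
    refine le_of_forall_pos_le_add fun δ hδ => ?_
    refine ContinuousLinearMap.opNorm_le_of_unit_norm (by linarith) fun x hx => ?_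
    rw [Real.norm_eq_abs, abs_le]
    have a1 := hc x hx.le
    have a2 := hc (-x) (by simp [hx])
    rw [map_neg] at a2
    constructor <;> linarith
  linarith

theorem exists_sel (μ : C(K, E) →L[ℝ] ℝ) (A : Finset K) (r : ℝ)
    (hr : r < ∑ k ∈ A, ‖atomP E k μ‖) :
    ∃ e : K → E, (∀ k, ‖e k‖ ≤ 1) ∧ r < ∑ k ∈ A, atomP E k μ (e k) := by
  set d := ∑ k ∈ A, ‖atomP E k μ‖ - r with hd
  have hdpos : 0 < d := by rw [hd]; linarith
  choose e he1 he2 using fun k => exists_near (atomP E k μ) (d / (A.card + 1)) (by positivity)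
  refine ⟨e, he1, ?_⟩
  have := Finset.sum_le_sum (s := A) fun k _ => he2 k
  rw [Finset.sum_sub_distrib, Finset.sum_const, nsmul_eq_mul] at this
  have b3 : (A.card : ℝ) * (d / (A.card + 1)) < d := by
    rw [← mul_div_assoc, div_lt_iff₀ (by positivity)]
    nlinarith
  linarith

theorem atom_norm_sum_le (μ : C(K, E) →L[ℝ] ℝ) (A : Finset K) :
    ∑ k ∈ A, ‖atomP E k μ‖ ≤ ‖μ‖ := by
  by_contra h
  obtain ⟨e, he, h1⟩ := exists_sel μ A _ (not_le.1 h)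
  linarith [atom_sum_le μ A e he]

/-- pointwise product -/
noncomputable def smulC (g : C(K, ℝ)) (f : C(K, E)) : C(K, E) := ⟨fun x => g x • f x, by fun_prop⟩

theorem smulC_apply (g : C(K, ℝ)) (f : C(K, E)) (x : K) : smulC g f x = g x • f x := rfl

theorem eq_zero_of_atom (hK : Scattered K) (μ : C(K, E) →L[ℝ] ℝ) (h : ∀ k, atomP E k μ = 0) :
    μ = 0 := by
  classical
  let good : Set K → Prop := fun V => IsOpen V ∧ ∀ f : C(K, E), tsupport f ⊆ V → μ f = 0
  let U : Set K := ⋃₀ {V | good V}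
  have hUo : IsOpen U := isOpen_sUnion fun V hV => hV.1
  have hU : ∀ f : C(K, E), tsupport f ⊆ U → μ f = 0 := by
    intro f hf
    obtain ⟨t, ht⟩ := (isClosed_tsupport f).isCompact.elim_finite_subcover
      (fun V : {V // good V} => V.1) (fun V => V.2.1)
      (by
        intro x hx
        obtain ⟨V, hV, hxV⟩ := hf hx
        exact Set.mem_iUnion.2 ⟨⟨V, hV⟩, hxV⟩)
    let s : Fin t.card → Set K := fun i => (t.equivFin.symm i).1.1
    have hgs : ∀ i, good (s i) := fun i => (t.equivFin.symm i).1.2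
    obtain ⟨ρ, h1, h2, -, -⟩ := exists_continuous_sum_one_of_isOpen_isCompact (s := s)
      (t := tsupport f) (fun i => (hgs i).1) (isClosed_tsupport f).isCompact (by
        intro x hx
        obtain ⟨V, hV, hxV⟩ := Set.mem_iUnion₂.1 (ht hx)
        exact Set.mem_iUnion.2 ⟨t.equivFin ⟨V, hV⟩, by simpa [s] using hxV⟩)
    have : f = ∑ i, smulC (ρ i) f := by
      ext x
      rw [ContinuousMap.sum_apply]
      simp only [smulC_apply]
      rw [← Finset.sum_smul]
      by_cases hx : x ∈ tsupport f
      · have := h2 hx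
        simp only [ContinuousMap.coe_sum, Finset.sum_apply, Pi.one_apply] at this
        rw [this, one_smul]
      · rw [image_eq_zero_of_notMem_tsupport hx, smul_zero]
    rw [this, map_sum]
    refine Finset.sum_eq_zero fun i _ => ?_
    refine (hgs i).2 _ (Set.Subset.trans (closure_mono ?_) (h1 i))
    intro x hx hx0
    exact hx (by simp [smulC_apply, hx0])
  have hUuniv : Uᶜ = ∅ := by
    by_contra hne
    obtain ⟨x, hx, V, hV, hVx⟩ := hK Uᶜ (Set.nonempty_iff_ne_empty.2 hne) hUo.isClosed_compl
    have hxV : x ∈ V := by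
      have : x ∈ V ∩ Uᶜ := by rw [hVx]; rfl
      exact this.1
    apply hx
    refine ⟨V, ⟨hV, ?_⟩, hxV⟩
    intro f hf
    by_contra hne
    have hpos : 0 < |μ f| := abs_pos.2 hne
    set ε := |μ f| / (2 * (‖μ‖ + 1)) with hε
    have hε0 : 0 < ε := by positivity
    let W : Set K := {y | ‖f y - f x‖ < ε}
    have hW : IsOpen W := isOpen_lt (by fun_prop) continuous_const
    obtain ⟨g, g01, g1, g0, hg⟩ := atomP_spec x W hW (by simpa [W] using hε0) μ (f x)
      (|μ f| / 2) (by positivity)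
    rw [h x, zero_apply, sub_zero] at hg
    have e1 : f = smulC (1 - g) f + (smulC g f - mulE K E g (f x)) + mulE K E g (f x) := by
      ext y
      simp [smulC_apply, sub_smul]
    have e2 : μ (smulC (1 - g) f) = 0 := by
      apply hU
      intro y hy
      have hyf : y ∈ tsupport f := by
        refine closure_mono ?_ hy
        intro z hz hz0
        exact hz (by simp [smulC_apply, hz0])
      have hyx : y ≠ x := by
        rintro rfl
        have := notMem_tsupport_iff_eventuallyEq.2 (show ⇑(smulC (1 - g) f) =ᶠ[𝓝 y] 0 by
          filter_upwards [g1] with z hz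
          simp [smulC_apply, hz])
        exact this hy
      by_contra hyU
      have : y ∈ V ∩ Uᶜ := ⟨hf hyf, hyU⟩
      rw [hVx] at this
      exact hyx this
    have e3 : |μ (smulC g f - mulE K E g (f x))| ≤ ‖μ‖ * ε := by
      refine (μ.le_opNorm _).trans (mul_le_mul_of_nonneg_left ?_ (norm_nonneg _))
      rw [ContinuousMap.norm_le _ hε0.le]
      intro y
      have : (smulC g f - mulE K E g (f x)) y = g y • (f y - f x) := by
        simp [smulC_apply, smul_sub]
      rw [this, norm_smul, Real.norm_eq_abs, abs_of_nonneg (g01 y).1]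
      by_cases hy : y ∈ W
      · have hy' : ‖f y - f x‖ < ε := hy
        calc _ ≤ 1 * ‖f y - f x‖ := mul_le_mul_of_nonneg_right (g01 y).2 (norm_nonneg _)
          _ ≤ ε := by linarith
      · rw [g0 y hy, zero_mul]; exact hε0.le
    have e4 : ‖μ‖ * ε < |μ f| / 2 := by
      have : ε * (2 * (‖μ‖ + 1)) = |μ f| := by rw [hε]; field_simp
      nlinarith
    have e5 : μ f = μ (smulC g f - mulE K E g (f x)) + μ (mulE K E g (f x)) := by
      conv_lhs => rw [e1]
      rw [map_add, map_add, e2, zero_add]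
    have e6 := abs_add_le (μ (smulC g f - mulE K E g (f x))) (μ (mulE K E g (f x)))
    rw [← e5] at e6
    linarith
  ext f
  exact hU f (by rw [Set.compl_empty_iff.1 hUuniv]; exact Set.subset_univ _)

theorem atom_rep (hK : Scattered K) (μ : C(K, E) →L[ℝ] ℝ) :
    HasSum (fun k => (atomP E k μ).comp (evE E k)) μ := by
  classical
  have hev : ∀ k : K, ‖evE E k‖ ≤ 1 := fun k =>
    ContinuousLinearMap.opNorm_le_bound _ zero_le_one fun f => by
      rw [one_mul]; exact f.norm_coe_le_norm k
  have hs : Summable (fun k => (atomP E k μ).comp (evE E k)) := by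
    refine Summable.of_norm (summable_of_sum_le (c := ‖μ‖) (fun _ => norm_nonneg _) fun s => ?_)
    refine le_trans (Finset.sum_le_sum fun k _ => ?_) (atom_norm_sum_le μ s)
    exact (ContinuousLinearMap.opNorm_comp_le _ _).trans
      (mul_le_of_le_one_right (norm_nonneg _) (hev k))
  have : μ - ∑' k, (atomP E k μ).comp (evE E k) = 0 := by
    apply eq_zero_of_atom hK
    intro j
    rw [map_sub, (atomP E j).map_tsum hs, tsum_eq_single j]
    · rw [atomP_ev, if_pos rfl, sub_self]
    · intro k hk
      rw [atomP_ev, if_neg hk.symm]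
  have h2 := hs.hasSum
  rwa [← sub_eq_zero.1 this] at h2

theorem atom_exists (hK : Scattered K) (μ : C(K, E) →L[ℝ] ℝ) (r : ℝ) (hr : r < ‖μ‖) :
    ∃ A : Finset K, r < ∑ k ∈ A, ‖atomP E k μ‖ := by
  by_contra hc
  push Not at hc
  have hev : ∀ k : K, ‖evE E k‖ ≤ 1 := fun k =>
    ContinuousLinearMap.opNorm_le_bound _ zero_le_one fun f => by
      rw [one_mul]; exact f.norm_coe_le_norm k
  have : ‖μ‖ ≤ r := by
    refine le_of_tendsto' (atom_rep hK μ).norm fun s => ?_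
    refine (norm_sum_le _ _).trans (le_trans (Finset.sum_le_sum fun k _ => ?_) (hc s))
    exact (ContinuousLinearMap.opNorm_comp_le _ _).trans
      (mul_le_of_le_one_right (norm_nonneg _) (hev k))
  linarith

theorem atom_exists_disjoint (hK : Scattered K) (μ : C(K, E) →L[ℝ] ℝ) (r : ℝ) (A : Finset K)
    (hr : r < ‖μ - ∑ k ∈ A, (atomP E k μ).comp (evE E k)‖) :
    ∃ A' : Finset K, Disjoint A A' ∧ r < ∑ k ∈ A', ‖atomP E k μ‖ := by
  classical
  obtain ⟨A', hA'⟩ := atom_exists hK _ r hr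
  have hv : ∀ j, atomP E j (μ - ∑ k ∈ A, (atomP E k μ).comp (evE E k))
      = if j ∈ A then 0 else atomP E j μ := by
    intro j
    rw [map_sub, map_sum]
    simp only [atomP_ev]
    rw [Finset.sum_ite_eq]
    split_ifs <;> simp
  refine ⟨A' \ A, Finset.disjoint_sdiff, hA'.trans_le (le_of_eq ?_)⟩
  rw [Finset.sum_congr rfl fun j _ => by rw [hv j]]
  rw [Finset.sdiff_eq_filter, Finset.sum_filter]
  refine Finset.sum_congr rfl fun j _ => ?_
  split_ifs <;> simp

end Part3

section Part4

variable {K : Type*} [TopologicalSpace K] [CompactSpace K] [T2Space K]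
  {E : Type*} [NormedAddCommGroup E] [NormedSpace ℝ E]
  {F : Type*} [NormedAddCommGroup F] [NormedSpace ℝ F]

theorem evE_norm_le (k : K) : ‖evE E k‖ ≤ 1 :=
  ContinuousLinearMap.opNorm_le_bound _ zero_le_one fun f => by
    rw [one_mul]; exact f.norm_coe_le_norm k

theorem atom_disj_sum (μ : C(K, E) →L[ℝ] ℝ) (s : Finset ℕ) (A : ℕ → Finset K)
    (hd : ∀ m n, m < n → Disjoint (A m) (A n)) (e : ℕ → K → E) (he : ∀ n k, ‖e n k‖ ≤ 1) :
    ∑ n ∈ s, |∑ k ∈ A n, atomP E k μ (e n k)| ≤ ‖μ‖ := by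
  classical
  have hd' : ∀ m n, m ≠ n → Disjoint (A m) (A n) := fun m n h =>
    (lt_or_gt_of_ne h).elim (hd m n) fun h => (hd n m h).symm
  let e' : K → E := fun k => if h : ∃ n, k ∈ A n then e h.choose k else 0
  have h1 : ∀ k, ‖e' k‖ ≤ 1 := by
    intro k
    simp only [e']
    split_ifs
    · exact he _ _
    · simp
  have h2 : ∀ n, ∀ k ∈ A n, e' k = e n k := by
    intro n k hk
    have hex : ∃ n, k ∈ A n := ⟨n, hk⟩
    simp only [e', dif_pos hex]
    by_contra hne
    have hne' : hex.choose ≠ n := fun h => hne (by rw [h])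
    exact Finset.disjoint_left.1 (hd' _ _ hne') hex.choose_spec hk
  have h3 := atom_sum_abs_le μ (s.biUnion A) e' h1
  rw [Finset.sum_biUnion (fun m _ n _ h => hd' m n h)] at h3
  refine le_trans (Finset.sum_le_sum fun n _ => ?_) h3
  refine (Finset.abs_sum_le_sum_abs _ _).trans (le_of_eq (Finset.sum_congr rfl fun k hk => ?_))
  rw [h2 n k hk]

theorem AR_CKE (hK : Scattered K) (hN : NN F) (hE : ∀ B : E →L[ℝ] F →L[ℝ] ℝ, AR B)
    (B : C(K, E) →L[ℝ] F →L[ℝ] ℝ) : AR B := by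
  classical
  apply AR_of_approx
  intro ε hε
  by_contra hcon
  push Not at hcon
  have key : ∀ A : Finset K, ∃ y : F, ‖y‖ ≤ 1 ∧ ∃ A' : Finset K, Disjoint A A' ∧
      ε / 2 < ∑ k ∈ A', ‖atomP E k (B.flip y)‖ := by
    intro A
    let Bk : K → (E →L[ℝ] F →L[ℝ] ℝ) := fun k => ((atomP E k).comp B.flip).flip
    have h1 := hcon (∑ k ∈ A, (Bk k).comp (evE E k))
      (AR.sum A fun k _ => (hE (Bk k)).pullback (evE E k))
    by_contra hc
    push Not at hc
    have hy : ∀ y : F, ‖y‖ ≤ 1 →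
        ‖B.flip y - ∑ k ∈ A, (atomP E k (B.flip y)).comp (evE E k)‖ ≤ ε / 2 := by
      intro y hy
      by_contra h
      obtain ⟨A', hA, hA'⟩ := atom_exists_disjoint hK (B.flip y) (ε / 2) A (not_le.1 h)
      exact absurd (hc y hy A' hA) (not_le.2 hA')
    have hy2 : ∀ y : F, ‖B.flip y - ∑ k ∈ A, (atomP E k (B.flip y)).comp (evE E k)‖
        ≤ ε / 2 * ‖y‖ := by
      intro y
      by_cases h0 : y = 0
      · subst h0; simp
      have hn : 0 < ‖y‖ := norm_pos_iff.2 h0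
      have := hy (‖y‖⁻¹ • y) (by rw [norm_smul, norm_inv, norm_norm, inv_mul_cancel₀ hn.ne'])
      have e : B.flip (‖y‖⁻¹ • y) - ∑ k ∈ A, (atomP E k (B.flip (‖y‖⁻¹ • y))).comp (evE E k)
          = ‖y‖⁻¹ • (B.flip y - ∑ k ∈ A, (atomP E k (B.flip y)).comp (evE E k)) := by
        rw [smul_sub, Finset.smul_sum]
        simp only [map_smul, ContinuousLinearMap.smul_comp]
      rw [e, norm_smul, norm_inv, norm_norm, inv_mul_le_iff₀ hn] at this
      linarith
    have : ‖B - ∑ k ∈ A, (Bk k).comp (evE E k)‖ ≤ ε / 2 := by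
      refine ContinuousLinearMap.opNorm_le_bound₂ _ (by positivity) fun f y => ?_
      have e : (B - ∑ k ∈ A, (Bk k).comp (evE E k)) f y
          = (B.flip y - ∑ k ∈ A, (atomP E k (B.flip y)).comp (evE E k)) f := by
        simp [Bk, sum_apply]
      rw [e]
      refine (ContinuousLinearMap.le_opNorm _ _).trans ?_
      calc _ ≤ (ε / 2 * ‖y‖) * ‖f‖ := mul_le_mul_of_nonneg_right (hy2 y) (norm_nonneg _)
        _ = _ := by ring
    linarith
  obtain ⟨f, hf, hd⟩ := exists_seq_of_forall_finset_exists
    (fun p : F × Finset K => ‖p.1‖ ≤ 1 ∧ ε / 2 < ∑ k ∈ p.2, ‖atomP E k (B.flip p.1)‖)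
    (fun p q => Disjoint p.2 q.2) (by
      intro s _
      obtain ⟨y, hy, A', hA, hA'⟩ := key (s.biUnion fun p => p.2)
      refine ⟨(y, A'), ⟨hy, hA'⟩, fun x hx => ?_⟩
      exact Finset.disjoint_of_subset_left
        (Finset.subset_biUnion_of_mem (fun p : F × Finset K => p.2) hx) hA)
  choose e he1 he2 using fun n => exists_sel (B.flip (f n).1) (f n).2 _ (hf n).2
  let φ : ℕ → F →L[ℝ] ℝ := fun n =>
    ∑ k ∈ (f n).2, ((atomP E k).comp B.flip).flip (e n k)
  have hφ : ∀ n y, φ n y = ∑ k ∈ (f n).2, atomP E k (B.flip y) (e n k) := by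
    intro n y
    simp [φ, sum_apply]
  obtain ⟨n, hn⟩ := hN φ ‖B.flip‖ (fun n => (f n).1) (ε / 2) (by positivity) (fun n => (hf n).1) (by
    intro y s
    simp only [hφ]
    exact (atom_disj_sum (B.flip y) s (fun n => (f n).2) hd e he1).trans (B.flip.le_opNorm y))
  rw [hφ] at hn
  linarith [he2 n]

theorem exists_signs (a : ℕ → ℕ → ℝ) (m : ℕ) : ∃ s : ℕ → ℝ, (∀ i, |s i| = 1) ∧
    ∑ i ∈ Finset.range m, a i i
      ≤ ∑ i ∈ Finset.range m, ∑ j ∈ Finset.range m, s i * s j * a i j := by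
  induction m with
  | zero => exact ⟨fun _ => 1, by simp, by simp⟩
  | succ m ih =>
    obtain ⟨s, hs, h⟩ := ih
    let d := ∑ j ∈ Finset.range m, s j * (a m j + a j m)
    let t : ℝ := if 0 ≤ d then 1 else -1
    have ht : |t| = 1 := by simp only [t]; split_ifs <;> simp
    have ht2 : t * t = 1 := by rw [← abs_mul_abs_self, ht, one_mul]
    have htd : 0 ≤ t * d := by
      simp only [t]
      split_ifs with h
      · linarith
      · linarith
    let s' : ℕ → ℝ := fun i => if i = m then t else s i
    have hsm : s' m = t := by simp [s']
    have hsi : ∀ i ∈ Finset.range m, s' i = s i := by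
      intro i hi
      simp [s', (Finset.mem_range.1 hi).ne]
    refine ⟨s', ?_, ?_⟩
    · intro i
      simp only [s']
      split_ifs
      · exact ht
      · exact hs i
    · have e1 : ∑ i ∈ Finset.range m, ∑ j ∈ Finset.range m, s' i * s' j * a i j
          = ∑ i ∈ Finset.range m, ∑ j ∈ Finset.range m, s i * s j * a i j :=
        Finset.sum_congr rfl fun i hi => Finset.sum_congr rfl fun j hj => by
          rw [hsi i hi, hsi j hj]
      have e2 : ∑ i ∈ Finset.range m, s' i * s' m * a i m + ∑ j ∈ Finset.range m, s' m * s' j * a m j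
          = t * d := by
        rw [← Finset.sum_add_distrib, Finset.mul_sum]
        refine Finset.sum_congr rfl fun i hi => ?_
        rw [hsi i hi, hsm]; ring
      have e3 : s' m * s' m * a m m = a m m := by rw [hsm, ht2, one_mul]
      rw [Finset.sum_range_succ, Finset.sum_range_succ]
      simp only [Finset.sum_range_succ (n := m)]
      rw [Finset.sum_add_distrib]
      linarith

theorem NN_CKE (hK : Scattered K) (hN : NN E) : NN C(K, E) := by
  classical
  intro μ M f ε hε hf hM
  by_contra hcon
  push Not at hcon
  -- norms of signed sums
  have hM' : ∀ (f : C(K, E)) (s : Finset ℕ), ∑ n ∈ s, |μ n f| ≤ |M| * ‖f‖ := fun f s =>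
    (hM f s).trans (mul_le_mul_of_nonneg_right (le_abs_self M) (norm_nonneg _))
  have hsum : ∀ (s : Finset ℕ) (c : ℕ → ℝ), (∀ i, |c i| ≤ 1) → ‖∑ n ∈ s, c n • μ n‖ ≤ |M| := by
    intro s c hc
    refine ContinuousLinearMap.opNorm_le_bound _ (abs_nonneg _) fun f => ?_
    refine le_trans ?_ (hM' f s)
    have : (∑ n ∈ s, c n • μ n) f = ∑ n ∈ s, c n * μ n f := by simp [sum_apply]
    rw [this, Real.norm_eq_abs]
    refine (Finset.abs_sum_le_sum_abs _ _).trans (Finset.sum_le_sum fun n _ => ?_)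
    rw [abs_mul]
    exact mul_le_of_le_one_left (abs_nonneg _) (hc n)
  have hlow : ∀ n, ε ≤ ‖μ n‖ := fun n =>
    (hcon n).trans ((le_abs_self _).trans (((μ n).le_opNorm _).trans
      (mul_le_of_le_one_right (norm_nonneg _) (hf n))))
  have hatom : ∀ k : K, Tendsto (fun n => ‖atomP E k (μ n)‖) atTop (𝓝 0) := by
    intro k
    refine hN.tendsto (fun n => atomP E k (μ n)) |M| fun y s => ?_
    let c : ℕ → ℝ := fun n => if 0 ≤ atomP E k (μ n) y then 1 else -1
    have hc : ∀ i, |c i| ≤ 1 := by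
      intro i; simp only [c]; split_ifs <;> simp
    have e1 : ∑ n ∈ s, |atomP E k (μ n) y| = atomP E k (∑ n ∈ s, c n • μ n) y := by
      rw [map_sum, sum_apply]
      refine Finset.sum_congr rfl fun n _ => ?_
      rw [map_smul]
      simp only [c, ContinuousLinearMap.smul_apply, smul_eq_mul]
      split_ifs with h
      · rw [abs_of_nonneg h, one_mul]
      · rw [abs_of_neg (not_le.1 h)]; ring
    rw [e1]
    have h1 := atom_norm_sum_le (∑ n ∈ s, c n • μ n) {k}
    rw [Finset.sum_singleton] at h1
    exact (le_abs_self _).trans ((ContinuousLinearMap.le_opNorm _ _).trans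
      (mul_le_mul_of_nonneg_right (h1.trans (hsum s c hc)) (norm_nonneg _)))
  have key : ∀ (A : Finset K) (N : ℕ), ∃ n, N < n ∧ ∃ A' : Finset K, Disjoint A A' ∧
      ε / 2 < ∑ k ∈ A', ‖atomP E k (μ n)‖ := by
    intro A N
    have ht : Tendsto (fun n => ∑ k ∈ A, ‖atomP E k (μ n)‖) atTop (𝓝 0) := by
      simpa using tendsto_finsetSum A fun k _ => hatom k
    obtain ⟨n, hn, hnN⟩ := ((ht.eventually_lt_const (show (0 : ℝ) < ε / 2 by positivity)).and
      (eventually_gt_atTop N)).exists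
    refine ⟨n, hnN, atom_exists_disjoint hK (μ n) (ε / 2) A ?_⟩
    have h1 : ‖∑ k ∈ A, (atomP E k (μ n)).comp (evE E k)‖ ≤ ∑ k ∈ A, ‖atomP E k (μ n)‖ :=
      (norm_sum_le _ _).trans (Finset.sum_le_sum fun k _ =>
        (ContinuousLinearMap.opNorm_comp_le _ _).trans
          (mul_le_of_le_one_right (norm_nonneg _) (evE_norm_le k)))
    have h2 := norm_sub_norm_le (μ n) (∑ k ∈ A, (atomP E k (μ n)).comp (evE E k))
    linarith [hlow n]
  obtain ⟨p, hp, hr⟩ := exists_seq_of_forall_finset_exists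
    (fun p : ℕ × Finset K => ε / 2 < ∑ k ∈ p.2, ‖atomP E k (μ p.1)‖)
    (fun p q => p.1 < q.1 ∧ Disjoint p.2 q.2) (by
      intro s _
      obtain ⟨n, hn, A', hA, hA'⟩ := key (s.biUnion fun p => p.2) (s.sup fun p => p.1)
      refine ⟨(n, A'), hA', fun x hx => ⟨?_, ?_⟩⟩
      · exact (Finset.le_sup (f := fun p : ℕ × Finset K => p.1) hx).trans_lt hn
      · exact Finset.disjoint_of_subset_left
          (Finset.subset_biUnion_of_mem (fun p : ℕ × Finset K => p.2) hx) hA)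
  choose e he1 he2 using fun n => exists_sel (μ (p n).1) (p n).2 _ (hp n)
  have hmono : StrictMono fun i => (p i).1 := fun i j hij => (hr i j hij).1
  let a : ℕ → ℕ → ℝ := fun i j => ∑ k ∈ (p j).2, atomP E k (μ (p i).1) (e j k)
  have hb : ∀ m : ℕ, m * (ε / 2) ≤ |M| := by
    intro m
    obtain ⟨s, hs, h⟩ := exists_signs a m
    let ν : C(K, E) →L[ℝ] ℝ := ∑ i ∈ Finset.range m, s i • μ (p i).1
    have hν : ‖ν‖ ≤ |M| := by
      have := hsum ((Finset.range m).map ⟨_, hmono.injective⟩)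
        (fun n => s (Function.invFun (fun i => (p i).1) n)) (fun i => (hs _).le)
      rw [Finset.sum_map] at this
      simp only [Function.Embedding.coeFn_mk] at this
      have h3 : ∀ i, Function.invFun (fun i => (p i).1) (p i).1 = i :=
        Function.leftInverse_invFun hmono.injective
      simp only [h3] at this
      exact this
    have h1 := atom_disj_sum ν (Finset.range m) (fun n => (p n).2) (fun i j h => (hr i j h).2) e he1
    have h2 : ∀ j, ∑ k ∈ (p j).2, atomP E k ν (e j k)
        = ∑ i ∈ Finset.range m, s i * a i j := by
      intro j
      simp only [a, Finset.mul_sum]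
      rw [Finset.sum_comm]
      refine Finset.sum_congr rfl fun k _ => ?_
      simp [ν, sum_apply]
    have h4 : ∑ i ∈ Finset.range m, ∑ j ∈ Finset.range m, s i * s j * a i j
        ≤ ∑ j ∈ Finset.range m, |∑ k ∈ (p j).2, atomP E k ν (e j k)| := by
      rw [Finset.sum_comm]
      refine Finset.sum_le_sum fun j _ => ?_
      rw [h2 j]
      have : ∑ i ∈ Finset.range m, s i * s j * a i j
          = s j * ∑ i ∈ Finset.range m, s i * a i j := by
        rw [Finset.mul_sum]
        exact Finset.sum_congr rfl fun i _ => by ring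
      rw [this]
      refine (le_abs_self _).trans ?_
      rw [abs_mul, hs j, one_mul]
    have h5 : m * (ε / 2) ≤ ∑ i ∈ Finset.range m, a i i := by
      have := Finset.card_nsmul_le_sum (Finset.range m) (fun i => a i i) (ε / 2)
        (fun i _ => (he2 i).le)
      simpa using this
    linarith
  obtain ⟨m, hm⟩ := exists_nat_gt (|M| / (ε / 2))
  rw [div_lt_iff₀ (by positivity)] at hm
  linarith [hb m]

end Part4

/-- for scattered compact `K`, `E` has Property (w) iff `C(K,E)` does. -/
theorem statement15 {K : Type*} [TopologicalSpace K] [CompactSpace K] [T2Space K]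
    [Nonempty K] (hK : Scattered K)
    {E : Type*} [NormedAddCommGroup E] [NormedSpace ℝ E] [CompleteSpace E] :
    PropertyW E ↔ PropertyW C(K, E) := by
  rw [propertyW_iff, propertyW_iff]
  constructor
  · intro h
    have hN : NN E := NN_of_AR h
    have hN' : NN C(K, E) := NN_CKE hK hN
    have h1 : ∀ B : C(K, E) →L[ℝ] E →L[ℝ] ℝ, AR B := AR_CKE hK hN h
    have h2 : ∀ B : E →L[ℝ] C(K, E) →L[ℝ] ℝ, AR B := fun B => (h1 B.flip).flip
    exact AR_CKE hK hN' h2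
  · intro h B
    obtain ⟨k⟩ := ‹Nonempty K›
    let i : E →L[ℝ] C(K, E) := mulE K E 1
    have h1 : AR (((B.comp (evE E k)).flip.comp (evE E k)).flip) := h _
    have h2 := ((h1.pullback i).flip.pullback i).flip
    convert h2 using 1
    ext x y
    simp [i]
end

section
/- Let K be a scattered compact Hausdorff space and let E be a Banach space with Property (w). Then every bounded linear operator from C(K,E) into E' is weakly compact. -/
open Filter Topology

open Pointwise in
theorem aux_weak_nhds {Y : Type*} [NormedAddCommGroup Y] [NormedSpace ℝ Y] {ι : Type*}
    (l : Filter ι) (u : ι → WeakSpace ℝ Y) (y : WeakSpace ℝ Y) :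
    Tendsto u l (𝓝 y) ↔ ∀ f : Y →L[ℝ] ℝ,
      Tendsto (fun i => f ((toWeakSpace ℝ Y).symm (u i))) l
        (𝓝 (f ((toWeakSpace ℝ Y).symm y))) := by
  have hind : IsInducing (fun (x : WeakSpace ℝ Y) (f : Y →L[ℝ] ℝ) =>
      f ((toWeakSpace ℝ Y).symm x)) := ⟨rfl⟩
  rw [hind.tendsto_nhds_iff, tendsto_pi_nhds]
  rfl

def RWC {Y : Type*} [NormedAddCommGroup Y] [NormedSpace ℝ Y] (A : Set Y) : Prop :=
  IsCompact (closure (toWeakSpace ℝ Y '' A))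

theorem RWC.limit {Y : Type*} [NormedAddCommGroup Y] [NormedSpace ℝ Y] {A : Set Y}
    (hA : RWC A) {ι : Type*} (l : Ultrafilter ι) (u : ι → Y) (hu : ∀ᶠ i in l, u i ∈ A) :
    ∃ y, ∀ f : Y →L[ℝ] ℝ, Tendsto (fun i => f (u i)) l (𝓝 (f y)) := by
  obtain ⟨y, -, hy⟩ := (isCompact_iff_ultrafilter_le_nhds.1 hA)
    (l.map (fun i => toWeakSpace ℝ Y (u i))) (by
      rw [le_principal_iff]
      show ∀ᶠ i in (l : Filter ι), toWeakSpace ℝ Y (u i) ∈ closure (toWeakSpace ℝ Y '' A)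
      filter_upwards [hu] with i hi
      exact subset_closure ⟨_, hi, rfl⟩)
  refine ⟨(toWeakSpace ℝ Y).symm y, fun f => ?_⟩
  have := (aux_weak_nhds (l : Filter ι) (fun i => toWeakSpace ℝ Y (u i)) y).1 hy f
  simpa using this

theorem RWC.mono {Y : Type*} [NormedAddCommGroup Y] [NormedSpace ℝ Y] {A B : Set Y}
    (hB : RWC B) (h : A ⊆ B) : RWC A :=
  hB.of_isClosed_subset isClosed_closure (closure_mono (Set.image_mono h))

open Pointwise in
theorem RWC.add {Y : Type*} [NormedAddCommGroup Y] [NormedSpace ℝ Y] {A B : Set Y}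
    (hA : RWC A) (hB : RWC B) : RWC (A + B) := by
  have h : IsCompact (closure (toWeakSpace ℝ Y '' A) + closure (toWeakSpace ℝ Y '' B)) :=
    IsCompact.add hA hB
  refine h.closure_of_subset ?_
  rw [Set.image_add]
  exact Set.add_subset_add subset_closure subset_closure

open Pointwise in
theorem RWC.of_approx {Y : Type*} [NormedAddCommGroup Y] [NormedSpace ℝ Y] [CompleteSpace Y]
    {A : Set Y} (h : ∀ ε : ℝ, 0 < ε → ∃ W : Set Y, RWC W ∧ A ⊆ W + Metric.closedBall 0 ε) :
    RWC A := by
  set tw := toWeakSpace ℝ Y with htw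
  have key : ∀ ε : ℝ, 0 < ε → ∃ W : Set Y, RWC W ∧
      ∀ x ∈ closure (tw '' A), ∃ w ∈ W, ‖tw.symm x - w‖ ≤ ε := by
    intro ε hε
    obtain ⟨W, hW, hAW⟩ := h ε hε
    have hcl : IsClosed (tw '' (Metric.closedBall (0:Y) ε)) := by
      have := (convex_closedBall (0:Y) ε).toWeakSpace_closure ℝ
      rw [Metric.isClosed_closedBall.closure_eq] at this
      rw [this]; exact isClosed_closure
    have h2 : IsClosed (closure (tw '' W) + tw '' (Metric.closedBall (0:Y) ε)) :=
      hcl.add_left_of_isCompact hW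
    have h3 : closure (tw '' A) ⊆ closure (tw '' W) + tw '' (Metric.closedBall (0:Y) ε) := by
      refine closure_minimal ?_ h2
      refine (Set.image_mono hAW).trans ?_
      rw [Set.image_add]
      exact Set.add_subset_add subset_closure le_rfl
    refine ⟨tw.symm '' closure (tw '' W), ?_, ?_⟩
    · show IsCompact (closure (tw '' (tw.symm '' closure (tw '' W))))
      rw [Set.image_image]
      simp only [LinearEquiv.apply_symm_apply, Set.image_id', closure_closure]
      exact hW
    · intro x hx
      obtain ⟨w, hw, _, ⟨b, hb, rfl⟩, rfl⟩ := h3 hx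
      refine ⟨_, ⟨w, hw, rfl⟩, ?_⟩
      simpa using hb
  have key' : ∀ n : ℕ, ∃ W : Set Y, RWC W ∧
      ∀ x ∈ closure (tw '' A), ∃ w ∈ W, ‖tw.symm x - w‖ ≤ 1 / ((n:ℝ) + 1) :=
    fun n => key _ (by positivity)
  choose W hW hWx using key'
  show IsCompact (closure (tw '' A))
  rw [isCompact_iff_ultrafilter_le_nhds]
  intro l hl
  rw [le_principal_iff] at hl
  choose! w hwW hwn using hWx
  have hlim : ∀ n, ∃ y, ∀ f : Y →L[ℝ] ℝ, Tendsto (fun x => f (w n x)) l (𝓝 (f y)) := by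
    intro n
    refine (hW n).limit l (w n) ?_
    filter_upwards [hl] with x hx using hwW n x hx
  choose y hy using hlim
  have hdist : ∀ n m, ‖y n - y m‖ ≤ 1 / ((n:ℝ)+1) + 1 / ((m:ℝ)+1) := by
    intro n m
    refine NormedSpace.norm_le_dual_bound ℝ _ (by positivity) ?_
    intro f
    have ht : Tendsto (fun x => ‖f (w n x) - f (w m x)‖) l (𝓝 ‖f (y n) - f (y m)‖) :=
      ((hy n f).sub (hy m f)).norm
    rw [map_sub]
    refine le_of_tendsto ht ?_
    filter_upwards [hl] with x hx
    rw [← map_sub]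
    refine (f.le_opNorm _).trans ?_
    rw [mul_comm]
    gcongr
    have h1 := hwn n x hx
    have h2 := hwn m x hx
    calc ‖w n x - w m x‖ = ‖(tw.symm x - w m x) - (tw.symm x - w n x)‖ := by congr 1; abel
      _ ≤ _ := norm_sub_le _ _
      _ ≤ _ := by linarith
  have hcau : CauchySeq y := by
    refine cauchySeq_of_le_tendsto_0' (fun n : ℕ => 2 * (1 / ((n:ℝ)+1))) ?_ ?_
    · intro n m hnm
      rw [dist_eq_norm]
      refine (hdist n m).trans ?_
      have : 1 / ((m:ℝ)+1) ≤ 1 / ((n:ℝ)+1) := by gcongr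
      linarith
    · simpa using (tendsto_one_div_add_atTop_nhds_zero_nat (𝕜 := ℝ)).const_mul 2
  obtain ⟨y0, hy0⟩ := cauchySeq_tendsto_of_complete hcau
  have hconv : (l : Filter _) ≤ 𝓝 (tw y0) := by
    have : Tendsto id (l : Filter (WeakSpace ℝ Y)) (𝓝 (tw y0)) := by
      rw [aux_weak_nhds]
      intro f
      rw [Metric.tendsto_nhds]
      intro ε hε
      have e1 : ∀ᶠ n : ℕ in atTop, ‖f‖ * (1 / ((n:ℝ)+1)) < ε / 3 := by
        have := (tendsto_one_div_add_atTop_nhds_zero_nat (𝕜 := ℝ)).const_mul ‖f‖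
        rw [mul_zero] at this
        exact this.eventually (gt_mem_nhds (by positivity))
      have e2 : ∀ᶠ n : ℕ in atTop, dist (f (y n)) (f y0) < ε / 3 :=
        (Metric.tendsto_nhds.1 ((f.continuous.tendsto y0).comp hy0)) _ (by positivity)
      obtain ⟨n, hn1, hn2⟩ := (e1.and e2).exists
      filter_upwards [hl, Metric.tendsto_nhds.1 (hy n f) (ε/3) (by positivity)] with x hx hx2
      have h3 : dist (f (tw.symm x)) (f (w n x)) < ε / 3 := by
        rw [dist_eq_norm, ← map_sub]
        refine lt_of_le_of_lt ((f.le_opNorm _).trans ?_) hn1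
        gcongr
        exact hwn n x hx
      have h4 := dist_triangle4 (f (tw.symm x)) (f (w n x)) (f (y n)) (f y0)
      simp only [id, ← htw, LinearEquiv.symm_apply_apply]
      linarith
    exact this
  exact ⟨tw y0, isClosed_closure.mem_of_tendsto (tendsto_id.mono_right hconv) hl, hconv⟩

theorem rosenthal_aux (ε : ℝ) (hε : 0 ≤ ε) (k : ℕ) : ∀ a : ℕ → ℕ → ℝ, (∀ n m, 0 ≤ a n m) →
    (∀ (F : Finset ℕ) m, ∑ n ∈ F, a n m ≤ k * ε) →
    ∃ g : ℕ → ℕ, Function.Injective g ∧ ∀ m (F : Finset ℕ), m ∉ F →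
      ∑ n ∈ F, a (g n) (g m) ≤ ε := by
  induction k with
  | zero =>
    intro a ha h
    refine ⟨id, Function.injective_id, fun m F _ => ?_⟩
    have h0 := h F m
    simp at h0 ⊢; linarith
  | succ k ih =>
    intro a ha h
    by_cases hp : ∃ p : ℕ, ∀ m (F : Finset ℕ), m ∉ F →
      ∑ n ∈ F, a (Nat.pair p n) (Nat.pair p m) ≤ ε
    · obtain ⟨p, hp⟩ := hp
      refine ⟨fun n => Nat.pair p n, fun i j hij => ?_, hp⟩
      exact (Nat.pair_eq_pair.1 hij).2
    · push Not at hp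
      choose m F hmF hF using hp
      have hinj : Function.Injective (fun p => Nat.pair p (m p)) :=
        fun i j hij => (Nat.pair_eq_pair.1 hij).1
      obtain ⟨g, hg, hg2⟩ := ih (fun n q => a (Nat.pair n (m n)) (Nat.pair q (m q)))
        (fun _ _ => ha _ _) (by
          intro G q
          have hdis : Disjoint (G.image (fun p => Nat.pair p (m p)))
              ((F q).image (fun n => Nat.pair q n)) := by
            rw [Finset.disjoint_left]
            intro x hx hx2
            obtain ⟨p, _, rfl⟩ := Finset.mem_image.1 hx
            obtain ⟨n, hn, hnp⟩ := Finset.mem_image.1 hx2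
            obtain ⟨rfl, rfl⟩ := Nat.pair_eq_pair.1 hnp
            exact hmF _ hn
          have := h (G.image (fun p => Nat.pair p (m p)) ∪ (F q).image (fun n => Nat.pair q n))
            (Nat.pair q (m q))
          rw [Finset.sum_union hdis, Finset.sum_image (fun _ _ _ _ h => hinj h),
            Finset.sum_image (fun _ _ _ _ h => (Nat.pair_eq_pair.1 h).2)] at this
          have h2 := hF q
          push_cast at this
          linarith)
      exact ⟨fun n => Nat.pair (g n) (m (g n)), fun i j hij => hg (hinj hij), hg2⟩

theorem wuc_contra {E : Type*} [NormedAddCommGroup E] [NormedSpace ℝ E] (hE : PropertyW E)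
    (y : ℕ → (E →L[ℝ] ℝ)) (e : ℕ → E) (M B : ℝ) (hM : 0 ≤ M)
    (hy : ∀ (F : Finset ℕ) x, ∑ n ∈ F, |y n x| ≤ M * ‖x‖)
    (he : ∀ n, ‖e n‖ ≤ B) (hye : ∀ n, y n (e n) = 1)
    (ε : ℝ) (hε : 0 ≤ ε) (hε1 : ε ≤ 1 / 8) (hε2 : ε * M * B ≤ 1 / 8)
    (hoff : ∀ m (F : Finset ℕ), m ∉ F → ∑ n ∈ F, |y n (e m)| ≤ ε) : False := by
  set s : ℕ → (E →L[ℝ] ℝ) := fun n => ∑ k ∈ Finset.range (n + 1), y k with hs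
  have hsn : ∀ n, ‖s n‖ ≤ M := by
    intro n
    refine ContinuousLinearMap.opNorm_le_bound _ hM fun x => ?_
    rw [hs]; simp only [sum_apply]
    exact (Finset.abs_sum_le_sum_abs _ _).trans (hy _ x)
  have hsum : ∀ x, Summable fun n => y n x • s n := by
    intro x
    refine Summable.of_norm_bounded (g := fun n => |y n x| * M) ?_ ?_
    · exact (summable_of_sum_le (fun n => abs_nonneg _) (fun F => hy F x)).mul_right M
    · intro n
      rw [norm_smul, Real.norm_eq_abs]
      gcongr
      exact hsn n
  have hfin : ∀ (F : Finset ℕ) x, ‖∑ n ∈ F, y n x • s n‖ ≤ (∑ n ∈ F, |y n x|) * M := by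
    intro F x
    refine (norm_sum_le _ _).trans ?_
    rw [Finset.sum_mul]
    refine Finset.sum_le_sum fun n _ => ?_
    rw [norm_smul, Real.norm_eq_abs]
    gcongr
    exact hsn n
  let R : E →L[ℝ] (E →L[ℝ] ℝ) := LinearMap.mkContinuous
    { toFun := fun x => ∑' n, y n x • s n
      map_add' := fun x x' => by
        rw [← (hsum x).tsum_add (hsum x')]
        simp only [map_add, add_smul]
      map_smul' := fun c x => by
        rw [RingHom.id_apply, ← (hsum x).tsum_const_smul]
        simp only [map_smul, smul_assoc] } (M * M) (by
      intro x
      refine le_of_tendsto (hsum x).hasSum.norm (Eventually.of_forall fun F => ?_)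
      refine (hfin F x).trans ?_
      have := hy F x
      nlinarith)
  have hR : ∀ x, HasSum (fun n => y n x • s n) (R x) := fun x => (hsum x).hasSum
  have hRs : ∀ m, ‖R (e m) - s m‖ ≤ ε * M := by
    intro m
    refine le_of_tendsto ((hR (e m)).sub_const (s m) |>.norm) ?_
    filter_upwards [eventually_ge_atTop {m}] with F hF
    have hm : m ∈ F := by simpa using hF
    rw [← Finset.add_sum_erase F _ hm, hye, one_smul, add_sub_cancel_left]
    refine (hfin _ _).trans ?_
    gcongr
    exact hoff m _ (by simp)
  have hse : ∀ n j, |s n (e j) - if j ≤ n then 1 else 0| ≤ 1 / 8 := by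
    intro n j
    have h1 : s n (e j) - (if j ≤ n then 1 else 0)
        = ∑ k ∈ (Finset.range (n+1)).erase j, y k (e j) := by
      rw [hs]; simp only [sum_apply]
      split_ifs with h
      · rw [← Finset.add_sum_erase (Finset.range (n+1)) _ (a := j) (by simp; omega), hye]
        ring
      · rw [Finset.erase_eq_of_notMem (by simp; omega)]; ring
    rw [h1]
    exact (Finset.abs_sum_le_sum_abs _ _).trans ((hoff j _ (by simp)).trans hε1)
  have hRe : ∀ m j, |R (e m) (e j) - if j ≤ m then 1 else 0| ≤ 1 / 4 := by
    intro m j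
    have h1 : |R (e m) (e j) - s m (e j)| ≤ 1 / 8 := by
      have := (R (e m) - s m).le_opNorm (e j)
      rw [sub_apply, Real.norm_eq_abs] at this
      refine this.trans (le_trans ?_ hε2)
      have := he j
      gcongr
      exact hRs m
    have h2 := hse m j
    rw [abs_le] at *
    constructor <;> linarith [h1.1, h1.2, h2.1, h2.2]
  have hBpos : 0 ≤ B := (norm_nonneg _).trans (he 0)
  let l : Ultrafilter ℕ := hyperfilter ℕ
  have hl : (l : Filter ℕ) ≤ atTop := Nat.hyperfilter_le_atTop
  obtain ⟨z, hz⟩ : ∃ z : E →L[ℝ] ℝ, ∀ f : (E →L[ℝ] ℝ) →L[ℝ] ℝ,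
      Tendsto (fun m => f (R ((B + 1)⁻¹ • e m))) l (𝓝 (f z)) := by
    refine RWC.limit (hE R) l _ (Eventually.of_forall fun m => ⟨_, ?_, rfl⟩)
    rw [mem_closedBall_zero_iff, norm_smul, Real.norm_eq_abs, abs_of_nonneg (by positivity)]
    rw [inv_mul_le_iff₀ (by positivity)]
    linarith [he m]
  obtain ⟨ψ, hψ⟩ : ∃ ψ : (E →L[ℝ] ℝ) →L[ℝ] ℝ, ∀ w : E →L[ℝ] ℝ,
      Tendsto (fun j => w (e j)) l (𝓝 (ψ w)) := by
    obtain ⟨ψ, -, hψ⟩ := (isCompact_iff_ultrafilter_le_nhds.1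
      (WeakDual.isCompact_closedBall (𝕜 := ℝ) (E := E →L[ℝ] ℝ) 0 B))
      (l.map fun j => StrongDual.toWeakDual (NormedSpace.inclusionInDoubleDual ℝ E (e j))) (by
        rw [le_principal_iff]
        refine Eventually.of_forall (f := (l : Filter ℕ)) fun j => ?_
        show NormedSpace.inclusionInDoubleDual ℝ E (e j) ∈ Metric.closedBall _ _
        have hj := (NormedSpace.double_dual_bound ℝ E (e j)).trans (he j)
        have h0 := dist_zero_right (E := StrongDual ℝ (StrongDual ℝ E))
          (NormedSpace.inclusionInDoubleDual ℝ E (e j))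
        exact Metric.mem_closedBall.2 (h0.trans_le hj))
    refine ⟨WeakDual.toStrongDual ψ, fun w => ?_⟩
    exact ((WeakDual.eval_continuous w).tendsto ψ).comp hψ
  have hz' : ∀ f : (E →L[ℝ] ℝ) →L[ℝ] ℝ,
      Tendsto (fun m => f (R (e m))) l (𝓝 ((B + 1) * f z)) := by
    intro f
    have := (hz f).const_mul (B + 1)
    refine this.congr fun m => ?_
    rw [map_smul, map_smul, smul_eq_mul, mul_inv_cancel_left₀ (by positivity)]
  have hψR : ∀ m, ψ (R (e m)) ≤ 1 / 4 := by
    intro m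
    refine le_of_tendsto (hψ (R (e m))) ?_
    filter_upwards [hl (eventually_gt_atTop m)] with j hj
    have := hRe m j
    rw [if_neg (by simpa using hj)] at this
    linarith [(abs_le.1 this).2]
  have h1 : (B + 1) * ψ z ≤ 1 / 4 := le_of_tendsto (hz' ψ) (Eventually.of_forall hψR)
  have h2 : ∀ j, 3 / 4 ≤ (B + 1) * z (e j) := by
    intro j
    refine ge_of_tendsto (hz' (NormedSpace.inclusionInDoubleDual ℝ E (e j))) ?_
    filter_upwards [hl (eventually_ge_atTop j)] with m hm
    have := hRe m j
    rw [if_pos (by simpa using hm)] at this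
    rw [NormedSpace.dual_def]
    linarith [(abs_le.1 this).1]
  have h3 : 3 / 4 ≤ (B + 1) * ψ z :=
    ge_of_tendsto ((hψ z).const_mul (B + 1)) (Eventually.of_forall h2)
  linarith

theorem wuc_contra' {E : Type*} [NormedAddCommGroup E] [NormedSpace ℝ E] (hE : PropertyW E)
    (y : ℕ → (E →L[ℝ] ℝ)) (M δ : ℝ) (hM : 0 ≤ M) (hδ : 0 < δ)
    (hy : ∀ (F : Finset ℕ) x, ∑ n ∈ F, |y n x| ≤ M * ‖x‖)
    (hyδ : ∀ n, δ < ‖y n‖) : False := by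
  have : ∀ n, ∃ x, ‖x‖ ≤ δ⁻¹ ∧ y n x = 1 := by
    intro n
    by_contra! hcon
    refine absurd (hyδ n) (not_lt.2 ?_)
    refine ContinuousLinearMap.opNorm_le_bound _ hδ.le fun x => ?_
    by_contra! hx
    have h0 : y n x ≠ 0 := by
      intro h0
      rw [h0, norm_zero] at hx
      exact absurd hx (not_lt.2 (by positivity))
    refine hcon ((y n x)⁻¹ • x) ?_ (by simp [h0])
    rw [norm_smul, norm_inv, inv_mul_le_iff₀ (norm_pos_iff.2 h0), ← div_eq_mul_inv,
      le_div_iff₀ hδ]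
    linarith
  choose e he hye using this
  set ε : ℝ := 1 / (8 * (M * δ⁻¹ + 1)) with hε
  have hεpos : 0 < ε := by positivity
  obtain ⟨k, hk⟩ := exists_nat_ge (M * δ⁻¹ / ε)
  obtain ⟨g, hg, hg2⟩ := rosenthal_aux ε hεpos.le k (fun n m => |y n (e m)|)
    (fun _ _ => abs_nonneg _) (by
      intro F m
      refine (hy F (e m)).trans ?_
      rw [div_le_iff₀ hεpos] at hk
      refine le_trans ?_ hk
      gcongr
      exact he m)
  refine wuc_contra hE (y ∘ g) (e ∘ g) M δ⁻¹ hM ?_ (fun n => he _) (fun n => hye _) ε hεpos.le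
    ?_ ?_ hg2
  · intro F x
    have := hy (F.image g) x
    rwa [Finset.sum_image (fun _ _ _ _ h => hg h)] at this
  · rw [hε]
    gcongr
    have : 0 ≤ M * δ⁻¹ := by positivity
    linarith
  · rw [hε]
    have : 0 ≤ M * δ⁻¹ := by positivity
    rw [mul_assoc, div_mul_eq_mul_div, div_le_div_iff₀ (by positivity) (by positivity)]
    linarith

/-- multiplication of a vector function by a scalar function -/
def mulF {K : Type*} [TopologicalSpace K] {E : Type*} [NormedAddCommGroup E] [NormedSpace ℝ E]
    (φ : C(K, ℝ)) (f : C(K, E)) : C(K, E) := ⟨fun x => φ x • f x, by fun_prop⟩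

theorem disjoint_contra {K : Type*} [TopologicalSpace K] [CompactSpace K]
    {E : Type*} [NormedAddCommGroup E] [NormedSpace ℝ E]
    (hE : PropertyW E) (T : C(K, E) →L[ℝ] (E →L[ℝ] ℝ)) (f : ℕ → C(K, E))
    (hf : ∀ n, ‖f n‖ ≤ 1) (hdis : ∀ n m, m < n → ∀ x, f n x = 0 ∨ f m x = 0)
    (ε : ℝ) (hε : 0 < ε) (hT : ∀ n, ε < ‖T (f n)‖) : False := by
  refine wuc_contra' hE (fun n => T (f n)) ‖T‖ ε T.opNorm_nonneg hε ?_ hT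
  intro F x
  set c : ℕ → ℝ := fun n => SignType.sign (T (f n) x) with hc
  have hc1 : ∀ n, |c n| ≤ 1 := by
    intro n
    simp only [hc]
    rcases SignType.sign (T (f n) x) with _ | _ | _ <;> simp
  have h1 : ∑ n ∈ F, |T (f n) x| = T (∑ n ∈ F, c n • f n) x := by
    rw [map_sum, sum_apply]
    refine Finset.sum_congr rfl fun n _ => ?_
    rw [map_smul, smul_apply, smul_eq_mul, hc]
    exact (sign_mul_self _).symm
  have h2 : ‖∑ n ∈ F, c n • f n‖ ≤ 1 := by
    rw [ContinuousMap.norm_le _ zero_le_one]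
    intro t
    rw [ContinuousMap.coe_sum, Finset.sum_apply]
    by_cases h : ∃ n ∈ F, f n t ≠ 0
    · obtain ⟨n, hn, hnt⟩ := h
      rw [Finset.sum_eq_single n]
      · rw [ContinuousMap.smul_apply, norm_smul]
        exact mul_le_one₀ (hc1 n) (norm_nonneg _) (((f n).norm_coe_le_norm t).trans (hf n))
      · intro m _ hmn
        rw [ContinuousMap.smul_apply]
        have : f m t = 0 := by
          rcases lt_or_gt_of_ne hmn with h | h
          · exact (hdis n m h t).resolve_left hnt
          · exact (hdis m n h t).resolve_right hnt
        rw [this, smul_zero]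
      · exact fun h => absurd hn h
    · push Not at h
      rw [Finset.sum_eq_zero]
      · simp
      · intro n hn
        rw [ContinuousMap.smul_apply, h n hn, smul_zero]
  rw [h1]
  refine (le_abs_self _).trans (((T _).le_opNorm x).trans ?_)
  gcongr
  refine (T.le_opNorm _).trans ?_
  exact mul_le_of_le_one_right T.opNorm_nonneg h2

theorem exists_nhd {K : Type*} [TopologicalSpace K] [CompactSpace K]
    {E : Type*} [NormedAddCommGroup E] [NormedSpace ℝ E]
    (hE : PropertyW E) (T : C(K, E) →L[ℝ] (E →L[ℝ] ℝ)) (C : Set K) (ε : ℝ) (hε : 0 < ε) :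
    ∃ U : Set K, IsOpen U ∧ C ⊆ U ∧ ∀ h : C(K, E), ‖h‖ ≤ 1 → (∀ x ∈ C, h x = 0) →
      (∀ x ∉ U, h x = 0) → ‖T h‖ ≤ ε := by
  by_contra! hcon
  have step : ∀ U : {U : Set K // IsOpen U ∧ C ⊆ U}, ∃ (h : C(K, E))
      (V : {U : Set K // IsOpen U ∧ C ⊆ U}), ‖h‖ ≤ 1 ∧ ε < ‖T h‖ ∧ (∀ x ∉ U.1, h x = 0) ∧
      V.1 ⊆ U.1 ∧ ∀ x ∈ V.1, h x = 0 := by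
    rintro ⟨U, hU, hCU⟩
    obtain ⟨h, h1, hC, hU0, hT⟩ := hcon U hU hCU
    obtain ⟨η, hη, hη2⟩ : ∃ η : ℝ, 0 < η ∧ ‖T‖ * (2 * η) < ‖T h‖ - ε := by
      refine ⟨(‖T h‖ - ε) / (2 * (‖T‖ + 1)), ?_, ?_⟩
      · have : 0 < ‖T h‖ - ε := by linarith
        positivity
      · have h0 : 0 < ‖T h‖ - ε := by linarith
        have : 0 ≤ ‖T‖ := T.opNorm_nonneg
        rw [show ‖T‖ * (2 * ((‖T h‖ - ε) / (2 * (‖T‖ + 1)))) =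
          (‖T‖ * (‖T h‖ - ε)) / (‖T‖ + 1) by field_simp, div_lt_iff₀ (by positivity)]
        linarith
    let θ : C(K, ℝ) := ⟨fun x => min 1 (max 0 ((‖h x‖ - η) / η)), by fun_prop⟩
    have hθ0 : ∀ x, 0 ≤ θ x := fun x => le_min zero_le_one (le_max_left _ _)
    have hθ1 : ∀ x, θ x ≤ 1 := fun x => min_le_left _ _
    have hθs : ∀ x, ‖h x‖ < η → θ x = 0 := by
      intro x hx
      show min 1 (max 0 ((‖h x‖ - η) / η)) = 0
      rw [max_eq_left, min_eq_right zero_le_one]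
      exact div_nonpos_of_nonpos_of_nonneg (by linarith) hη.le
    have hθb : ∀ x, 2 * η ≤ ‖h x‖ → θ x = 1 := by
      intro x hx
      show min 1 (max 0 ((‖h x‖ - η) / η)) = 1
      rw [min_eq_left]
      refine le_max_of_le_right ?_
      rw [le_div_iff₀ hη]; linarith
    refine ⟨mulF θ h, ⟨U ∩ {x | ‖h x‖ < η}, hU.inter (isOpen_lt (by fun_prop) (by fun_prop)),
      fun x hx => ⟨hCU hx, by simp [hC x hx, hη]⟩⟩, ?_, ?_, ?_, Set.inter_subset_left, ?_⟩
    · rw [ContinuousMap.norm_le _ zero_le_one]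
      intro x
      show ‖θ x • h x‖ ≤ 1
      rw [norm_smul, Real.norm_eq_abs, abs_of_nonneg (hθ0 x)]
      exact mul_le_one₀ (hθ1 x) (norm_nonneg _) ((h.norm_coe_le_norm x).trans h1)
    · have h3 : ‖h - mulF θ h‖ ≤ 2 * η := by
        rw [ContinuousMap.norm_le _ (by positivity)]
        intro x
        show ‖h x - θ x • h x‖ ≤ 2 * η
        by_cases hx : 2 * η ≤ ‖h x‖
        · rw [hθb x hx]; simp; positivity
        · rw [show h x - θ x • h x = (1 - θ x) • h x by rw [sub_smul, one_smul], norm_smul,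
            Real.norm_eq_abs, abs_of_nonneg (by linarith [hθ1 x])]
          have := hθ0 x
          have := norm_nonneg (h x)
          nlinarith
      have h4 : ‖T h - T (mulF θ h)‖ ≤ ‖T‖ * (2 * η) := by
        rw [← map_sub]
        refine (T.le_opNorm _).trans ?_
        gcongr
      have h5 := norm_sub_norm_le (T h) (T (mulF θ h))
      linarith
    · intro x hx
      show θ x • h x = 0
      rw [hU0 x hx, smul_zero]
    · intro x hx
      show θ x • h x = 0
      rw [hθs x hx.2, zero_smul]
  choose h V h1 hT h0 hVU hV0 using step
  let U : ℕ → {U : Set K // IsOpen U ∧ C ⊆ U} :=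
    fun n => Nat.rec ⟨Set.univ, isOpen_univ, Set.subset_univ _⟩ (fun _ u => V u) n
  have hUs : ∀ n, U (n + 1) = V (U n) := fun n => rfl
  have hanti : Antitone fun n => (U n).1 := antitone_nat_of_succ_le fun n => by
    rw [hUs]; exact hVU _
  refine disjoint_contra hE T (fun n => h (U n)) (fun n => h1 _) ?_ ε hε (fun n => hT _)
  intro n m hmn x
  by_cases hx : x ∈ (U n).1
  · right
    refine hV0 _ x ?_
    rw [← hUs]
    exact hanti (Nat.succ_le_of_lt hmn) hx
  · left
    exact h0 _ x hx

theorem good_sInter {K : Type*} [TopologicalSpace K] [CompactSpace K] [T2Space K]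
    {E : Type*} [NormedAddCommGroup E] [NormedSpace ℝ E]
    (hE : PropertyW E) (T : C(K, E) →L[ℝ] (E →L[ℝ] ℝ)) (c : Set (Set K))
    (hc : IsChain (· ⊆ ·) c) (hne : c.Nonempty) (hcl : ∀ s ∈ c, IsClosed s)
    (hg : ∀ s ∈ c, RWC (T '' {f | ‖f‖ ≤ 1 ∧ ∀ x ∈ s, f x = 0})) :
    RWC (T '' {f | ‖f‖ ≤ 1 ∧ ∀ x ∈ ⋂₀ c, f x = 0}) := by
  refine RWC.of_approx fun ε hε => ?_
  obtain ⟨U, hU, hCU, hT⟩ := exists_nhd hE T (⋂₀ c) ε hε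
  have : Nonempty c := hne.to_subtype
  obtain ⟨⟨s, hs⟩, hsU⟩ := exists_subset_nhds_of_isCompact (V := fun s : c => s.1)
    (by
      intro a b
      rcases hc.total a.2 b.2 with h | h
      · exact ⟨a, subset_rfl, h⟩
      · exact ⟨b, h, subset_rfl⟩)
    (fun i => (hcl i.1 i.2).isCompact) (U := U)
    (fun x hx => hU.mem_nhds (hCU (by rwa [Set.sInter_eq_iInter])))
  obtain ⟨φ, hφ0, hφ1, hφ⟩ := exists_continuous_zero_one_of_isClosed (hcl s hs) hU.isClosed_compl
    (Set.disjoint_compl_right_iff_subset.2 hsU)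
  refine ⟨_, hg s hs, ?_⟩
  rintro _ ⟨f, ⟨hf1, hf0⟩, rfl⟩
  refine ⟨_, ⟨mulF φ f, ⟨?_, ?_⟩, rfl⟩, T (f - mulF φ f), ?_, by simp⟩
  · rw [ContinuousMap.norm_le _ zero_le_one]
    intro x
    show ‖φ x • f x‖ ≤ 1
    rw [norm_smul, Real.norm_eq_abs, abs_of_nonneg (hφ x).1]
    exact mul_le_one₀ (hφ x).2 (norm_nonneg _) ((f.norm_coe_le_norm x).trans hf1)
  · intro x hx
    show φ x • f x = 0
    rw [hφ0 hx]; simp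
  · rw [mem_closedBall_zero_iff]
    refine hT _ ?_ ?_ ?_
    · rw [ContinuousMap.norm_le _ zero_le_one]
      intro x
      show ‖f x - φ x • f x‖ ≤ 1
      rw [show f x - φ x • f x = (1 - φ x) • f x by rw [sub_smul, one_smul], norm_smul,
            Real.norm_eq_abs, abs_of_nonneg (by linarith [(hφ x).2])]
      exact mul_le_one₀ (by linarith [(hφ x).1]) (norm_nonneg _)
        ((f.norm_coe_le_norm x).trans hf1)
    · intro x hx
      show f x - φ x • f x = 0
      rw [hf0 x hx]; simp
    · intro x hx
      show f x - φ x • f x = 0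
      rw [hφ1 hx]; simp

theorem good_step {K : Type*} [TopologicalSpace K] [CompactSpace K] [T2Space K]
    {E : Type*} [NormedAddCommGroup E] [NormedSpace ℝ E]
    (hE : PropertyW E) (T : C(K, E) →L[ℝ] (E →L[ℝ] ℝ)) (C : Set K) (hC : IsClosed C)
    (hg : RWC (T '' {f | ‖f‖ ≤ 1 ∧ ∀ x ∈ C, f x = 0}))
    (p : K) (hp : p ∈ C) (U : Set K) (hU : IsOpen U) (hUC : U ∩ C = {p}) :
    RWC (T '' {f | ‖f‖ ≤ 1 ∧ ∀ x ∈ C \ U, f x = 0}) := by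
  have hpU : p ∈ U := (hUC.symm ▸ Set.mem_singleton p : p ∈ U ∩ C).1
  obtain ⟨φ, hφ0, hφ1, hφ⟩ := exists_continuous_zero_one_of_isClosed
    (hC.sdiff hU) (isClosed_singleton (x := p))
    (by rw [Set.disjoint_singleton_right]; exact fun h => h.2 hpU)
  have hφn : ∀ x (e : E), ‖φ x • e‖ ≤ ‖e‖ := by
    intro x e
    rw [norm_smul, Real.norm_eq_abs, abs_of_nonneg (hφ x).1]
    exact mul_le_of_le_one_left (norm_nonneg _) (hφ x).2
  let S : E →L[ℝ] C(K, E) := LinearMap.mkContinuous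
    { toFun := fun e => mulF φ (ContinuousMap.const K e)
      map_add' := fun a b => by ext x; exact smul_add _ _ _
      map_smul' := fun r a => by ext x; exact smul_comm _ _ _ } 1 (by
      intro e
      rw [ContinuousMap.norm_le _ (by positivity)]
      intro x
      rw [one_mul]
      exact hφn x e)
  have hS : ∀ e x, S e x = φ x • e := fun _ _ => rfl
  refine (RWC.add (hE (T.comp S)) (RWC.add hg hg)).mono ?_
  rintro _ ⟨f, ⟨hf1, hf0⟩, rfl⟩
  have hfp : ‖f p‖ ≤ 1 := (f.norm_coe_le_norm p).trans hf1
  set g : C(K, E) := (1 / 2 : ℝ) • (f - S (f p)) with hgdef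
  have hgm : g ∈ {f : C(K, E) | ‖f‖ ≤ 1 ∧ ∀ x ∈ C, f x = 0} := by
    refine ⟨?_, ?_⟩
    · rw [ContinuousMap.norm_le _ zero_le_one]
      intro x
      show ‖(1 / 2 : ℝ) • (f x - φ x • f p)‖ ≤ 1
      rw [norm_smul]
      have := norm_sub_le (f x) (φ x • f p)
      have := hφn x (f p)
      have := (f.norm_coe_le_norm x).trans hf1
      rw [Real.norm_eq_abs, abs_of_pos (by norm_num)]
      linarith
    · intro x hx
      show (1 / 2 : ℝ) • (f x - φ x • f p) = 0
      by_cases hxU : x ∈ U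
      · have : x = p := by
          have : x ∈ U ∩ C := ⟨hxU, hx⟩
          rwa [hUC] at this
        subst this
        rw [hφ1 rfl]; simp
      · rw [hφ0 ⟨hx, hxU⟩, hf0 x ⟨hx, hxU⟩]; simp
  refine ⟨_, ⟨f p, by simpa using hfp, rfl⟩, _, ⟨_, ⟨g, hgm, rfl⟩, _, ⟨g, hgm, rfl⟩, rfl⟩, ?_⟩
  show T (S (f p)) + (T g + T g) = T f
  rw [← map_add, ← map_add]
  congr 1
  rw [hgdef, ← add_smul]
  norm_num

/-- for scattered compact `K` and `E` with Property (w), every operator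
from `C(K,E)` into `E'` is weakly compact. -/
theorem statement16 {K : Type*} [TopologicalSpace K] [CompactSpace K] [T2Space K]
    (hK : Scattered K)
    {E : Type*} [NormedAddCommGroup E] [NormedSpace ℝ E] [CompleteSpace E]
    (hE : PropertyW E) :
    ∀ T : C(K, E) →L[ℝ] (E →L[ℝ] ℝ), IsWeaklyCompactOperator T := by
  intro T
  let S : Set (Set K) := {C | IsClosed C ∧ RWC (T '' {f | ‖f‖ ≤ 1 ∧ ∀ x ∈ C, f x = 0})}
  have huniv : Set.univ ∈ S := by
    refine ⟨isClosed_univ, ?_⟩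
    have h0 : (T '' {f | ‖f‖ ≤ 1 ∧ ∀ x ∈ Set.univ, f x = 0}) ⊆ {0} := by
      rintro _ ⟨f, ⟨-, hf⟩, rfl⟩
      have : f = 0 := by ext x; simpa using hf x trivial
      simp [this]
    refine RWC.mono (B := {0}) ?_ h0
    show IsCompact (closure (toWeakSpace ℝ (E →L[ℝ] ℝ) '' {0}))
    rw [Set.image_singleton]
    exact isCompact_singleton.closure
  obtain ⟨C, -, hmin⟩ := zorn_superset_nonempty S (by
    intro c hcS hc hne
    exact ⟨⋂₀ c, ⟨isClosed_sInter fun s hs => (hcS hs).1,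
      good_sInter hE T c hc hne (fun s hs => (hcS hs).1) (fun s hs => (hcS hs).2)⟩,
      fun s hs => Set.sInter_subset_of_mem hs⟩) _ huniv
  have hCS : C ∈ S := hmin.prop
  rcases C.eq_empty_or_nonempty with h | h
  · refine RWC.mono hCS.2 ?_
    rintro _ ⟨f, hf, rfl⟩
    refine ⟨f, ⟨by simpa using hf, ?_⟩, rfl⟩
    intro x hx
    rw [h] at hx
    exact hx.elim
  · obtain ⟨p, hp, U, hU, hUC⟩ := hK C h hCS.1
    have hnew : C \ U ∈ S := ⟨hCS.1.sdiff hU, good_step hE T C hCS.1 hCS.2 p hp U hU hUC⟩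
    have hpU : p ∈ U := (hUC.symm ▸ Set.mem_singleton p : p ∈ U ∩ C).1
    exact absurd hpU (hmin.le_of_le hnew Set.sdiff_subset hp).2
end
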